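/- There exists ε > 0 depending only on n, Λ and C₀ with the following property. Assume the blow-up framework with bounded T_i: for each i ∈ ℕ, K_i satisfies (K1) with constant C₀, (K2) with constant Λ and (K3), with K_i(x_i) → n(n−2); each c_i is a constant with c_i → c₀ and c₀ < ε; u_i is a positive solution of the boundary Yamabe system on B₁⁺ with coefficients (K_i, c_i); x_i ∈ cl(ℝⁿ₊) ∩ B(0,1/2) is a selected local maximum point, i.e. M_i := u_i(x_i), Γ_i := M_i^{2/(n−2)}, there is σ_i → 0 with u_i(x_i) ≥ u_i on B(x_i,σ_i) ∩ ℝⁿ₊ and Γ_i·σ_i → ∞, and u_i(x_i) · (min over cl(B_{2/3}⁺) of u_i) > i; moreover T_i := x_{i,n}·Γ_i converges to some T̄ ∈ [0,∞), and with x_i' the orthogonal projection of x_i onto {xₙ = 0}, the rescalings v_i(y) = M_i^{−1}·u_i(x_i' + Γ_i^{−1}y) converge in C²_loc(cl(ℝⁿ₊)) to U(y) = (γ/(γ² + |y − t₀·eₙ|²))^{(n−2)/2}, where γ = (1 + c₀²/(n−2)²)^{−1} if c₀ ≤ 0, γ = 1 if c₀ > 0, and t₀ = γ·c₀/(n−2).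 Then there exists a constant C > 0 such that ‖∇K_i(x_i')‖ · Γ_i^{n−3} ≤ C for all i. -/

import Mathlib

open Metric Set MeasureTheory Filter Topology

noncomputable section

abbrev Euc (n : ℕ) := EuclideanSpace ℝ (Fin n)

/-- Index of the last coordinate. -/
def lastIdx (n : ℕ) (h0 : 0 < n) : Fin n := ⟨n - 1, by omega⟩

/-- The open upper half-space `ℝⁿ₊ = {x : xₙ > 0}`. -/
def upperHalf (n : ℕ) (h0 : 0 < n) : Set (Euc n) := {x | 0 < x (lastIdx n h0)}

/-- The upper half-ball `B_r⁺ = B(0,r) ∩ ℝⁿ₊`. -/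
def halfBall (n : ℕ) (h0 : 0 < n) (r : ℝ) : Set (Euc n) :=
  Metric.ball (0 : Euc n) r ∩ upperHalf n h0

/-- The flat boundary portion `∂'B_r⁺ = B(0,r) ∩ {xₙ = 0}`. -/
def flatBdry (n : ℕ) (h0 : 0 < n) (r : ℝ) : Set (Euc n) :=
  Metric.ball (0 : Euc n) r ∩ {x | x (lastIdx n h0) = 0}

/-- Laplacian (within a set `s`) as the sum of pure second partial derivatives. -/
def lapWithin (n : ℕ) (s : Set (Euc n)) (u : Euc n → ℝ) (x : Euc n) : ℝ :=
  ∑ i : Fin n, iteratedFDerivWithin ℝ 2 u s x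
    ![EuclideanSpace.single i (1 : ℝ), EuclideanSpace.single i (1 : ℝ)]

/-- Normal derivative `∂u/∂xₙ` (within a set `s`). -/
def normalDerivWithin (n : ℕ) (h0 : 0 < n) (s : Set (Euc n)) (u : Euc n → ℝ) (x : Euc n) : ℝ :=
  fderivWithin ℝ u s x (EuclideanSpace.single (lastIdx n h0) (1 : ℝ))

/-- Positive solution of the boundary Yamabe system on `B₁⁺` with coefficients `(K, c)`. -/
def IsYamabeSol (n : ℕ) (h0 : 0 < n) (K c u : Euc n → ℝ) : Prop :=
  ContDiffOn ℝ 2 u (closure (halfBall n h0 1)) ∧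
  (∀ x ∈ closure (halfBall n h0 1), 0 < u x) ∧
  (∀ x ∈ halfBall n h0 1,
    lapWithin n (closure (halfBall n h0 1)) u x
      + K x * u x ^ (((n : ℝ) + 2) / ((n : ℝ) - 2)) = 0) ∧
  (∀ x ∈ flatBdry n h0 1,
    normalDerivWithin n h0 (closure (halfBall n h0 1)) u x
      = c x * u x ^ ((n : ℝ) / ((n : ℝ) - 2)))

/-- Condition (K1) with constant `C₀`. -/
def CondK1 (n : ℕ) (h0 : 0 < n) (C₀ : ℝ) (K : Euc n → ℝ) : Prop :=
  ContDiffOn ℝ (n - 2 : ℕ) K (closure (halfBall n h0 1)) ∧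
  ∀ x ∈ closure (halfBall n h0 1), ∀ j : ℕ, 1 ≤ j → j ≤ n - 2 →
    ‖iteratedFDerivWithin ℝ j K (closure (halfBall n h0 1)) x‖ ≤
      C₀ * ‖iteratedFDerivWithin ℝ 1 K (closure (halfBall n h0 1)) x‖ ^
        (((n : ℝ) - 2 - (j : ℝ)) / ((n : ℝ) - 3))

/-- Condition (K2) with constant `Λ`. -/
def CondK2 (n : ℕ) (h0 : 0 < n) (Λ : ℝ) (K : Euc n → ℝ) : Prop :=
  ∀ x ∈ closure (halfBall n h0 1),
    1 / Λ ≤ K x ∧ ∀ j : ℕ, 1 ≤ j → j ≤ n - 2 →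
      ‖iteratedFDerivWithin ℝ j K (closure (halfBall n h0 1)) x‖ ≤ Λ

/-- Condition (K3): `K` depends only on the first `n - 1` coordinates. -/
def CondK3 (n : ℕ) (h0 : 0 < n) (K : Euc n → ℝ) : Prop :=
  ∀ x ∈ closure (halfBall n h0 1), ∀ y ∈ closure (halfBall n h0 1),
    (∀ i : Fin n, i ≠ lastIdx n h0 → x i = y i) → K x = K y

/-- `C²_loc` convergence of `v i` to `U` on the region `D`: uniform convergence of the
functions and their first and second derivatives on every compact subset of `D`. -/
def TendstoC2LocOn (n : ℕ) (v : ℕ → Euc n → ℝ) (U : Euc n → ℝ) (D : Set (Euc n)) : Prop :=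
  ∀ s : Set (Euc n), IsCompact s → s ⊆ D →
    TendstoUniformlyOn (fun i => v i) U Filter.atTop s ∧
    TendstoUniformlyOn (fun i y => fderivWithin ℝ (v i) D y)
      (fun y => fderivWithin ℝ U D y) Filter.atTop s ∧
    TendstoUniformlyOn (fun i y => iteratedFDerivWithin ℝ 2 (v i) D y)
      (fun y => iteratedFDerivWithin ℝ 2 U D y) Filter.atTop s

section

variable {n : ℕ}

/-- `φ` is differentiable near `x` with derivative having derivative `d` at `x`. -/
def HasSecondDerivAt (φ : ℝ → ℝ) (d x : ℝ) : Prop :=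
  ∃ φ' : ℝ → ℝ, (∀ᶠ t in 𝓝 x, HasDerivAt φ (φ' t) t) ∧ HasDerivAt φ' d x

namespace HasSecondDerivAt

variable {φ ψ : ℝ → ℝ} {d d' x : ℝ}

theorem add (hφ : HasSecondDerivAt φ d x) (hψ : HasSecondDerivAt ψ d' x) :
    HasSecondDerivAt (fun t => φ t + ψ t) (d + d') x := by
  obtain ⟨φ', h1, h2⟩ := hφ
  obtain ⟨ψ', h3, h4⟩ := hψ
  refine ⟨fun t => φ' t + ψ' t, ?_, h2.add h4⟩
  filter_upwards [h1, h3] with t h h' using h.add h'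

theorem sub (hφ : HasSecondDerivAt φ d x) (hψ : HasSecondDerivAt ψ d' x) :
    HasSecondDerivAt (fun t => φ t - ψ t) (d - d') x := by
  obtain ⟨φ', h1, h2⟩ := hφ
  obtain ⟨ψ', h3, h4⟩ := hψ
  refine ⟨fun t => φ' t - ψ' t, ?_, h2.sub h4⟩
  filter_upwards [h1, h3] with t h h' using h.sub h'

theorem const_mul (c : ℝ) (hφ : HasSecondDerivAt φ d x) :
    HasSecondDerivAt (fun t => c * φ t) (c * d) x := by
  obtain ⟨φ', h1, h2⟩ := hφ
  refine ⟨fun t => c * φ' t, ?_, h2.const_mul c⟩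
  filter_upwards [h1] with t h using h.const_mul c

theorem reflect {c : ℝ} (hφ : HasSecondDerivAt φ d (c - x)) :
    HasSecondDerivAt (fun t => φ (c - t)) d x := by
  obtain ⟨φ', h1, h2⟩ := hφ
  refine ⟨fun t => -φ' (c - t), ?_, ?_⟩
  · have hc : Tendsto (fun t : ℝ => c - t) (𝓝 x) (𝓝 (c - x)) :=
      (continuous_const.sub continuous_id).tendsto x
    filter_upwards [hc.eventually h1] with t h
    have h' := h.scomp t ((hasDerivAt_id t).const_sub c)
    simpa [Function.comp_def] using h'
  · have h' : HasDerivAt (fun t => φ' (c - t)) (-d) x := by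
      simpa [Function.comp_def] using h2.scomp x ((hasDerivAt_id x).const_sub c)
    simpa using h'.fun_neg

theorem shift {c : ℝ} (hφ : HasSecondDerivAt φ d (x - c)) :
    HasSecondDerivAt (fun t => φ (t - c)) d x := by
  obtain ⟨φ', h1, h2⟩ := hφ
  refine ⟨fun t => φ' (t - c), ?_, ?_⟩
  · have hc : Tendsto (fun t : ℝ => t - c) (𝓝 x) (𝓝 (x - c)) :=
      (continuous_id.sub continuous_const).tendsto x
    filter_upwards [hc.eventually h1] with t h
    simpa using h.comp_sub_const t c
  · simpa using h2.comp_sub_const x c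

theorem const (c x : ℝ) : HasSecondDerivAt (fun _ => c) 0 x :=
  ⟨fun _ => 0, Eventually.of_forall fun t => hasDerivAt_const t c, hasDerivAt_const x 0⟩

theorem nonneg_of_isLocalMin (hφ : HasSecondDerivAt φ d x) (hmin : IsLocalMin φ x) : 0 ≤ d := by
  obtain ⟨φ', h1, h2⟩ := hφ
  by_contra! hd
  have hder : deriv φ =ᶠ[𝓝 x] φ' := h1.mono fun t h => h.deriv
  have hdd : deriv (deriv φ) x = d := by rw [hder.deriv_eq, h2.deriv]
  have h0 : deriv φ x = 0 := hmin.deriv_eq_zero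
  have hc : ContinuousAt φ x := h1.self_of_nhds.continuousAt
  have hmax := isLocalMax_of_deriv_deriv_neg (by rw [hdd]; exact hd) h0 hc
  have hconst : φ =ᶠ[𝓝 x] fun _ => φ x := by
    filter_upwards [hmin, hmax] with t a b using le_antisymm b a
  have : deriv φ =ᶠ[𝓝 x] fun _ => 0 := by
    have := hconst.deriv
    simpa using this
  have := this.deriv_eq
  rw [hdd] at this
  simp at this
  exact hd.ne this

/-- Chain rule for `F ∘ (cos φ * y + sin φ * w)` at `φ = 0`. -/
theorem comp_rotation {F F' : ℝ → ℝ} {F2 y w : ℝ} (h1 : ∀ᶠ u in 𝓝 y, HasDerivAt F (F' u) u)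
    (h2 : HasDerivAt F' F2 y) :
    HasSecondDerivAt (fun φ => F (Real.cos φ * y + Real.sin φ * w)) (F2 * w ^ 2 - F' y * y) 0 := by
  have hc : ∀ φ : ℝ, HasDerivAt (fun φ => Real.cos φ * y + Real.sin φ * w)
      (-Real.sin φ * y + Real.cos φ * w) φ := fun φ =>
    ((Real.hasDerivAt_cos φ).mul_const y).add ((Real.hasDerivAt_sin φ).mul_const w)
  have hcont : Tendsto (fun φ => Real.cos φ * y + Real.sin φ * w) (𝓝 0) (𝓝 y) := by
    have := (hc 0).continuousAt.tendsto
    simpa using this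
  refine ⟨fun φ => F' (Real.cos φ * y + Real.sin φ * w) * (-Real.sin φ * y + Real.cos φ * w),
    ?_, ?_⟩
  · filter_upwards [hcont.eventually h1] with φ h
    exact h.comp φ (hc φ)
  · have e0 : Real.cos 0 * y + Real.sin 0 * w = y := by simp
    have hF' : HasDerivAt (fun φ => F' (Real.cos φ * y + Real.sin φ * w))
        (F2 * (-Real.sin 0 * y + Real.cos 0 * w)) 0 :=
      HasDerivAt.comp (h₂ := F') 0 (by rw [e0]; exact h2) (hc 0)
    have hs : HasDerivAt (fun φ => -Real.sin φ * y + Real.cos φ * w)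
        (-Real.cos 0 * y + -Real.sin 0 * w) 0 :=
      ((Real.hasDerivAt_sin 0).neg.mul_const y).add ((Real.hasDerivAt_cos 0).mul_const w)
    have := hF'.fun_mul hs
    have e : F2 * w ^ 2 - F' y * y = F2 * (-Real.sin 0 * y + Real.cos 0 * w)
        * (-Real.sin 0 * y + Real.cos 0 * w) + F' (Real.cos 0 * y + Real.sin 0 * w)
        * (-Real.cos 0 * y + -Real.sin 0 * w) := by
      rw [e0]; simp; ring
    rw [e]
    exact this

end HasSecondDerivAt

/-- Cylindrical Laplacian `∂ᵣᵣ + Δ_θ` of `G` at `(r, b j₀)`, tested along the radial line and the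
great circles in the directions of the orthonormal basis `b`. -/
def HasCylLap (b : OrthonormalBasis (Fin n) ℝ (Euc n)) (j₀ : Fin n) (G : ℝ → Euc n → ℝ)
    (r ℓ : ℝ) : Prop :=
  ∃ (α : ℝ) (d : Fin n → ℝ), HasSecondDerivAt (fun t => G t (b j₀)) α r ∧
    (∀ j, j ≠ j₀ →
      HasSecondDerivAt (fun φ => G r (Real.cos φ • b j₀ + Real.sin φ • b j)) (d j) 0) ∧
    ℓ = α + ∑ j ∈ Finset.univ.erase j₀, d j

namespace HasCylLap

variable {b : OrthonormalBasis (Fin n) ℝ (Euc n)} {j₀ : Fin n} {G G' : ℝ → Euc n → ℝ}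
  {r ℓ ℓ' : ℝ}

theorem add (h : HasCylLap b j₀ G r ℓ) (h' : HasCylLap b j₀ G' r ℓ') :
    HasCylLap b j₀ (fun r θ => G r θ + G' r θ) r (ℓ + ℓ') := by
  obtain ⟨α, d, h1, h2, h3⟩ := h
  obtain ⟨α', d', h1', h2', h3'⟩ := h'
  refine ⟨α + α', fun j => d j + d' j, h1.add h1', fun j hj => (h2 j hj).add (h2' j hj), ?_⟩
  rw [h3, h3', Finset.sum_add_distrib]; ring

theorem sub (h : HasCylLap b j₀ G r ℓ) (h' : HasCylLap b j₀ G' r ℓ') :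
    HasCylLap b j₀ (fun r θ => G r θ - G' r θ) r (ℓ - ℓ') := by
  obtain ⟨α, d, h1, h2, h3⟩ := h
  obtain ⟨α', d', h1', h2', h3'⟩ := h'
  refine ⟨α - α', fun j => d j - d' j, h1.sub h1', fun j hj => (h2 j hj).sub (h2' j hj), ?_⟩
  rw [h3, h3', Finset.sum_sub_distrib]; ring

theorem const_mul (c : ℝ) (h : HasCylLap b j₀ G r ℓ) :
    HasCylLap b j₀ (fun r θ => c * G r θ) r (c * ℓ) := by
  obtain ⟨α, d, h1, h2, h3⟩ := h
  refine ⟨c * α, fun j => c * d j, h1.const_mul c, fun j hj => (h2 j hj).const_mul c, ?_⟩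
  rw [h3, ← Finset.mul_sum]; ring

theorem reflect {c : ℝ} (h : HasCylLap b j₀ G (c - r) ℓ) :
    HasCylLap b j₀ (fun r θ => G (c - r) θ) r ℓ := by
  obtain ⟨α, d, h1, h2, h3⟩ := h
  exact ⟨α, d, h1.reflect, h2, h3⟩

theorem shift {c : ℝ} (h : HasCylLap b j₀ G (r - c) ℓ) :
    HasCylLap b j₀ (fun r θ => G (r - c) θ) r ℓ := by
  obtain ⟨α, d, h1, h2, h3⟩ := h
  exact ⟨α, d, h1.shift, h2, h3⟩

theorem nonneg (h : HasCylLap b j₀ G r ℓ)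
    (hmin : ∀ᶠ p : ℝ × Euc n in 𝓝 (r, b j₀), ‖p.2‖ = 1 → G r (b j₀) ≤ G p.1 p.2) : 0 ≤ ℓ := by
  obtain ⟨α, d, h1, h2, h3⟩ := h
  have hα : 0 ≤ α := by
    refine h1.nonneg_of_isLocalMin ?_
    have hc : Tendsto (fun t : ℝ => (t, b j₀)) (𝓝 r) (𝓝 (r, b j₀)) :=
      (continuous_id.prodMk continuous_const).tendsto r
    filter_upwards [hc.eventually hmin] with t ht
    exact ht (b.norm_eq_one j₀)
  have hd : ∀ j, j ≠ j₀ → 0 ≤ d j := by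
    intro j hj
    refine (h2 j hj).nonneg_of_isLocalMin ?_
    have hc : Tendsto (fun φ : ℝ => (r, Real.cos φ • b j₀ + Real.sin φ • b j)) (𝓝 0)
        (𝓝 (r, b j₀)) := by
      have : Continuous (fun φ : ℝ => (r, Real.cos φ • b j₀ + Real.sin φ • b j)) := by fun_prop
      have := this.tendsto 0
      simpa using this
    filter_upwards [hc.eventually hmin] with φ hφ
    have : ‖Real.cos φ • b j₀ + Real.sin φ • b j‖ = 1 := by
      have hor : inner ℝ (b j₀) (b j) = 0 := b.orthonormal.2 (Ne.symm hj)
      have := norm_add_sq_real (Real.cos φ • b j₀) (Real.sin φ • b j)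
      rw [inner_smul_left, inner_smul_right, hor, norm_smul, norm_smul] at this
      rw [b.norm_eq_one, b.norm_eq_one, mul_one, mul_one, Real.norm_eq_abs, Real.norm_eq_abs,
        sq_abs, sq_abs] at this
      have h2 := Real.cos_sq_add_sin_sq φ
      have : ‖Real.cos φ • b j₀ + Real.sin φ • b j‖ ^ 2 = 1 := by
        rw [this, ← h2]; simp
      nlinarith [norm_nonneg (Real.cos φ • b j₀ + Real.sin φ • b j)]
    simpa using hφ this
  rw [h3]
  exact add_nonneg hα (Finset.sum_nonneg fun j hj => hd j (Finset.ne_of_mem_erase hj))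

/-- Cylindrical Laplacian of a function of `r` and `⟪v, θ⟫` only. -/
theorem zonal (hn : 1 ≤ n) (v : Euc n) (hv : ‖v‖ = 1) {Φ : ℝ → ℝ → ℝ} {F' : ℝ → ℝ} {α F2 : ℝ}
    (hr : HasSecondDerivAt (fun t => Φ t (inner ℝ v (b j₀))) α r)
    (h1 : ∀ᶠ u in 𝓝 (inner ℝ v (b j₀)), HasDerivAt (Φ r) (F' u) u)
    (h2 : HasDerivAt F' F2 (inner ℝ v (b j₀))) :
    HasCylLap b j₀ (fun r θ => Φ r (inner ℝ v θ)) r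
      (α + (F2 * (1 - (inner ℝ v (b j₀)) ^ 2)
        - ((n : ℝ) - 1) * (F' (inner ℝ v (b j₀)) * inner ℝ v (b j₀)))) := by
  refine ⟨α, fun j => F2 * (inner ℝ v (b j)) ^ 2 - F' (inner ℝ v (b j₀)) * inner ℝ v (b j₀),
    hr, ?_, ?_⟩
  · intro j hj
    have := HasSecondDerivAt.comp_rotation (w := inner ℝ v (b j)) h1 h2
    simpa [inner_add_right, inner_smul_right] using this
  · congr 1
    have hsum : ∑ j, (inner ℝ v (b j)) ^ 2 = 1 := by
      have := b.sum_sq_norm_inner_left v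
      simpa [hv] using this
    have herase : ∑ j ∈ Finset.univ.erase j₀, (inner ℝ v (b j)) ^ 2
        = 1 - (inner ℝ v (b j₀)) ^ 2 := by
      rw [← hsum, ← Finset.add_sum_erase _ _ (Finset.mem_univ j₀)]; ring
    rw [Finset.sum_sub_distrib, ← Finset.mul_sum, herase, Finset.sum_const,
      Finset.card_erase_of_mem (Finset.mem_univ _)]
    simp [Nat.cast_sub hn]

end HasCylLap

section

variable {b : OrthonormalBasis (Fin n) ℝ (Euc n)} {j₀ : Fin n}

/-- The profile `ρ ↦ ρ^{-(h-g)} (ρ+1)^{-g}`. -/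
def profile (h g ρ : ℝ) : ℝ := ρ ^ (-(h - g)) * (ρ + 1) ^ (-g)

/-- Minus the logarithmic derivative of `profile`. -/
def profileLog (h g ρ : ℝ) : ℝ := (h - g) / ρ + g / (ρ + 1)

theorem profile_pos {h g ρ : ℝ} (hρ : 0 < ρ) : 0 < profile h g ρ := by
  unfold profile; positivity

theorem hasDerivAt_profile {h g ρ : ℝ} (hρ : 0 < ρ) :
    HasDerivAt (profile h g) (-(profile h g ρ * profileLog h g ρ)) ρ := by
  have h1 : HasDerivAt (fun x : ℝ => x ^ (-(h - g))) (-(h - g) * ρ ^ (-(h - g) - 1)) ρ :=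
    Real.hasDerivAt_rpow_const (Or.inl hρ.ne')
  have h2 : HasDerivAt (fun x : ℝ => (x + 1) ^ (-g)) (-g * (ρ + 1) ^ (-g - 1)) ρ := by
    have := (Real.hasDerivAt_rpow_const (p := -g) (x := ρ + 1) (Or.inl (by positivity))).comp_add_const ρ 1
    simpa using this
  have h3 := h1.fun_mul h2
  have e : -(profile h g ρ * profileLog h g ρ) = -(h - g) * ρ ^ (-(h - g) - 1) * (ρ + 1) ^ (-g)
      + ρ ^ (-(h - g)) * (-g * (ρ + 1) ^ (-g - 1)) := by
    rw [Real.rpow_sub_one hρ.ne', Real.rpow_sub_one (by positivity)]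
    unfold profile profileLog
    ring
  rw [e]
  exact h3

theorem hasDerivAt_profileLog {h g ρ : ℝ} (hρ : 0 < ρ) :
    HasDerivAt (profileLog h g) (-((h - g) / ρ ^ 2 + g / (ρ + 1) ^ 2)) ρ := by
  have h1 : HasDerivAt (fun x : ℝ => (h - g) / x) (-(h - g) / ρ ^ 2) ρ := by
    simpa using (hasDerivAt_const ρ (h - g)).fun_div (hasDerivAt_id' ρ) hρ.ne'
  have h2 : HasDerivAt (fun x : ℝ => g / (x + 1)) (-g / (ρ + 1) ^ 2) ρ := by
    simpa using (hasDerivAt_const ρ g).fun_div ((hasDerivAt_id' ρ).add_const 1)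
      (by positivity : ρ + 1 ≠ 0)
  have e : -((h - g) / ρ ^ 2 + g / (ρ + 1) ^ 2) = -(h - g) / ρ ^ 2 + -g / (ρ + 1) ^ 2 := by ring
  rw [e]
  exact h1.fun_add h2

/-- Second derivative of `profile`, divided by `profile`. -/
def profileSnd (h g ρ : ℝ) : ℝ := profileLog h g ρ ^ 2 + (h - g) / ρ ^ 2 + g / (ρ + 1) ^ 2

theorem hasDerivAt_profile_deriv {h g ρ : ℝ} (hρ : 0 < ρ) :
    HasDerivAt (fun x => -(profile h g x * profileLog h g x))
      (profile h g ρ * profileSnd h g ρ) ρ := by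
  have := ((hasDerivAt_profile (h := h) (g := g) hρ).fun_mul
    (hasDerivAt_profileLog (h := h) (g := g) hρ)).fun_neg
  refine this.congr_deriv ?_
  unfold profileSnd
  ring

/-- The key algebraic lower bound for the linearized conformal operator on the profile. -/
theorem profile_operator_bound {h g σ C y ρ : ℝ} (hh : 1 ≤ h) (hg : 0 ≤ g)
    (hσ : 0 < σ) (hσ1 : σ ≤ 1) (hC : 1 ≤ C) (hy : -1 ≤ y) (hy1 : y ≤ 1) (hρ : ρ = C - y + σ) :
    -(6 * (h + 1) ^ 2 * C * (σ / ρ ^ 2 + g / (ρ * (ρ + 1)))) ≤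
      h * (2 - h) - (3 * C + (2 * h - 1) * y) * profileLog h g ρ
        + (C ^ 2 - y ^ 2) * profileSnd h g ρ := by
  have hρσ : σ ≤ ρ := by linarith
  have hρ0 : 0 < ρ := by linarith
  set dl := g / (ρ * (ρ + 1)) with hdl
  have hdl0 : 0 ≤ dl := by positivity
  have hu : profileLog h g ρ = h / ρ - dl := by
    rw [hdl]; unfold profileLog; field_simp; ring
  have hv : h * (h + 1) / ρ ^ 2 - (2 * h + 2) * (dl / ρ) ≤ profileSnd h g ρ := by
    unfold profileSnd
    rw [hu]
    have e1 : (h - g) / ρ ^ 2 + g / (ρ + 1) ^ 2 = h / ρ ^ 2 - 2 * (dl / ρ) + g / (ρ ^ 2 * (ρ + 1) ^ 2) := by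
      rw [hdl]; field_simp; ring
    have e2 : 0 ≤ g / (ρ ^ 2 * (ρ + 1) ^ 2) := by positivity
    have e3 : (h / ρ - dl) ^ 2 = h ^ 2 / ρ ^ 2 - 2 * h * (dl / ρ) + dl ^ 2 := by ring
    have e4 : h * (h + 1) / ρ ^ 2 = h ^ 2 / ρ ^ 2 + h / ρ ^ 2 := by ring
    nlinarith [sq_nonneg dl]
  have hy2 : 0 ≤ C ^ 2 - y ^ 2 := by nlinarith
  have hy3 : C ^ 2 - y ^ 2 ≤ 2 * C * ρ := by nlinarith
  have hcoef : -((2 * h + 2) * C) ≤ 3 * C + (2 * h - 1) * y := by nlinarith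
  have hcoef2 : 3 * C + (2 * h - 1) * y ≤ (2 * h + 2) * C := by nlinarith
  have key1 : h * (2 - h) - (3 * C + (2 * h - 1) * y) * (h / ρ)
      + (C ^ 2 - y ^ 2) * (h * (h + 1) / ρ ^ 2)
      = -(h * σ * (2 * (h + 1) * C - 3 * ρ + (h + 1) * σ)) / ρ ^ 2 := by
    have hy' : y = C + σ - ρ := by linarith
    rw [hy']
    field_simp
    ring
  have key2 : -(3 * h * (h + 1) * C * (σ / ρ ^ 2)) ≤
      -(h * σ * (2 * (h + 1) * C - 3 * ρ + (h + 1) * σ)) / ρ ^ 2 := by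
    have : -(3 * h * (h + 1) * C * (σ / ρ ^ 2)) = -(3 * h * (h + 1) * C * σ) / ρ ^ 2 := by ring
    rw [this]
    refine div_le_div_of_nonneg_right ?_ (by positivity)
    have e : 0 ≤ h * σ := by positivity
    have : 2 * (h + 1) * C - 3 * ρ + (h + 1) * σ ≤ 3 * (h + 1) * C := by nlinarith
    have := mul_le_mul_of_nonneg_left this e
    linarith
  have key3 : (C ^ 2 - y ^ 2) * (h * (h + 1) / ρ ^ 2 - (2 * h + 2) * (dl / ρ))
      ≤ (C ^ 2 - y ^ 2) * profileSnd h g ρ := by gcongr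
  have key4 : (C ^ 2 - y ^ 2) * ((2 * h + 2) * (dl / ρ)) ≤ 2 * C * (2 * h + 2) * dl := by
    have : (C ^ 2 - y ^ 2) * ((2 * h + 2) * (dl / ρ)) ≤ 2 * C * ρ * ((2 * h + 2) * (dl / ρ)) := by
      gcongr
    have e : 2 * C * ρ * ((2 * h + 2) * (dl / ρ)) = 2 * C * (2 * h + 2) * dl := by
      field_simp
    linarith
  have key5 : -((2 * h + 2) * C * dl) ≤ (3 * C + (2 * h - 1) * y) * dl := by nlinarith
  have hX : 0 ≤ C * (σ / ρ ^ 2) := by positivity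
  have hY : 0 ≤ C * dl := by positivity
  rw [hu]
  have f1 : 3 * h * (h + 1) * (C * (σ / ρ ^ 2)) ≤ 6 * (h + 1) ^ 2 * (C * (σ / ρ ^ 2)) := by
    gcongr ?_ * _
    nlinarith
  have f2 : 6 * (h + 1) * (C * dl) ≤ 6 * (h + 1) ^ 2 * (C * dl) := by
    gcongr ?_ * _
    nlinarith
  linarith

/-- The function `sinh t · profile (cosh t - y + σ)`. -/
def testP (k g σ t y : ℝ) : ℝ := Real.sinh t * profile (k + 1) g (Real.cosh t - y + σ)

theorem cosh_sub_add_pos {σ t y : ℝ} (hσ : 0 < σ) (hy1 : y ≤ 1) : 0 < Real.cosh t - y + σ := by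
  linarith [Real.one_le_cosh t]

theorem testP_secondDeriv {k g σ t y : ℝ} (hσ : 0 < σ) (hy1 : y ≤ 1) :
    HasSecondDerivAt (fun t => testP k g σ t y)
      (Real.sinh t * profile (k + 1) g (Real.cosh t - y + σ) *
        (1 - 3 * Real.cosh t * profileLog (k + 1) g (Real.cosh t - y + σ)
          + (Real.cosh t ^ 2 - 1) * profileSnd (k + 1) g (Real.cosh t - y + σ))) t := by
  have hin : ∀ t, HasDerivAt (fun t => Real.cosh t - y + σ) (Real.sinh t) t := fun t => by
    simpa using ((Real.hasDerivAt_cosh t).sub_const y).add_const σ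
  have hpos : ∀ t, 0 < Real.cosh t - y + σ := fun t => cosh_sub_add_pos hσ hy1
  have hF : ∀ t, HasDerivAt (fun t => profile (k + 1) g (Real.cosh t - y + σ))
      (-(profile (k + 1) g (Real.cosh t - y + σ) * profileLog (k + 1) g (Real.cosh t - y + σ))
        * Real.sinh t) t := fun t =>
    HasDerivAt.comp (h₂ := profile (k + 1) g) t (hasDerivAt_profile (hpos t)) (hin t)
  have hF1 : ∀ t, HasDerivAt (fun t => -(profile (k + 1) g (Real.cosh t - y + σ) *
        profileLog (k + 1) g (Real.cosh t - y + σ)))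
      (profile (k + 1) g (Real.cosh t - y + σ) * profileSnd (k + 1) g (Real.cosh t - y + σ)
        * Real.sinh t) t := fun t =>
    HasDerivAt.comp (h₂ := fun x => -(profile (k + 1) g x * profileLog (k + 1) g x)) t
      (hasDerivAt_profile_deriv (hpos t)) (hin t)
  refine ⟨_, Eventually.of_forall fun t => (Real.hasDerivAt_sinh t).fun_mul (hF t), ?_⟩
  have := ((Real.hasDerivAt_cosh t).fun_mul (hF t)).fun_add
    ((Real.hasDerivAt_sinh t).fun_mul ((hF1 t).fun_mul (Real.hasDerivAt_sinh t)))
  refine this.congr_deriv ?_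
  have e : Real.sinh t ^ 2 = Real.cosh t ^ 2 - 1 := by linarith [Real.cosh_sq t]
  linear_combination (Real.sinh t * profile (k + 1) g (Real.cosh t - y + σ) *
    profileSnd (k + 1) g (Real.cosh t - y + σ)) * e

theorem hasSecondDerivAt_exp (c t : ℝ) :
    HasSecondDerivAt (fun t => Real.exp (c * t)) (c ^ 2 * Real.exp (c * t)) t := by
  have h : ∀ t, HasDerivAt (fun t => Real.exp (c * t)) (c * Real.exp (c * t)) t := fun t => by
    have := ((hasDerivAt_id' t).const_mul c).exp
    simpa [mul_comm] using this
  refine ⟨_, Eventually.of_forall h, ?_⟩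
  exact ((h t).const_mul c).congr_deriv (by ring)

theorem HasCylLap.radial {g : ℝ → ℝ} {α r : ℝ} (hg : HasSecondDerivAt g α r) :
    HasCylLap b j₀ (fun r _ => g r) r α :=
  ⟨α, fun _ => 0, hg, fun _ _ => HasSecondDerivAt.const _ _, by simp⟩

theorem HasCylLap.linear (hn : 1 ≤ n) (v : Euc n) (hv : ‖v‖ = 1) {g : ℝ → ℝ} {α r : ℝ}
    (hg : HasSecondDerivAt g α r) :
    HasCylLap b j₀ (fun r θ => inner ℝ v θ * g r) r
      (inner ℝ v (b j₀) * (α - ((n : ℝ) - 1) * g r)) := by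
  have h := HasCylLap.zonal (b := b) (j₀ := j₀) hn v hv (Φ := fun r u => u * g r)
    (F' := fun _ => g r) (F2 := 0) (hg.const_mul (inner ℝ v (b j₀)))
    (Eventually.of_forall fun u => by simpa using (hasDerivAt_id' u).mul_const (g r))
    (hasDerivAt_const _ _)
  convert h using 1
  ring

theorem testP_cylLap {k g σ : ℝ} (hn : 1 ≤ n) (hk : (n : ℝ) = 2 * k + 2) (hσ : 0 < σ)
    (v : Euc n) (hv : ‖v‖ = 1) (t : ℝ) :
    HasCylLap b j₀ (fun t θ => testP k g σ t (inner ℝ v θ)) t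
      (k ^ 2 * testP k g σ t (inner ℝ v (b j₀)) + testP k g σ t (inner ℝ v (b j₀)) *
        ((k + 1) * (2 - (k + 1)) - (3 * Real.cosh t + (2 * (k + 1) - 1) * (inner ℝ v (b j₀)))
          * profileLog (k + 1) g (Real.cosh t - inner ℝ v (b j₀) + σ)
          + (Real.cosh t ^ 2 - (inner ℝ v (b j₀)) ^ 2)
            * profileSnd (k + 1) g (Real.cosh t - inner ℝ v (b j₀) + σ))) := by
  set y : ℝ := inner ℝ v (b j₀) with hy
  have hy1 : y ≤ 1 := by
    have := real_inner_le_norm v (b j₀)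
    rwa [hv, b.norm_eq_one, mul_one] at this
  have hin : ∀ u : ℝ, HasDerivAt (fun u => Real.cosh t - u + σ) (-1) u := fun u => by
    simpa using ((hasDerivAt_id' u).const_sub (Real.cosh t)).add_const σ
  have hev : ∀ᶠ u in 𝓝 y, 0 < Real.cosh t - u + σ := by
    have : ContinuousAt (fun u => Real.cosh t - u + σ) y := (hin y).continuousAt
    exact this.eventually (lt_mem_nhds (cosh_sub_add_pos hσ hy1))
  have h := HasCylLap.zonal (b := b) (j₀ := j₀) hn v hv (Φ := fun t u => testP k g σ t u)
    (testP_secondDeriv (k := k) (g := g) (t := t) hσ hy1)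
    (F' := fun u => Real.sinh t * (-(profile (k + 1) g (Real.cosh t - u + σ)
      * profileLog (k + 1) g (Real.cosh t - u + σ)) * (-1)))
    (F2 := Real.sinh t * (profile (k + 1) g (Real.cosh t - y + σ)
      * profileSnd (k + 1) g (Real.cosh t - y + σ) * (-1) * (-1)))
    (by
      filter_upwards [hev] with u hu
      exact ((hasDerivAt_profile hu).comp u (hin u)).const_mul _)
    ((((hasDerivAt_profile_deriv (cosh_sub_add_pos hσ hy1)).comp y (hin y)).mul_const
      (-1)).const_mul _)
  convert h using 1
  rw [← hy, hk]
  unfold testP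
  ring

end

/-- `e^{-kt}(1 - e^{-t})`. -/
def testT (k t : ℝ) : ℝ := Real.exp ((-k) * t) - Real.exp (-(k + 1) * t)

/-- `e^{kt}(1 - e^{-t})`. -/
def testS (k t : ℝ) : ℝ := Real.exp (k * t) - Real.exp ((k - 1) * t)

/-- `e^{-t} testT k t`. -/
def testT' (k t : ℝ) : ℝ := Real.exp (-(k + 1) * t) - Real.exp (-(k + 2) * t)

/-- `e^{-t} testS k t`. -/
def testS' (k t : ℝ) : ℝ := Real.exp ((k - 1) * t) - Real.exp ((k - 2) * t)

theorem testT'_eq (k t : ℝ) : testT' k t = Real.exp (-t) * testT k t := by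
  unfold testT testT'
  rw [mul_sub, ← Real.exp_add, ← Real.exp_add]
  ring_nf

theorem testS'_eq (k t : ℝ) : testS' k t = Real.exp (-t) * testS k t := by
  unfold testS testS'
  rw [mul_sub, ← Real.exp_add, ← Real.exp_add]
  ring_nf

theorem testT_eq (k t : ℝ) : testT k t = Real.exp ((-k) * t) * (1 - Real.exp (-t)) := by
  unfold testT
  rw [mul_sub, ← Real.exp_add, mul_one]
  ring_nf

theorem testS_eq (k t : ℝ) : testS k t = Real.exp (k * t) * (1 - Real.exp (-t)) := by
  unfold testS
  rw [mul_sub, ← Real.exp_add, mul_one]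
  ring_nf

theorem one_sub_exp_neg_nonneg {t : ℝ} (ht : 0 ≤ t) : 0 ≤ 1 - Real.exp (-t) := by
  have : Real.exp (-t) ≤ 1 := Real.exp_le_one_iff.2 (by linarith)
  linarith

theorem testT_nonneg {k t : ℝ} (ht : 0 ≤ t) : 0 ≤ testT k t := by
  rw [testT_eq]; exact mul_nonneg (Real.exp_pos _).le (one_sub_exp_neg_nonneg ht)

theorem testS_nonneg {k t : ℝ} (ht : 0 ≤ t) : 0 ≤ testS k t := by
  rw [testS_eq]; exact mul_nonneg (Real.exp_pos _).le (one_sub_exp_neg_nonneg ht)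

/-- The comparison function for the method of moving spheres. -/
def testH (k g σ q B D a A ε t y z : ℝ) : ℝ :=
  a * (q * (B * testP k g σ t y - D * testT k t)) + A * testS k t
    + ε * (z * (a * testT' k t + A * testS' k t))

/-- The value of `∂ₜₜ + Δ - k²` on `testP`, divided by `testP`. -/
def testPop (k g σ t y : ℝ) : ℝ :=
  (k + 1) * (2 - (k + 1)) - (3 * Real.cosh t + (2 * (k + 1) - 1) * y)
    * profileLog (k + 1) g (Real.cosh t - y + σ)
    + (Real.cosh t ^ 2 - y ^ 2) * profileSnd (k + 1) g (Real.cosh t - y + σ)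

/-- The value of `∂ₜₜ + Δ - k²` on `testH`. -/
def testHop (k g σ q B D a A ε t y z : ℝ) : ℝ :=
  a * (q * (B * (testP k g σ t y * testPop k g σ t y)
      + D * ((2 * k + 1) * Real.exp (-(k + 1) * t))))
    + A * ((2 * k - 1) * Real.exp ((k - 1) * t))
    + ε * (z * (a * (-((2 * k + 3) * Real.exp (-(k + 2) * t)))
      + A * (-(4 * k) * Real.exp ((k - 1) * t) + (6 * k - 3) * Real.exp ((k - 2) * t))))

theorem testH_cylLap {n : ℕ} {b : OrthonormalBasis (Fin n) ℝ (Euc n)} {j₀ : Fin n}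
    {k g σ : ℝ} (q B D a A ε : ℝ) (hn : 1 ≤ n) (hk : (n : ℝ) = 2 * k + 2) (hσ : 0 < σ)
    (v v' : Euc n) (hv : ‖v‖ = 1) (hv' : ‖v'‖ = 1) (t : ℝ) :
    HasCylLap b j₀ (fun t θ => testH k g σ q B D a A ε t (inner ℝ v θ) (inner ℝ v' θ)) t
      (k ^ 2 * testH k g σ q B D a A ε t (inner ℝ v (b j₀)) (inner ℝ v' (b j₀))
        + testHop k g σ q B D a A ε t (inner ℝ v (b j₀)) (inner ℝ v' (b j₀))) := by
  have hP := testP_cylLap (b := b) (j₀ := j₀) (g := g) hn hk hσ v hv t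
  have hT : HasCylLap b j₀ (fun t _ => testT k t) t _ :=
    HasCylLap.radial ((hasSecondDerivAt_exp (-k) t).sub (hasSecondDerivAt_exp (-(k + 1)) t))
  have hS : HasCylLap b j₀ (fun t _ => testS k t) t _ :=
    HasCylLap.radial ((hasSecondDerivAt_exp k t).sub (hasSecondDerivAt_exp (k - 1) t))
  have hT1 : HasSecondDerivAt (fun t => a * testT' k t) _ t :=
    ((hasSecondDerivAt_exp (-(k + 1)) t).sub (hasSecondDerivAt_exp (-(k + 2)) t)).const_mul a
  have hS1 : HasSecondDerivAt (fun t => A * testS' k t) _ t :=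
    ((hasSecondDerivAt_exp (k - 1) t).sub (hasSecondDerivAt_exp (k - 2) t)).const_mul A
  have hL := (HasCylLap.linear (b := b) (j₀ := j₀) hn v' hv' (hT1.add hS1)).const_mul ε
  have h := ((((hP.const_mul B).sub (hT.const_mul D)).const_mul q).const_mul a).add
    (hS.const_mul A) |>.add hL
  convert h using 1
  · rfl
  rw [hk]
  unfold testH testHop testPop testT testS testT' testS'
  ring

theorem sinh_le_exp {t : ℝ} (ht : 0 ≤ t) : Real.sinh t ≤ Real.exp t * (1 - Real.exp (-t)) := by
  have h1 : Real.exp t * Real.exp (-t) = 1 := by rw [← Real.exp_add]; simp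
  rw [Real.sinh_eq]
  have h2 : 1 ≤ Real.exp t := Real.one_le_exp ht
  have h3 : Real.exp (-t) ≤ 1 := Real.exp_le_one_iff.2 (by linarith)
  have h4 := Real.exp_pos (-t)
  nlinarith

theorem exp_le_two_sinh {t : ℝ} (ht : 0 ≤ t) :
    Real.exp t * (1 - Real.exp (-t)) ≤ 2 * Real.sinh t := by
  have h1 : Real.exp t * Real.exp (-t) = 1 := by rw [← Real.exp_add]; simp
  rw [Real.sinh_eq]
  have h3 : Real.exp (-t) ≤ 1 := Real.exp_le_one_iff.2 (by linarith)
  nlinarith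

theorem half_exp_le_cosh (t : ℝ) : Real.exp t / 2 ≤ Real.cosh t := by
  rw [Real.cosh_eq]; linarith [Real.exp_pos (-t)]

theorem cosh_le_exp {t : ℝ} (ht : 0 ≤ t) : Real.cosh t ≤ Real.exp t := by
  rw [Real.cosh_eq]
  have : Real.exp (-t) ≤ Real.exp t := Real.exp_le_exp.2 (by linarith)
  linarith

theorem exp_rpow_neg (m t : ℝ) : Real.exp t ^ (-m) = Real.exp (-m * t) := by
  rw [← Real.exp_mul]; ring_nf

theorem profile_le {h g ρ : ℝ} (hg : 0 ≤ g) (hρ : 0 < ρ) : profile h g ρ ≤ ρ ^ (-h) := by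
  unfold profile
  have h1 : (ρ + 1) ^ (-g) ≤ ρ ^ (-g) :=
    Real.rpow_le_rpow_of_nonpos hρ (by linarith) (by linarith)
  calc ρ ^ (-(h - g)) * (ρ + 1) ^ (-g) ≤ ρ ^ (-(h - g)) * ρ ^ (-g) := by gcongr
    _ = ρ ^ (-h) := by rw [← Real.rpow_add hρ]; ring_nf

theorem profile_le' {h g ρ : ℝ} (hg : 0 ≤ g) (hρ : 0 < ρ) :
    profile h g ρ ≤ ρ ^ (-h) * ρ ^ g := by
  unfold profile
  have h1 : (ρ + 1) ^ (-g) ≤ 1 :=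
    Real.rpow_le_one_of_one_le_of_nonpos (by linarith) (by linarith)
  calc ρ ^ (-(h - g)) * (ρ + 1) ^ (-g) ≤ ρ ^ (-(h - g)) * 1 := by gcongr
    _ = ρ ^ (-h) * ρ ^ g := by rw [mul_one, ← Real.rpow_add hρ]; ring_nf

theorem le_profile {h g ρ : ℝ} (hgh : g ≤ h) (hρ : 0 < ρ) :
    (ρ + 1) ^ (-h) ≤ profile h g ρ := by
  unfold profile
  have h1 : (ρ + 1) ^ (-(h - g)) ≤ ρ ^ (-(h - g)) :=
    Real.rpow_le_rpow_of_nonpos hρ (by linarith) (by linarith)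
  calc (ρ + 1) ^ (-h) = (ρ + 1) ^ (-(h - g)) * (ρ + 1) ^ (-g) := by
        rw [← Real.rpow_add (by linarith)]; ring_nf
    _ ≤ _ := by gcongr

theorem testP_le {k g σ t y : ℝ} (hk : 1 ≤ k) (hg : 0 ≤ g) (hσ : 0 < σ) (hσ1 : σ ≤ 1)
    (ht : 0 ≤ t) (hy1 : y ≤ 1) : testP k g σ t y ≤ (2 / σ) ^ (k + 1) * testT k t := by
  have hC := Real.one_le_cosh t
  have hρ := cosh_sub_add_pos (t := t) hσ hy1
  have h1 : σ / 2 * Real.exp t ≤ Real.cosh t - y + σ := by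
    have := half_exp_le_cosh t
    nlinarith
  have h2 : profile (k + 1) g (Real.cosh t - y + σ) ≤
      (2 / σ) ^ (k + 1) * Real.exp (-(k + 1) * t) := by
    refine (profile_le hg hρ).trans ?_
    refine (Real.rpow_le_rpow_of_nonpos (by positivity) h1 (by linarith)).trans_eq ?_
    rw [Real.mul_rpow (by positivity) (Real.exp_pos t).le, exp_rpow_neg, Real.rpow_neg (by positivity),
      ← Real.inv_rpow (by positivity), inv_div]
  unfold testP
  calc _ ≤ (Real.exp t * (1 - Real.exp (-t))) * ((2 / σ) ^ (k + 1) * Real.exp (-(k + 1) * t)) :=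
        mul_le_mul (sinh_le_exp ht) h2 (profile_pos hρ).le
          (mul_nonneg (Real.exp_pos _).le (one_sub_exp_neg_nonneg ht))
    _ = (2 / σ) ^ (k + 1) * ((Real.exp t * Real.exp (-(k + 1) * t)) * (1 - Real.exp (-t))) := by ring
    _ = _ := by rw [← Real.exp_add, testT_eq]; ring_nf

theorem le_testP {k g σ t y : ℝ} (hk : 1 ≤ k) (hg1 : g ≤ 1) (hσ : 0 < σ)
    (hσ1 : σ ≤ 1) (ht : 0 ≤ t) (hy : -1 ≤ y) (hy1 : y ≤ 1) :
    testT k t ≤ 2 * 4 ^ (k + 1) * testP k g σ t y := by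
  have hC := Real.one_le_cosh t
  have hρ := cosh_sub_add_pos (t := t) hσ hy1
  have h1 : Real.cosh t - y + σ + 1 ≤ 4 * Real.exp t := by
    have := cosh_le_exp ht
    nlinarith
  have h2 : Real.exp (-(k + 1) * t) ≤ 4 ^ (k + 1) * profile (k + 1) g (Real.cosh t - y + σ) := by
    have h3 := Real.rpow_le_rpow_of_nonpos (by positivity) h1 (by linarith : -(k + 1) ≤ 0)
    rw [Real.mul_rpow (by positivity) (Real.exp_pos t).le, exp_rpow_neg,
      Real.rpow_neg (by positivity)] at h3
    have h4 := h3.trans (le_profile (by linarith : g ≤ k + 1) hρ)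
    have h5 : (0:ℝ) < 4 ^ (k + 1) := by positivity
    rwa [inv_mul_le_iff₀ h5] at h4
  calc testT k t = (Real.exp t * (1 - Real.exp (-t))) * Real.exp (-(k + 1) * t) := by
        rw [testT_eq, mul_right_comm, ← Real.exp_add]; ring_nf
    _ ≤ (2 * Real.sinh t) * (4 ^ (k + 1) * profile (k + 1) g (Real.cosh t - y + σ)) :=
        mul_le_mul (exp_le_two_sinh ht) h2 (Real.exp_pos _).le
          (by linarith [Real.sinh_nonneg_iff.2 ht])
    _ = _ := by unfold testP; ring

theorem testPop_bound {k g σ t y : ℝ} (hk : 1 ≤ k) (hg : 0 ≤ g)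
    (hσ : 0 < σ) (hσ1 : σ ≤ 1) (ht : 0 ≤ t) (hy : -1 ≤ y) (hy1 : y ≤ 1) :
    -(6 * (k + 2) ^ 2 * (Real.sinh t * Real.cosh t * (profile (k + 1) g (Real.cosh t - y + σ) *
      (σ / (Real.cosh t - y + σ) ^ 2
        + g / ((Real.cosh t - y + σ) * (Real.cosh t - y + σ + 1)))))) ≤
      testP k g σ t y * testPop k g σ t y := by
  have h := profile_operator_bound (h := k + 1) (by linarith) hg hσ hσ1 (Real.one_le_cosh t)
    hy hy1 rfl
  have hP : 0 ≤ testP k g σ t y :=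
    mul_nonneg (Real.sinh_nonneg_iff.2 ht) (profile_pos (cosh_sub_add_pos hσ hy1)).le
  have h' := mul_le_mul_of_nonneg_left h hP
  refine le_trans (le_of_eq ?_) h'
  unfold testP
  ring

theorem testPop_bound_near {k g σ t y : ℝ} (hk : 1 ≤ k) (hg : 0 ≤ g) (hg1 : g ≤ 1)
    (hσ : 0 < σ) (hσ1 : σ ≤ 1) (ht : 0 ≤ t) (hy : -1 ≤ y) (hy1 : y ≤ 1)
    (hρ1 : Real.cosh t - y + σ ≤ 1) :
    -(12 * (k + 2) ^ 2 * (σ ^ g + g) * (Real.sinh t * (Real.cosh t - y + σ) ^ (-(k + 2)))) ≤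
      testP k g σ t y * testPop k g σ t y := by
  refine le_trans ?_ (testPop_bound hk hg hσ hσ1 ht hy hy1)
  have hρ := cosh_sub_add_pos (t := t) hσ hy1
  have hC2 : Real.cosh t ≤ 2 := by linarith
  have hC := Real.one_le_cosh t
  set ρ := Real.cosh t - y + σ with hρd
  have hσρ : σ ≤ ρ := by linarith
  have hsinh : 0 ≤ Real.sinh t := Real.sinh_nonneg_iff.2 ht
  have e1 : profile (k + 1) g ρ * (σ / ρ ^ 2 + g / (ρ * (ρ + 1))) ≤
      ρ ^ (-(k + 2)) * (σ ^ g + g) := by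
    have a1 : profile (k + 1) g ρ ≤ ρ ^ (-(k + 2)) * (ρ * ρ ^ g) := by
      refine (profile_le' hg hρ).trans_eq ?_
      have : ρ ^ (-(k + 1)) = ρ ^ (-(k + 2)) * ρ := by
        rw [← Real.rpow_add_one hρ.ne']; ring_nf
      rw [this]; ring
    have a2 : ρ * ρ ^ g * (σ / ρ ^ 2 + g / (ρ * (ρ + 1))) ≤ σ ^ g + g := by
      have b1 : ρ * ρ ^ g * (σ / ρ ^ 2) ≤ σ ^ g := by
        have : ρ ^ (g - 1) ≤ σ ^ (g - 1) :=
          Real.rpow_le_rpow_of_nonpos hσ hσρ (by linarith)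
        calc ρ * ρ ^ g * (σ / ρ ^ 2) = σ * ρ ^ (g - 1) := by
              rw [Real.rpow_sub_one hρ.ne']; field_simp
          _ ≤ σ * σ ^ (g - 1) := by gcongr
          _ = σ ^ g := by rw [Real.rpow_sub_one hσ.ne']; field_simp
      have b2 : ρ * ρ ^ g * (g / (ρ * (ρ + 1))) ≤ g := by
        have : ρ ^ g ≤ 1 := Real.rpow_le_one hρ.le hρ1 hg
        have e : ρ * ρ ^ g * (g / (ρ * (ρ + 1))) = g * (ρ ^ g / (ρ + 1)) := by field_simp
        rw [e]
        have : ρ ^ g / (ρ + 1) ≤ 1 := by rw [div_le_one (by linarith)]; linarith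
        nlinarith
      rw [mul_add]; linarith
    calc _ ≤ ρ ^ (-(k + 2)) * (ρ * ρ ^ g) * (σ / ρ ^ 2 + g / (ρ * (ρ + 1))) := by
          gcongr
      _ = ρ ^ (-(k + 2)) * (ρ * ρ ^ g * (σ / ρ ^ 2 + g / (ρ * (ρ + 1)))) := by ring
      _ ≤ _ := by gcongr
  have e0 : 0 ≤ profile (k + 1) g ρ * (σ / ρ ^ 2 + g / (ρ * (ρ + 1))) :=
    mul_nonneg (profile_pos hρ).le (by positivity)
  have e2 : Real.sinh t * Real.cosh t * (profile (k + 1) g ρ * (σ / ρ ^ 2 + g / (ρ * (ρ + 1))))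
      ≤ Real.sinh t * 2 * (ρ ^ (-(k + 2)) * (σ ^ g + g)) := by gcongr
  have e3 := mul_le_mul_of_nonneg_left e2 (by positivity : 0 ≤ 6 * (k + 2) ^ 2)
  linarith

theorem testPop_bound_far {k g σ t y : ℝ} (hk : 1 ≤ k) (hg : 0 ≤ g)
    (hσ : 0 < σ) (hσ1 : σ ≤ 1) (ht : 0 ≤ t) (hy : -1 ≤ y) (hy1 : y ≤ 1)
    (hρ1 : Real.cosh t ≤ 2 * (Real.cosh t - y + σ)) :
    -(6 * (k + 2) ^ 2 * (σ + g) * (4 ^ (k + 3) * Real.exp (-(k + 1) * t))) ≤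
      testP k g σ t y * testPop k g σ t y := by
  refine le_trans ?_ (testPop_bound hk hg hσ hσ1 ht hy hy1)
  have hρ := cosh_sub_add_pos (t := t) hσ hy1
  have hC := Real.one_le_cosh t
  set ρ := Real.cosh t - y + σ with hρd
  have hsinh : 0 ≤ Real.sinh t := Real.sinh_nonneg_iff.2 ht
  have hsc : Real.sinh t ≤ 2 * ρ := by
    refine le_trans ?_ hρ1
    rw [Real.cosh_eq, Real.sinh_eq]; linarith [Real.exp_pos (-t)]
  have hexp : Real.exp t ≤ 4 * ρ := by linarith [half_exp_le_cosh t]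
  have e1 : profile (k + 1) g ρ ≤ 4 ^ (k + 1) * Real.exp (-(k + 1) * t) := by
    refine (profile_le hg hρ).trans ?_
    have h1 : Real.exp t / 4 ≤ ρ := by linarith
    refine (Real.rpow_le_rpow_of_nonpos (by positivity) h1 (by linarith)).trans_eq ?_
    rw [Real.div_rpow (Real.exp_pos t).le (by positivity), exp_rpow_neg, Real.rpow_neg (by positivity)]
    field_simp
  have e2 : Real.sinh t * Real.cosh t * (σ / ρ ^ 2 + g / (ρ * (ρ + 1))) ≤ 4 * (σ + g) := by
    have a1 : σ / ρ ^ 2 + g / (ρ * (ρ + 1)) ≤ (σ + g) / ρ ^ 2 := by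
      rw [add_div]
      gcongr
      nlinarith
    calc _ ≤ (2 * ρ) * (2 * ρ) * ((σ + g) / ρ ^ 2) := by gcongr
      _ = _ := by field_simp; ring
  have e3 : profile (k + 1) g ρ * (Real.sinh t * Real.cosh t * (σ / ρ ^ 2 + g / (ρ * (ρ + 1))))
      ≤ 4 ^ (k + 1) * Real.exp (-(k + 1) * t) * (4 * (σ + g)) :=
    mul_le_mul e1 e2 (by positivity) (by positivity)
  have e4 := mul_le_mul_of_nonneg_left e3 (by positivity : 0 ≤ 6 * (k + 2) ^ 2)
  have e5 : (4 : ℝ) ^ (k + 3) = 4 ^ (k + 1) * 16 := by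
    rw [show k + 3 = (k + 1) + 2 by ring, Real.rpow_add (by norm_num)]; norm_num
  have e6 : (0:ℝ) ≤ 6 * (k + 2) ^ 2 * (4 ^ (k + 1) * Real.exp (-(k + 1) * t) * (4 * (σ + g))) := by
    positivity
  rw [e5]
  linarith

theorem exp_le_exp_of_coef {c d t : ℝ} (ht : 0 ≤ t) (h : c ≤ d) :
    Real.exp (c * t) ≤ Real.exp (d * t) :=
  Real.exp_le_exp.2 (mul_le_mul_of_nonneg_right h ht)

theorem sinh_mul_exp_le {c t : ℝ} :
    2 * (Real.sinh t * Real.exp (c * t)) ≤ Real.exp ((c + 1) * t) := by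
  have h : Real.exp t * Real.exp (c * t) = Real.exp ((c + 1) * t) := by
    rw [← Real.exp_add]; ring_nf
  rw [Real.sinh_eq]
  nlinarith [Real.exp_pos (-t), Real.exp_pos (c * t)]

/-- The comparison function is a strict supersolution of the linearized problem with source. -/
theorem testHop_add_source_pos {k g σ q Cb c₂ Cs B a A ε E m w dκ t y z : ℝ}
    (hk : 1 ≤ k) (hg : 0 ≤ g) (hg1 : g ≤ 1) (hσ : 0 < σ) (hσ1 : σ ≤ 1) (hq : 0 < q)
    (hCb : 0 < Cb) (hB : 0 ≤ B) (ha : 0 ≤ a) (hE : 0 ≤ E) (hCs : 0 ≤ Cs)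
    (hgood : 4 * (B * (12 * (k + 2) ^ 2 * (σ ^ g + g))) ≤ c₂)
    (hbad : B * (6 * (k + 2) ^ 2 * (σ + g) * 4 ^ (k + 3)) ≤ Cb)
    (hε : 0 ≤ ε) (hεk : 8 * k * ε ≤ 1) (hεq : ε * (2 * k + 3) ≤ q * Cb)
    (hA : 8 * (Cs * E) ≤ A) (hA0 : 0 < A)
    (ht : 0 ≤ t) (hy : -1 ≤ y) (hy1 : y ≤ 1) (hz : 0 ≤ z) (hz1 : z ≤ 1)
    (hw0 : 0 < w) (hwb : y ≤ 1 / 2 → w ≤ Cb * q * Real.exp (-(k + 2) * t))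
    (hws : w ≤ Cs * Real.exp (-(k + 2) * t))
    (hwg : 1 / 2 ≤ y → Real.cosh t - y + σ ≤ 1 →
      c₂ * q * (Real.cosh t - y + σ) ^ (-(k + 2)) ≤ w)
    (hm : Real.sinh t ≤ m) (hm4 : m ≤ 4 * Real.sinh t)
    (hκ : m * (a * (y - 1 / 4) - E * Real.exp ((2 * k - 1) * t)) ≤ dκ) :
    A / 4 * Real.exp ((k - 1) * t) ≤ testHop k g σ q B (10 * Cb) a A ε t y z + dκ * w := by
  have hsinh : 0 ≤ Real.sinh t := Real.sinh_nonneg_iff.2 ht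
  have hm0 : 0 ≤ m := hsinh.trans hm
  set X := Real.exp (-(k + 1) * t) with hX
  set Y := Real.exp ((k - 1) * t) with hY
  have hX0 : 0 < X := Real.exp_pos _
  have hY0 : 0 < Y := Real.exp_pos _
  -- the error term
  have herr : m * (E * Real.exp ((2 * k - 1) * t)) * w ≤ A / 4 * Y := by
    have h1 : Real.exp ((2 * k - 1) * t) * w ≤ Cs * Real.exp ((k - 3) * t) := by
      calc _ ≤ Real.exp ((2 * k - 1) * t) * (Cs * Real.exp (-(k + 2) * t)) := by gcongr
        _ = Cs * (Real.exp ((2 * k - 1) * t) * Real.exp (-(k + 2) * t)) := by ring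
        _ = _ := by rw [← Real.exp_add]; ring_nf
    have h2 : m * (E * (Real.exp ((2 * k - 1) * t) * w)) ≤
        4 * Real.sinh t * (E * (Cs * Real.exp ((k - 3) * t))) := by gcongr
    have h3 := sinh_mul_exp_le (c := k - 3) (t := t)
    have h4 : Real.exp ((k - 3 + 1) * t) ≤ Y := exp_le_exp_of_coef ht (by linarith)
    have h5 : E * Cs * (2 * (Real.sinh t * Real.exp ((k - 3) * t))) ≤ E * Cs * Y := by
      gcongr; linarith
    have h6 : 8 * (Cs * E) * Y ≤ A * Y := by gcongr
    linarith
  -- the `A` part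
  have hApart : A / 2 * Y ≤ A * ((2 * k - 1) * Y) + ε * (z * (A * (-(4 * k) * Y
      + (6 * k - 3) * Real.exp ((k - 2) * t)))) := by
    have h1 : 0 ≤ ε * (z * (A * ((6 * k - 3) * Real.exp ((k - 2) * t)))) := by
      have : 0 ≤ 6 * k - 3 := by linarith
      positivity
    have h2 : ε * z * (A * (4 * k * Y)) ≤ ε * 1 * (A * (4 * k * Y)) := by gcongr
    have h3 : (8 * k * ε) * (A * Y) ≤ 1 * (A * Y) := by gcongr
    have h4 : A * (1 * Y) ≤ A * ((2 * k - 1) * Y) := by gcongr; linarith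
    linarith
  -- the `a` part
  have hapart : 0 ≤ q * (B * (testP k g σ t y * testPop k g σ t y)
      + 10 * Cb * ((2 * k + 1) * X)) - ε * (z * ((2 * k + 3) * Real.exp (-(k + 2) * t)))
      + m * (y - 1 / 4) * w := by
    have h1 : ε * (z * ((2 * k + 3) * Real.exp (-(k + 2) * t))) ≤ q * Cb * X := by
      have h1 : Real.exp (-(k + 2) * t) ≤ X := exp_le_exp_of_coef ht (by linarith)
      calc _ = ε * (2 * k + 3) * (z * Real.exp (-(k + 2) * t)) := by ring
        _ ≤ q * Cb * (1 * X) := by gcongr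
        _ = _ := by ring
    have h3 : q * Cb * X * 30 ≤ q * (10 * Cb * ((2 * k + 1) * X)) := by
      have : q * Cb * X * 10 * 3 ≤ q * Cb * X * 10 * (2 * k + 1) := by gcongr; linarith
      linarith
    have h0 : 0 < q * Cb * X := by positivity
    by_cases hcase : 1 / 2 ≤ y ∧ Real.cosh t - y + σ ≤ 1
    · obtain ⟨hy2, hρ⟩ := hcase
      have hw := hwg hy2 hρ
      have hb := testPop_bound_near hk hg hg1 hσ hσ1 ht hy hy1 hρ
      set R := (Real.cosh t - y + σ) ^ (-(k + 2)) with hR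
      have hR0 : 0 < R := Real.rpow_pos_of_pos (cosh_sub_add_pos hσ hy1) _
      have h4 := mul_le_mul_of_nonneg_left hb (by positivity : 0 ≤ q * B)
      have h5 : Real.sinh t * (1 / 4) * (c₂ * q * R) ≤ m * (y - 1 / 4) * w := by
        have hc : 0 ≤ c₂ * q * R := by
          have : 0 ≤ c₂ := le_trans (by positivity) hgood
          positivity
        have : (1:ℝ) / 4 ≤ y - 1 / 4 := by linarith
        gcongr
      have h6 : 4 * (B * (12 * (k + 2) ^ 2 * (σ ^ g + g))) * (Real.sinh t * q * R) ≤
          c₂ * (Real.sinh t * q * R) := by gcongr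
      linarith
    · have hC := Real.one_le_cosh t
      have hρ : Real.cosh t ≤ 2 * (Real.cosh t - y + σ) := by
        by_cases hy2 : 1 / 2 ≤ y
        · have : 1 < Real.cosh t - y + σ := by
            by_contra! hcon
            exact hcase ⟨hy2, hcon⟩
          linarith
        · push Not at hy2
          linarith
      have hb := testPop_bound_far hk hg hσ hσ1 ht hy hy1 hρ
      have h4 := mul_le_mul_of_nonneg_left hb (by positivity : 0 ≤ q * B)
      have h5 : q * X * (B * (6 * (k + 2) ^ 2 * (σ + g) * 4 ^ (k + 3))) ≤ q * X * Cb := by gcongr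
      have h6 : -(3 * (q * Cb * X)) ≤ m * (y - 1 / 4) * w := by
        by_cases hy2 : 1 / 2 ≤ y
        · have : 0 ≤ m * (y - 1 / 4) * w := by
            have : 0 ≤ y - 1 / 4 := by linarith
            positivity
          linarith
        · push Not at hy2
          have hw := hwb hy2.le
          have e1 : m * (1 / 4 - y) * w ≤
              (4 * Real.sinh t) * (5 / 4) * (Cb * q * Real.exp (-(k + 2) * t)) := by
            by_cases hy3 : 0 ≤ 1 / 4 - y
            · gcongr; linarith
            · have : m * (1 / 4 - y) * w ≤ 0 := by
                have : 0 ≤ m * (y - 1 / 4) * w := by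
                  have : 0 ≤ y - 1 / 4 := by linarith
                  positivity
                linarith
              refine this.trans (by positivity)
          have e2 := sinh_mul_exp_le (c := -(k + 2)) (t := t)
          have e3 : Real.exp ((-(k + 2) + 1) * t) = X := by rw [hX]; ring_nf
          rw [e3] at e2
          have e4 := mul_le_mul_of_nonneg_left e2 (by positivity : 0 ≤ Cb * q)
          linarith
      linarith
  have h7 := mul_le_mul_of_nonneg_right hκ hw0.le
  have h8 := mul_nonneg ha hapart
  unfold testHop
  rw [← hX, ← hY]
  linarith

theorem testH_nonneg {k g σ q B D a A ε t y z : ℝ} (hk : 1 ≤ k) (hg1 : g ≤ 1) (hσ : 0 < σ)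
    (hσ1 : σ ≤ 1) (hq : 0 ≤ q) (hD : 0 ≤ D) (hB : B = 2 * 4 ^ (k + 1) * D) (ha : 0 ≤ a)
    (hA : 0 ≤ A) (hε : 0 ≤ ε) (ht : 0 ≤ t) (hy : -1 ≤ y) (hy1 : y ≤ 1) (hz : 0 ≤ z) :
    0 ≤ testH k g σ q B D a A ε t y z := by
  have h1 := mul_le_mul_of_nonneg_left (le_testP hk hg1 hσ hσ1 ht hy hy1) hD
  have h2 : 0 ≤ B * testP k g σ t y - D * testT k t := by rw [hB]; linarith
  have hT := testT_nonneg (k := k) ht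
  have hS := testS_nonneg (k := k) ht
  have hT' : 0 ≤ testT' k t := by rw [testT'_eq]; positivity
  have hS' : 0 ≤ testS' k t := by rw [testS'_eq]; positivity
  unfold testH
  positivity

theorem testH_le {k g σ q B D a A ε t y z : ℝ} (hk : 1 ≤ k) (hg : 0 ≤ g) (hσ : 0 < σ)
    (hσ1 : σ ≤ 1) (hq : 0 ≤ q) (hD : 0 ≤ D) (hB : 0 ≤ B) (ha : 0 ≤ a)
    (hA : 0 ≤ A) (hε1 : ε ≤ 1) (ht : 0 ≤ t) (hy1 : y ≤ 1) (hz : 0 ≤ z)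
    (hz1 : z ≤ 1) :
    testH k g σ q B D a A ε t y z ≤
      (q * (B * (2 / σ) ^ (k + 1)) + 2) * (a * testT k t + A * testS k t) := by
  have h1 := testP_le hk hg hσ hσ1 ht hy1
  have hT := testT_nonneg (k := k) ht
  have hS := testS_nonneg (k := k) ht
  have he : Real.exp (-t) ≤ 1 := Real.exp_le_one_iff.2 (by linarith)
  have hT' : testT' k t ≤ testT k t := by rw [testT'_eq]; nlinarith [Real.exp_pos (-t)]
  have hS' : testS' k t ≤ testS k t := by rw [testS'_eq]; nlinarith [Real.exp_pos (-t)]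
  have hT0 : 0 ≤ testT' k t := by rw [testT'_eq]; positivity
  have hS0 : 0 ≤ testS' k t := by rw [testS'_eq]; positivity
  have hsum : 0 ≤ a * testT k t + A * testS k t := by positivity
  have h2 : ε * (z * (a * testT' k t + A * testS' k t)) ≤
      1 * (1 * (a * testT k t + A * testS k t)) := by gcongr
  have h3 : a * (q * (B * testP k g σ t y - D * testT k t)) ≤
      a * (q * (B * ((2 / σ) ^ (k + 1) * testT k t))) := by
    have : 0 ≤ D * testT k t := by positivity
    gcongr
    have := mul_le_mul_of_nonneg_left h1 hB
    linarith
  have h4 : 0 ≤ q * (B * (2 / σ) ^ (k + 1)) * (A * testS k t) := by positivity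
  unfold testH
  have : 0 ≤ a * testT k t := by positivity
  linarith

/-- The closed upper unit hemisphere with pole `p`. -/
def hemisphere (p : Euc n) : Set (Euc n) := {θ | ‖θ‖ = 1 ∧ 0 ≤ inner ℝ p θ}

theorem isCompact_hemisphere (p : Euc n) : IsCompact (hemisphere p) := by
  have h : hemisphere p = sphere (0 : Euc n) 1 ∩ {θ | 0 ≤ inner ℝ p θ} := by
    ext θ; simp [hemisphere]
  rw [h]
  exact (isCompact_sphere 0 1).inter_right (isClosed_le continuous_const (by fun_prop))

/-- The region swept by the slices `[α τ, r₁] × hemisphere p`, `τ ∈ [τ₀, τ₁]`. -/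
def sweepDomain (p : Euc n) (τ₀ τ₁ r₁ : ℝ) (α : ℝ → ℝ) : Set (ℝ × ℝ × Euc n) :=
  {x | x.1 ∈ Icc τ₀ τ₁ ∧ x.2.1 ∈ Icc (α x.1) r₁ ∧ x.2.2 ∈ hemisphere p}

theorem isCompact_sweepDomain (p : Euc n) {τ₀ τ₁ r₁ : ℝ} {α : ℝ → ℝ} (hα : Continuous α)
    (hmono : Monotone α) : IsCompact (sweepDomain p τ₀ τ₁ r₁ α) := by
  have h : sweepDomain p τ₀ τ₁ r₁ α =
      (Icc τ₀ τ₁ ×ˢ (Icc (α τ₀) r₁ ×ˢ hemisphere p)) ∩ {x | α x.1 ≤ x.2.1} := by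
    ext ⟨t, r, θ⟩
    simp only [sweepDomain, mem_ofPred_eq, mem_inter_iff, mem_prod, mem_Icc]
    constructor
    · rintro ⟨⟨h1, h2⟩, ⟨h3, h4⟩, h5⟩
      exact ⟨⟨⟨h1, h2⟩, ⟨(hmono h1).trans h3, h4⟩, h5⟩, h3⟩
    · rintro ⟨⟨⟨h1, h2⟩, ⟨h3, h4⟩, h5⟩, h6⟩
      exact ⟨⟨h1, h2⟩, ⟨h6, h4⟩, h5⟩
  rw [h]
  exact (isCompact_Icc.prod (isCompact_Icc.prod (isCompact_hemisphere p))).inter_right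
    (isClosed_le (by fun_prop) (by fun_prop))

/-- Continuity method: a family positive at the initial time and never touching zero from above
stays positive. -/
theorem sweep_pos {p : Euc n} {τ₀ τ₁ r₁ : ℝ} {α : ℝ → ℝ} (hα : Continuous α)
    (hmono : Monotone α) {F : ℝ → ℝ → Euc n → ℝ}
    (hF : ContinuousOn (fun x : ℝ × ℝ × Euc n => F x.1 x.2.1 x.2.2) (sweepDomain p τ₀ τ₁ r₁ α))
    (h0 : ∀ r ∈ Icc (α τ₀) r₁, ∀ θ ∈ hemisphere p, 0 < F τ₀ r θ)
    (htouch : ∀ τ ∈ Ioc τ₀ τ₁, ∀ r ∈ Icc (α τ) r₁, ∀ θ ∈ hemisphere p, F τ r θ = 0 →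
      (∀ r' ∈ Icc (α τ) r₁, ∀ θ' ∈ hemisphere p, 0 ≤ F τ r' θ') → False) :
    ∀ τ ∈ Icc τ₀ τ₁, ∀ r ∈ Icc (α τ) r₁, ∀ θ ∈ hemisphere p, 0 < F τ r θ := by
  by_contra! hcon
  obtain ⟨τ, hτ, r, hr, θ, hθ, hle⟩ := hcon
  set Z := sweepDomain p τ₀ τ₁ r₁ α ∩ (fun x : ℝ × ℝ × Euc n => F x.1 x.2.1 x.2.2) ⁻¹' Iic 0
  have hD := isCompact_sweepDomain p (τ₀ := τ₀) (τ₁ := τ₁) (r₁ := r₁) hα hmono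
  have hZ : IsCompact Z := by
    refine hD.of_isClosed_subset ?_ inter_subset_left
    exact hF.preimage_isClosed_of_isClosed hD.isClosed isClosed_Iic
  have hne : Z.Nonempty := ⟨(τ, r, θ), ⟨hτ, hr, hθ⟩, hle⟩
  obtain ⟨⟨s, r', θ'⟩, ⟨⟨hs, hr', hθ'⟩, hle'⟩, hmin⟩ :=
    hZ.exists_isMinOn hne continuous_fst.continuousOn
  simp only [mem_preimage, mem_Iic] at hs hr' hθ' hle'
  have hs0 : τ₀ < s := by
    rcases hs.1.lt_or_eq with h | h
    · exact h
    · subst h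
      exact absurd hle' (not_le.2 (h0 r' hr' θ' hθ'))
  have hnonneg : ∀ r'' ∈ Icc (α s) r₁, ∀ θ'' ∈ hemisphere p, 0 ≤ F s r'' θ'' := by
    intro r'' hr'' θ'' hθ''
    have hmem : ∀ t ∈ Icc τ₀ s, (t, r'', θ'') ∈ sweepDomain p τ₀ τ₁ r₁ α := fun t ht =>
      ⟨⟨ht.1, ht.2.trans hs.2⟩, ⟨(hmono ht.2).trans hr''.1, hr''.2⟩, hθ''⟩
    have hcont : ContinuousOn (fun t => F t r'' θ'') (Icc τ₀ s) :=
      hF.comp (f := fun t => (t, r'', θ'')) (by fun_prop) hmem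
    have hpos : ∀ t ∈ Ico τ₀ s, 0 ≤ F t r'' θ'' := by
      intro t ht
      by_contra! hneg
      have : (t, r'', θ'') ∈ Z := ⟨hmem t ⟨ht.1, ht.2.le⟩, hneg.le⟩
      exact absurd (hmin this) (not_le.2 ht.2)
    have hcl : s ∈ closure (Ico τ₀ s) := by
      rw [closure_Ico hs0.ne]; exact right_mem_Icc.2 hs0.le
    have hc := (hcont s (right_mem_Icc.2 hs0.le)).mono Ico_subset_Icc_self
    have := hc.mem_closure hcl (t := Ici 0) fun t ht => hpos t ht
    rwa [closure_Ici] at this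
  exact htouch s ⟨hs0, hs.2⟩ r' hr' θ' hθ' (le_antisymm hle' (hnonneg r' hr' θ' hθ')) hnonneg

theorem inner_le_one {p θ : Euc n} (hp : ‖p‖ = 1) (hθ : ‖θ‖ = 1) : inner ℝ p θ ≤ 1 := by
  have := real_inner_le_norm p θ
  rwa [hp, hθ, mul_one] at this

theorem neg_one_le_inner {p θ : Euc n} (hp : ‖p‖ = 1) (hθ : ‖θ‖ = 1) : -1 ≤ inner ℝ p θ := by
  have := neg_le_of_abs_le (abs_real_inner_le_norm p θ)
  rwa [hp, hθ, mul_one] at this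

/-- The auxiliary function `e^{-Nz}` has bounded spherical Laplacian. -/
theorem exp_height_cylLap {b : OrthonormalBasis (Fin n) ℝ (Euc n)} {j₀ : Fin n} (hn : 1 ≤ n)
    {p : Euc n} (hp : ‖p‖ = 1) {N : ℝ} (hN : 0 ≤ N) (hz : 0 ≤ inner ℝ p (b j₀)) (r : ℝ) :
    ∃ ℓ ≤ N ^ 2 + n * N,
      HasCylLap b j₀ (fun _ θ => Real.exp (-N * inner ℝ p θ)) r ℓ := by
  have hd : ∀ u : ℝ, HasDerivAt (fun u => Real.exp (-N * u)) (-N * Real.exp (-N * u)) u :=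
    fun u => by
      have := ((hasDerivAt_id' u).const_mul (-N)).exp
      simpa [mul_comm] using this
  have h := HasCylLap.zonal (b := b) (j₀ := j₀) (r := r) hn p hp
    (Φ := fun _ u => Real.exp (-N * u)) (HasSecondDerivAt.const _ _)
    (Eventually.of_forall hd) ((hd _).const_mul (-N))
  refine ⟨_, ?_, h⟩
  set z : ℝ := inner ℝ p (b j₀)
  have hz1 : z ≤ 1 := inner_le_one hp (b.norm_eq_one j₀)
  have he : Real.exp (-N * z) ≤ 1 := Real.exp_le_one_iff.2 (by nlinarith)
  have he0 := Real.exp_pos (-N * z)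
  have hn1 : (1:ℝ) ≤ n := by exact_mod_cast hn
  have e1 : N ^ 2 * (Real.exp (-N * z) * (1 - z ^ 2)) ≤ N ^ 2 * (1 * 1) := by
    gcongr
    · nlinarith
    · nlinarith
  have e2 : ((n : ℝ) - 1) * (N * (Real.exp (-N * z) * z)) ≤ n * (N * (1 * 1)) := by
    gcongr
    linarith
  linarith

theorem HasDerivWithinAt.nonneg_of_min {φ : ℝ → ℝ} {d : ℝ} (h : HasDerivWithinAt φ d (Ici 0) 0)
    (hmin : ∀ᶠ t in 𝓝[≥] (0 : ℝ), φ 0 ≤ φ t) : 0 ≤ d := by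
  have h1 : Tendsto (slope φ 0) (𝓝[>] 0) (𝓝 d) := by
    have := hasDerivWithinAt_iff_tendsto_slope.1 h
    simpa using this
  refine ge_of_tendsto h1 ?_
  have h2 : ∀ᶠ t in 𝓝[>] (0:ℝ), φ 0 ≤ φ t := hmin.filter_mono (nhdsWithin_mono _ Ioi_subset_Ici_self)
  filter_upwards [h2, self_mem_nhdsWithin] with t ht ht0
  rw [slope_def_field]
  exact div_nonneg (by linarith) (by simpa using (mem_Ioi.1 ht0).le)

theorem norm_rotation {θ p : Euc n} (hθ : ‖θ‖ = 1) (hp : ‖p‖ = 1) (h : inner ℝ p θ = 0) (φ : ℝ) :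
    ‖Real.cos φ • θ + Real.sin φ • p‖ = 1 := by
  have := norm_add_sq_real (Real.cos φ • θ) (Real.sin φ • p)
  rw [inner_smul_left, inner_smul_right, real_inner_comm, h, norm_smul, norm_smul, hθ, hp,
    mul_one, mul_one, Real.norm_eq_abs, Real.norm_eq_abs, sq_abs, sq_abs] at this
  have h1 : ‖Real.cos φ • θ + Real.sin φ • p‖ ^ 2 = 1 := by
    rw [this, ← Real.cos_sq_add_sin_sq φ]; simp
  nlinarith [norm_nonneg (Real.cos φ • θ + Real.sin φ • p)]

theorem inner_rotation {θ p : Euc n} (hp : ‖p‖ = 1) (h : inner ℝ p θ = 0) (φ : ℝ) :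
    inner ℝ p (Real.cos φ • θ + Real.sin φ • p) = Real.sin φ := by
  rw [inner_add_right, inner_smul_right, inner_smul_right, h, real_inner_self_eq_norm_sq, hp]
  ring

/-- Sweeping principle on a half-cylinder with an oblique condition on the flat boundary. -/
theorem sweep_nonneg (hn : 1 ≤ n) {p : Euc n} (hp : ‖p‖ = 1) {τ₀ τ₁ r₁ Bd η : ℝ} {α : ℝ → ℝ}
    (hα : Continuous α) (hmono : Monotone α) (hBd : 0 ≤ Bd) (hη : 0 < η)
    {f : ℝ → ℝ → Euc n → ℝ}
    (hf : ContinuousOn (fun x : ℝ × ℝ × Euc n => f x.1 x.2.1 x.2.2) (sweepDomain p τ₀ τ₁ r₁ α))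
    (h0 : ∀ r ∈ Icc (α τ₀) r₁, ∀ θ ∈ hemisphere p, 0 ≤ f τ₀ r θ)
    (hleft : ∀ τ ∈ Icc τ₀ τ₁, ∀ θ ∈ hemisphere p, 0 ≤ f τ (α τ) θ)
    (hright : ∀ τ ∈ Icc τ₀ τ₁, ∀ θ ∈ hemisphere p, 0 ≤ f τ r₁ θ)
    (h_interior : ∀ τ ∈ Icc τ₀ τ₁, ∀ r ∈ Ioo (α τ) r₁,
      ∀ (b : OrthonormalBasis (Fin n) ℝ (Euc n)) (j₀ : Fin n), 0 < inner ℝ p (b j₀) →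
      f τ r (b j₀) < 0 → ∃ ℓ, HasCylLap b j₀ (f τ) r ℓ ∧ ℓ ≤ Bd * (-f τ r (b j₀)) - η)
    (hbd : ∀ τ ∈ Icc τ₀ τ₁, ∀ r ∈ Ioo (α τ) r₁, ∀ θ, ‖θ‖ = 1 → inner ℝ p θ = 0 →
      f τ r θ < 0 → ∃ d, HasDerivWithinAt (fun φ => f τ r (Real.cos φ • θ + Real.sin φ • p)) d
        (Ici 0) 0 ∧ d ≤ Bd * (-f τ r θ)) :
    ∀ τ ∈ Icc τ₀ τ₁, ∀ r ∈ Icc (α τ) r₁, ∀ θ ∈ hemisphere p, 0 ≤ f τ r θ := by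
  set N := Bd + 1 with hN
  set Cψ := N ^ 2 + n * N with hCψ
  have hCψ0 : 0 ≤ Cψ := by positivity
  have key : ∀ κ : ℝ, 0 < κ → κ * (Bd + Cψ) < η → ∀ τ ∈ Icc τ₀ τ₁, ∀ r ∈ Icc (α τ) r₁,
      ∀ θ ∈ hemisphere p, 0 < f τ r θ + κ * Real.exp (-N * inner ℝ p θ) := by
    intro κ hκ hκη
    refine sweep_pos (F := fun τ r θ => f τ r θ + κ * Real.exp (-N * inner ℝ p θ)) hα hmono
      (hf.add (by fun_prop)) (fun r hr θ hθ => ?_) ?_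
    · have := h0 r hr θ hθ
      positivity
    intro τ hτ r hr θ hθ hzero hnonneg
    have hτ' : τ ∈ Icc τ₀ τ₁ := Ioc_subset_Icc_self hτ
    have hψ : 0 < κ * Real.exp (-N * inner ℝ p θ) := by positivity
    have hneg : f τ r θ < 0 := by linarith
    have hr' : r ∈ Ioo (α τ) r₁ := by
      refine ⟨lt_of_le_of_ne hr.1 ?_, lt_of_le_of_ne hr.2 ?_⟩
      · rintro rfl
        linarith [hleft τ hτ' θ hθ]
      · rintro rfl
        linarith [hright τ hτ' θ hθ]
    have habs : -f τ r θ ≤ κ := by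
      have : Real.exp (-N * inner ℝ p θ) ≤ 1 :=
        Real.exp_le_one_iff.2 (by have := mul_nonneg (by linarith : 0 ≤ N) hθ.2; linarith)
      have := mul_le_mul_of_nonneg_left this hκ.le
      linarith
    rcases hθ.2.lt_or_eq with hz | hz
    · obtain ⟨v, b, hb⟩ : ∃ j₀ : Fin n, ∃ b : OrthonormalBasis (Fin n) ℝ (Euc n), b j₀ = θ := by
        have hon : Orthonormal ℝ (Subtype.val : ({θ} : Set (Euc n)) → Euc n) := by
          rw [orthonormal_subtype_iff_ite]
          intro v hv w hw
          rw [mem_singleton_iff] at hv hw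
          subst hv; subst hw
          simp [hθ.1]
        let j₀ : Fin n := ⟨0, hn⟩
        obtain ⟨b, hb⟩ := Orthonormal.exists_orthonormalBasis_extension_of_card_eq
          (𝕜 := ℝ) (E := Euc n) (ι := Fin n) (by simp) (v := fun _ => θ) (s := {j₀}) (by
            rw [orthonormal_iff_ite]
            rintro ⟨i, hi⟩ ⟨j, hj⟩
            rw [mem_singleton_iff] at hi hj
            subst hi; subst hj
            simp [hθ.1])
        exact ⟨j₀, b, hb j₀ rfl⟩
      subst hb
      obtain ⟨ℓ, hℓ, hℓle⟩ := h_interior τ hτ' r hr' b v hz hneg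
      obtain ⟨ℓ', hℓ'le, hℓ'⟩ := exp_height_cylLap (b := b) (j₀ := v) hn hp
        (by linarith : 0 ≤ N) hz.le r
      have hsum := (hℓ.add (hℓ'.const_mul κ)).nonneg ?_
      · have h1 := mul_le_mul_of_nonneg_left hℓ'le hκ.le
        have h2 := mul_le_mul_of_nonneg_left habs hBd
        linarith
      · have e1 : ∀ᶠ q : ℝ × Euc n in 𝓝 (r, b v), q.1 ∈ Ioo (α τ) r₁ :=
          continuous_fst.continuousAt.eventually (Ioo_mem_nhds hr'.1 hr'.2)
        have e2 : ∀ᶠ q : ℝ × Euc n in 𝓝 (r, b v), 0 < inner ℝ p q.2 := by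
          have : Continuous fun q : ℝ × Euc n => (inner ℝ p q.2 : ℝ) := by fun_prop
          exact this.continuousAt.eventually (lt_mem_nhds hz)
        filter_upwards [e1, e2] with q hq1 hq2 hq3
        rw [hzero]
        exact hnonneg q.1 (Ioo_subset_Icc_self hq1) q.2 ⟨hq3, hq2.le⟩
    · obtain ⟨d, hd, hdle⟩ := hbd τ hτ' r hr' θ hθ.1 hz.symm hneg
      have hψd : HasDerivWithinAt (fun φ => κ * Real.exp (-N *
          inner ℝ p (Real.cos φ • θ + Real.sin φ • p))) (κ * -N) (Ici 0) 0 := by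
        simp_rw [inner_rotation hp hz.symm]
        have := (((Real.hasDerivAt_sin 0).const_mul (-N)).exp.const_mul κ).hasDerivWithinAt
          (s := Ici 0)
        simpa using this
      have h1 := (hd.fun_add hψd).nonneg_of_min (by
        have : ∀ᶠ φ in 𝓝[≥] (0:ℝ), φ ∈ Icc 0 Real.pi := Icc_mem_nhdsGE Real.pi_pos
        filter_upwards [this] with φ hφ
        have h0' : f τ r (Real.cos 0 • θ + Real.sin 0 • p) + κ * Real.exp (-N *
          inner ℝ p (Real.cos 0 • θ + Real.sin 0 • p)) = 0 := by simpa using hzero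
        rw [h0']
        exact hnonneg r hr _ ⟨norm_rotation hθ.1 hp hz.symm φ,
          by rw [inner_rotation hp hz.symm]; exact Real.sin_nonneg_of_mem_Icc hφ⟩)
      have h2 := mul_le_mul_of_nonneg_left habs hBd
      rw [hN] at h1
      nlinarith
  intro τ hτ r hr θ hθ
  refine le_of_forall_pos_lt_add fun ε hε => ?_
  set κ := min (ε) (η / (2 * (Bd + Cψ + 1))) with hκd
  have hden : 0 < Bd + Cψ + 1 := by positivity
  have hκ : 0 < κ := lt_min hε (by positivity)
  have hκη : κ * (Bd + Cψ) < η := by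
    have h1 : κ ≤ η / (2 * (Bd + Cψ + 1)) := min_le_right _ _
    rw [le_div_iff₀ (by positivity)] at h1
    nlinarith
  have h1 := key κ hκ hκη τ hτ r hr θ hθ
  have h2 : Real.exp (-N * inner ℝ p θ) ≤ 1 :=
    Real.exp_le_one_iff.2 (by have := mul_nonneg (by linarith : 0 ≤ N) hθ.2; linarith)
  have h3 : κ ≤ ε := min_le_left _ _
  nlinarith

/-- Positive solutions of the boundary Yamabe system in cylindrical coordinates, on the
half-cylinder `(-∞, r₁] × hemisphere p`. -/
structure IsCylSol (p : Euc n) (k c r₁ : ℝ) (κ W : ℝ → Euc n → ℝ) : Prop where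
  cont : ContinuousOn (fun x : ℝ × Euc n => W x.1 x.2) (Iic r₁ ×ˢ hemisphere p)
  pos : ∀ r ≤ r₁, ∀ θ ∈ hemisphere p, 0 < W r θ
  eqn : ∀ r < r₁, ∀ (b : OrthonormalBasis (Fin n) ℝ (Euc n)) (j₀ : Fin n),
    0 < inner ℝ p (b j₀) → HasCylLap b j₀ W r
      (k ^ 2 * W r (b j₀) - κ r (b j₀) * W r (b j₀) ^ ((k + 2) / k))
  bdry : ∀ r < r₁, ∀ θ, ‖θ‖ = 1 → inner ℝ p θ = 0 →
    HasDerivWithinAt (fun φ => W r (Real.cos φ • θ + Real.sin φ • p))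
      (c * W r θ ^ ((k + 1) / k)) (Ici 0) 0

theorem exp_rpow_div {k m r : ℝ} (hk : 0 < k) :
    Real.exp (-k * r) ^ (m / k) = Real.exp (-m * r) := by
  rw [← Real.exp_mul]; congr 1; field_simp

namespace IsCylSol

variable {p : Euc n} {k c r₁ : ℝ} {κ W : ℝ → Euc n → ℝ}

/-- Lower barrier for solutions on the end of the cylinder. -/
theorem barrier (h : IsCylSol p k c r₁ κ W) (hn : 1 ≤ n) (hp : ‖p‖ = 1)
    (hnk : (n : ℝ) = 2 * k + 2) (hk : 1 ≤ k) {κ₀ rL μ ν : ℝ} (hκ₀ : 0 < κ₀)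
    (hκ : ∀ r ≤ r₁, ∀ θ ∈ hemisphere p, κ₀ ≤ κ r θ) (hrL : 0 ≤ rL) (hrL1 : rL ≤ r₁)
    (hμ : 0 < μ) (hμ1 : μ ≤ 1) (hν : 0 < ν) (hcν : c ≤ ν)
    (hleft : ∀ θ ∈ hemisphere p, μ * (1 + ν) * Real.exp (-k * rL) ≤ W rL θ)
    (hright : ∀ θ ∈ hemisphere p, μ * (1 + ν) * Real.exp (-k * r₁) ≤ W r₁ θ) :
    ∀ r ∈ Icc rL r₁, ∀ θ ∈ hemisphere p, μ * Real.exp (-k * r) ≤ W r θ := by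
  have hk0 : 0 < k := by linarith
  set Z : ℝ → Euc n → ℝ := fun r θ =>
    μ * (Real.exp (-k * r) + ν * (inner ℝ p θ * Real.exp (-(k + 1) * r))) with hZ
  have hZle : ∀ r, 0 ≤ r → ∀ θ ∈ hemisphere p, Z r θ ≤ μ * (1 + ν) * Real.exp (-k * r) := by
    intro r hr θ hθ
    have h1 : Real.exp (-(k + 1) * r) ≤ Real.exp (-k * r) := exp_le_exp_of_coef hr (by linarith)
    have h2 : inner ℝ p θ ≤ 1 := inner_le_one hp hθ.1
    have h3 : inner ℝ p θ * Real.exp (-(k + 1) * r) ≤ 1 * Real.exp (-k * r) := by gcongr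
    have h4 : μ * (ν * (inner ℝ p θ * Real.exp (-(k + 1) * r))) ≤
        μ * (ν * (1 * Real.exp (-k * r))) := by gcongr
    simp only [hZ]
    linarith
  have hZpos : ∀ r, ∀ θ ∈ hemisphere p, 0 < Z r θ := by
    intro r θ hθ
    have := hθ.2
    have h1 := Real.exp_pos (-k * r)
    have h2 := Real.exp_pos (-(k + 1) * r)
    simp only [hZ]
    positivity
  have hsub : Icc rL r₁ ×ˢ hemisphere p ⊆ Iic r₁ ×ˢ hemisphere p :=
    prod_mono Icc_subset_Iic_self subset_rfl
  by_cases hne : (hemisphere p).Nonempty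
  swap
  · intro r _ θ hθ
    exact absurd ⟨θ, hθ⟩ hne
  obtain ⟨⟨r', θ'⟩, hmem, hmin⟩ := ((isCompact_Icc (a := rL) (b := r₁)).prod
    (isCompact_hemisphere p)).exists_isMinOn
    (show (Icc rL r₁ ×ˢ hemisphere p).Nonempty from
      (nonempty_Icc.2 hrL1).prod hne) (h.cont.mono hsub)
  have hm0 : 0 < W r' θ' := h.pos r' hmem.1.2 θ' hmem.2
  set m := W r' θ' with hm
  have hmle : ∀ r ∈ Icc rL r₁, ∀ θ ∈ hemisphere p, m ≤ W r θ := fun r hr θ hθ =>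
    hmin (show (r, θ) ∈ Icc rL r₁ ×ˢ hemisphere p from ⟨hr, hθ⟩)
  have hsw := sweep_nonneg (τ₀ := 0) (τ₁ := 1) (r₁ := r₁) (Bd := 0) (α := fun _ => rL)
    (η := κ₀ * m ^ ((k + 2) / k)) (f := fun σ r θ => W r θ - σ * Z r θ) hn hp
    continuous_const monotone_const le_rfl (by positivity) ?_ ?_ ?_ ?_ ?_ ?_
  · intro r hr θ hθ
    have h1 := hsw 1 (by simp) r hr θ hθ
    refine le_trans ?_ (by linarith : Z r θ ≤ W r θ)
    have := hθ.2
    have h2 := Real.exp_pos (-(k + 1) * r)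
    have : 0 ≤ μ * (ν * (inner ℝ p θ * Real.exp (-(k + 1) * r))) := by positivity
    simp only [hZ]
    linarith
  · refine ContinuousOn.sub ?_ ?_
    · exact h.cont.comp (f := fun x : ℝ × ℝ × Euc n => (x.2.1, x.2.2)) (by fun_prop)
        fun x hx => ⟨hx.2.1.2, hx.2.2⟩
    · simp only [hZ]
      fun_prop
  · intro r hr θ hθ
    simpa using (h.pos r hr.2 θ hθ).le
  · intro σ hσ θ hθ
    have h1 := mul_le_mul_of_nonneg_right hσ.2 (hZpos rL θ hθ).le
    linarith [hleft θ hθ, hZle rL hrL θ hθ]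
  · intro σ hσ θ hθ
    have h1 := mul_le_mul_of_nonneg_right hσ.2 (hZpos r₁ θ hθ).le
    linarith [hright θ hθ, hZle r₁ (hrL.trans hrL1) θ hθ]
  · intro σ hσ r hr b j₀ hz hneg
    have hθ : b j₀ ∈ hemisphere p := ⟨b.norm_eq_one j₀, hz.le⟩
    have h1 := h.eqn r hr.2 b j₀ hz
    have h2 : HasCylLap b j₀ Z r _ :=
      ((HasCylLap.radial (b := b) (j₀ := j₀) (hasSecondDerivAt_exp (-k) r)).add
        ((HasCylLap.linear (b := b) (j₀ := j₀) hn p hp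
          (hasSecondDerivAt_exp (-(k + 1)) r)).const_mul ν)).const_mul μ
    refine ⟨_, h1.sub (h2.const_mul σ), ?_⟩
    have e1 : μ * ((-k) ^ 2 * Real.exp (-k * r) + ν * (inner ℝ p (b j₀) *
        ((-(k + 1)) ^ 2 * Real.exp (-(k + 1) * r) - ((n : ℝ) - 1) * Real.exp (-(k + 1) * r))))
        = k ^ 2 * Z r (b j₀) := by
      simp only [hZ]; rw [hnk]; ring
    rw [e1]
    have e2 : κ₀ * m ^ ((k + 2) / k) ≤ κ r (b j₀) * W r (b j₀) ^ ((k + 2) / k) := by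
      have := hκ r hr.2.le _ hθ
      have h4 := hmle r (Ioo_subset_Icc_self hr) _ hθ
      have h5 := hκ₀.le.trans this
      gcongr
    have e3 : k ^ 2 * (W r (b j₀) - σ * Z r (b j₀)) ≤ 0 :=
      mul_nonpos_of_nonneg_of_nonpos (by positivity) hneg.le
    linarith
  · intro σ hσ r hr θ hθ hz hneg
    have h1 := h.bdry r hr.2 θ hθ hz
    have hr0 : 0 ≤ r := hrL.trans hr.1.le
    have hmem : θ ∈ hemisphere p := ⟨hθ, hz.ge⟩
    have hWpos := h.pos r hr.2.le θ hmem
    have h2 : HasDerivWithinAt (fun φ => σ * Z r (Real.cos φ • θ + Real.sin φ • p))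
        (σ * (μ * (ν * Real.exp (-(k + 1) * r)))) (Ici 0) 0 := by
      simp only [hZ, inner_rotation hp hz]
      have := ((((Real.hasDerivAt_sin 0).mul_const (Real.exp (-(k + 1) * r))).const_mul
        ν).const_add (Real.exp (-k * r))).const_mul μ |>.const_mul σ
      simpa using this.hasDerivWithinAt (s := Ici 0)
    refine ⟨_, h1.fun_sub h2, ?_⟩
    rw [zero_mul, sub_nonpos]
    have hZ0 : Z r θ = μ * Real.exp (-k * r) := by simp [hZ, hz]
    have hσ1 := hσ.2
    have hσ0 := hσ.1
    have hq : (1:ℝ) ≤ (k + 1) / k := by rw [le_div_iff₀ hk0]; linarith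
    have hX := Real.exp_pos (-(k + 1) * r)
    rcases le_total c 0 with hc | hc
    · refine le_trans (mul_nonpos_of_nonpos_of_nonneg hc (Real.rpow_nonneg hWpos.le _)) ?_
      positivity
    · have e1 : W r θ ^ ((k + 1) / k) ≤ (σ * μ * Real.exp (-k * r)) ^ ((k + 1) / k) := by
        refine Real.rpow_le_rpow hWpos.le ?_ (by linarith)
        rw [hZ0] at hneg
        linarith
      have e2 : (σ * μ * Real.exp (-k * r)) ^ ((k + 1) / k) ≤
          σ * μ * Real.exp (-(k + 1) * r) := by
        rw [Real.mul_rpow (by positivity) (Real.exp_pos _).le, exp_rpow_div hk0]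
        have : (σ * μ) ^ ((k + 1) / k) ≤ σ * μ := by
          have := Real.rpow_le_rpow_of_exponent_ge' (x := σ * μ) (by positivity)
            (by nlinarith) zero_le_one hq
          simpa using this
        gcongr
      calc c * W r θ ^ ((k + 1) / k) ≤ ν * (σ * μ * Real.exp (-(k + 1) * r)) := by
            have := e1.trans e2
            have h0 := Real.rpow_nonneg hWpos.le ((k + 1) / k)
            gcongr
        _ = _ := by ring

end IsCylSol

theorem rpow_sub_rpow_le {x y m : ℝ} (hx : 0 < x) (hy : 0 ≤ y) (hm : 1 ≤ m) :
    x ^ m - y ^ m ≤ m * x ^ (m - 1) * (x - y) := by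
  have h1 : -1 ≤ (y - x) / x := by
    rw [le_div_iff₀ hx]; linarith
  have h2 := one_add_mul_self_le_rpow_one_add h1 hm
  have h3 : 1 + (y - x) / x = y / x := by field_simp; ring
  rw [h3, Real.div_rpow hy hx.le] at h2
  have h4 : 0 < x ^ m := Real.rpow_pos_of_pos hx m
  rw [le_div_iff₀ h4] at h2
  rw [Real.rpow_sub_one hx.ne']
  have h5 : m * (x ^ m / x) * (x - y) = -(m * ((y - x) / x)) * x ^ m := by
    field_simp; ring
  rw [h5]
  linarith

theorem testH_hasDerivWithinAt {k g σ q B D a A ε t : ℝ} {e p θ : Euc n} (hσ : 0 < σ)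
    (he : ‖e‖ = 1) (hp : ‖p‖ = 1) (hep : inner ℝ e p = 0) (hθ : ‖θ‖ = 1)
    (hz : inner ℝ p θ = 0) :
    HasDerivWithinAt (fun φ => testH k g σ q B D a A ε t
      (inner ℝ e (Real.cos φ • θ + Real.sin φ • p)) (inner ℝ p (Real.cos φ • θ + Real.sin φ • p)))
      (ε * (a * testT' k t + A * testS' k t)) (Ici 0) 0 := by
  have e1 : ∀ φ, inner ℝ e (Real.cos φ • θ + Real.sin φ • p) = Real.cos φ * inner ℝ e θ := by
    intro φ
    rw [inner_add_right, inner_smul_right, inner_smul_right, hep, mul_zero, add_zero]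
  simp only [e1, inner_rotation hp hz]
  have hρ : 0 < Real.cosh t - Real.cos 0 * inner ℝ e θ + σ := by
    rw [Real.cos_zero, one_mul]
    exact cosh_sub_add_pos hσ (inner_le_one he hθ)
  have h1 : HasDerivAt (fun φ => Real.cosh t - Real.cos φ * inner ℝ e θ + σ) 0 0 := by
    have := (((Real.hasDerivAt_cos 0).mul_const (inner ℝ e θ)).const_sub
      (Real.cosh t)).add_const σ
    simpa using this
  have h2 := (hasDerivAt_profile (h := k + 1) (g := g) hρ).comp (0 : ℝ) h1
  have h3 := (((((h2.const_mul (Real.sinh t)).const_mul B).sub_const (D * testT k t)).const_mul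
    q).const_mul a).add_const (A * testS k t)
  have h4 := ((Real.hasDerivAt_sin 0).mul_const (a * testT' k t + A * testS' k t)).const_mul ε
  have h5 := (h3.add h4).hasDerivWithinAt (s := Ici 0)
  refine HasDerivWithinAt.congr_deriv (HasDerivWithinAt.congr h5 ?_ ?_) ?_
  · intro φ _
    simp [testH, testP]
  · simp [testH, testP]
  · simp

theorem two_exp_mem {τ : ℝ} (h1 : -(1 / 2) ≤ τ) (h2 : τ ≤ 1 / 2) :
    1 ≤ 2 * Real.exp τ ∧ 2 * Real.exp τ ≤ 4 := by
  constructor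
  · have := Real.add_one_le_exp τ
    linarith
  · have h5 : Real.exp τ ≤ Real.exp (1 / 2) := Real.exp_le_exp.2 h2
    have h6 : Real.exp (1 / 2) * Real.exp (1 / 2) = Real.exp 1 := by
      rw [← Real.exp_add]; norm_num
    nlinarith [Real.exp_one_lt_d9, Real.exp_pos (1 / 2 : ℝ)]

namespace IsCylSol

variable {p e : Euc n} {k c r₁ : ℝ} {κ W : ℝ → Euc n → ℝ}

set_option maxHeartbeats 1000000 in
/-- Method of moving spheres: positivity of the reflected difference propagates. -/
theorem sliding (h : IsCylSol p k c r₁ κ W) (hn : 1 ≤ n) (hp : ‖p‖ = 1) (he : ‖e‖ = 1)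
    (hep : inner ℝ e p = 0) (hnk : (n : ℝ) = 2 * k + 2) (hk : 1 ≤ k)
    {g σ q Cb c₂ Cs B D a A ε E ω κM CW : ℝ}
    (hg : 0 ≤ g) (hg1 : g ≤ 1) (hσ : 0 < σ) (hσ1 : σ ≤ 1) (hq : 0 < q)
    (hCb : 0 < Cb) (hD : D = 10 * Cb) (hB : B = 2 * 4 ^ (k + 1) * D) (ha : 0 ≤ a) (hE : 0 ≤ E)
    (hCs : 0 ≤ Cs)
    (hgood : 4 * (B * (12 * (k + 2) ^ 2 * (σ ^ g + g))) ≤ c₂)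
    (hbad : B * (6 * (k + 2) ^ 2 * (σ + g) * 4 ^ (k + 3)) ≤ Cb)
    (hε : 0 ≤ ε) (hε1 : ε ≤ 1) (hεk : 8 * k * ε ≤ 1) (hεq : ε * (2 * k + 3) ≤ q * Cb)
    (hA : 8 * (Cs * E) ≤ A) (hA0 : 0 < A) (hω1 : ω ≤ 1 / 2)
    (hκ : ∀ r ≤ r₁, ∀ θ ∈ hemisphere p, 0 ≤ κ r θ ∧ κ r θ ≤ κM)
    (hκd : ∀ τ ∈ Icc (-ω) ω, ∀ t, 0 ≤ t → τ + t ≤ r₁ → ∀ θ ∈ hemisphere p,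
      2 * Real.sinh t * Real.exp τ * (a * (inner ℝ e θ - 1 / 4) - E * Real.exp ((2 * k - 1) * t))
        ≤ κ (τ + t) θ - κ (τ - t) θ)
    (hwb : ∀ τ ∈ Icc (-ω) ω, ∀ t, 0 ≤ t → τ + t ≤ r₁ → ∀ θ ∈ hemisphere p,
      (inner ℝ e θ ≤ 1 / 2 →
        W (τ - t) θ ^ ((k + 2) / k) ≤ Cb * q * Real.exp (-(k + 2) * t)) ∧
      W (τ - t) θ ^ ((k + 2) / k) ≤ Cs * Real.exp (-(k + 2) * t) ∧
      (1 / 2 ≤ inner ℝ e θ → Real.cosh t - inner ℝ e θ + σ ≤ 1 →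
      c₂ * q * (Real.cosh t - inner ℝ e θ + σ) ^ (-(k + 2)) ≤ W (τ - t) θ ^ ((k + 2) / k)))
    (hWH : ∀ τ ∈ Icc (-ω) ω, ∀ t, 0 ≤ t → τ + t ≤ r₁ → ∀ θ ∈ hemisphere p,
      W (τ - t) θ + testH k g σ q B D a A ε t (inner ℝ e θ) (inner ℝ p θ)
        ≤ CW * Real.exp (-k * t))
    (hCW : 0 < CW)
    (hcε : c * ((k + 1) / k) * CW ^ (1 / k) * (q * (B * (2 / σ) ^ (k + 1)) + 2) ≤ ε)
    (hright : ∀ τ ∈ Icc (-ω) ω, ∀ θ ∈ hemisphere p, CW * Real.exp (-k * (r₁ - τ)) ≤ W r₁ θ)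
    (hωr : ω ≤ r₁)
    (hstart : ∀ t, 0 ≤ t → -ω + t ≤ r₁ → ∀ θ ∈ hemisphere p,
      testH k g σ q B D a A ε t (inner ℝ e θ) (inner ℝ p θ) ≤ W (-ω + t) θ - W (-ω - t) θ) :
    ∀ τ ∈ Icc (-ω) ω, ∀ t, 0 ≤ t → τ + t ≤ r₁ → ∀ θ ∈ hemisphere p,
      testH k g σ q B D a A ε t (inner ℝ e θ) (inner ℝ p θ) ≤ W (τ + t) θ - W (τ - t) θ := by
  have hk0 : 0 < k := by linarith
  have hD0 : 0 ≤ D := by rw [hD]; linarith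
  have hB0 : 0 ≤ B := by rw [hB]; positivity
  set CH := q * (B * (2 / σ) ^ (k + 1)) + 2 with hCH
  have hCH0 : 0 < CH := by positivity
  set pp : ℝ := (k + 2) / k with hpp
  set qq : ℝ := (k + 1) / k with hqq
  have hpp1 : 1 ≤ pp := by rw [hpp, le_div_iff₀ hk0]; linarith
  have hqq1 : 1 ≤ qq := by rw [hqq, le_div_iff₀ hk0]; linarith
  have hpp' : pp - 1 = 2 / k := by rw [hpp]; field_simp; ring
  have hqq' : qq - 1 = 1 / k := by rw [hqq]; field_simp; ring
  by_cases hne : (hemisphere p).Nonempty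
  swap
  · intro τ _ t _ _ θ hθ
    exact absurd ⟨θ, hθ⟩ hne
  obtain ⟨θ₀, hθ₀⟩ := hne
  by_cases hω0 : 0 ≤ ω
  swap
  · intro τ hτ
    exact absurd (hτ.1.trans hτ.2) (by linarith)
  have hκM : 0 ≤ κM := (hκ r₁ le_rfl θ₀ hθ₀).1.trans (hκ r₁ le_rfl θ₀ hθ₀).2
  have hHnn : ∀ t, 0 ≤ t → ∀ θ ∈ hemisphere p,
      0 ≤ testH k g σ q B D a A ε t (inner ℝ e θ) (inner ℝ p θ) := fun t ht θ hθ =>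
    testH_nonneg hk hg1 hσ hσ1 hq.le hD0 hB ha hA0.le hε ht (neg_one_le_inner he hθ.1)
      (inner_le_one he hθ.1) hθ.2
  have hHle : ∀ t, 0 ≤ t → ∀ θ ∈ hemisphere p,
      testH k g σ q B D a A ε t (inner ℝ e θ) (inner ℝ p θ)
        ≤ CH * (a * testT k t + A * testS k t) := fun t ht θ hθ =>
    testH_le hk hg hσ hσ1 hq.le hD0 hB0 ha hA0.le hε1 ht
      (inner_le_one he hθ.1) hθ.2 (inner_le_one hp hθ.1)
  have hsw := sweep_nonneg (τ₀ := -ω) (τ₁ := ω) (r₁ := r₁)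
    (Bd := κM * (pp * CW ^ (2 / k)) + |c| * (qq * CW ^ (1 / k)))
    (α := fun τ => τ)
    (η := A / 4) (f := fun τ r θ => W r θ - W (2 * τ - r) θ -
      testH k g σ q B D a A ε (r - τ) (inner ℝ e θ) (inner ℝ p θ)) hn hp
    continuous_id monotone_id (by positivity) (by positivity) ?_ ?_ ?_ ?_ ?_ ?_
  · intro τ hτ t ht htr θ hθ
    have h1 := hsw τ hτ (τ + t) ⟨by simpa using ht, htr⟩ θ hθ
    rw [show 2 * τ - (τ + t) = τ - t by ring, show τ + t - τ = t by ring] at h1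
    linarith
  · refine ContinuousOn.sub (ContinuousOn.sub ?_ ?_) ?_
    · exact h.cont.comp (f := fun x : ℝ × ℝ × Euc n => (x.2.1, x.2.2)) (by fun_prop)
        fun x hx => ⟨hx.2.1.2, hx.2.2⟩
    · refine h.cont.comp (f := fun x : ℝ × ℝ × Euc n => (2 * x.1 - x.2.1, x.2.2)) (by fun_prop)
        fun x hx => ⟨?_, hx.2.2⟩
      have h1 := hx.2.1.1
      have h2 := hx.1.2
      simp only [mem_Iic]
      linarith
    · unfold testH testP testT testS testT' testS' profile
      have hρ : ∀ x ∈ sweepDomain p (-ω) ω r₁ (fun τ => τ),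
          0 < Real.cosh (x.2.1 - x.1) - inner ℝ e x.2.2 + σ := fun x hx =>
        cosh_sub_add_pos hσ (inner_le_one he hx.2.2.1)
      have hc1 : ContinuousOn (fun x : ℝ × ℝ × Euc n =>
          Real.cosh (x.2.1 - x.1) - inner ℝ e x.2.2 + σ)
          (sweepDomain p (-ω) ω r₁ (fun τ => τ)) := by fun_prop
      have hc2 := hc1.rpow_const (p := -(k + 1 - g)) fun x hx => Or.inl (hρ x hx).ne'
      have hc3 := (hc1.add_const 1).rpow_const (p := -g) fun x hx =>
        Or.inl (add_pos (hρ x hx) one_pos).ne'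
      fun_prop
  · intro r hr θ hθ
    have h1 := hstart (r + ω) (by linarith [hr.1]) (by linarith [hr.2]) θ hθ
    rw [show -ω + (r + ω) = r by ring, show -ω - (r + ω) = 2 * -ω - r by ring] at h1
    rw [show r - -ω = r + ω by ring]
    linarith
  · intro τ hτ θ hθ
    have : testH k g σ q B D a A ε (τ - τ) (inner ℝ e θ) (inner ℝ p θ) = 0 := by
      simp [testH, testP, testT, testS, testT', testS']
    rw [this, show 2 * τ - τ = τ by ring]
    simp
  · intro τ hτ θ hθ
    have h1 := hWH τ hτ (r₁ - τ) (by linarith [hτ.2]) (by linarith) θ hθ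
    rw [show τ - (r₁ - τ) = 2 * τ - r₁ by ring] at h1
    linarith [hright τ hτ θ hθ]
  · intro τ hτ r hr b j₀ hz hneg
    have hθ : b j₀ ∈ hemisphere p := ⟨b.norm_eq_one j₀, hz.le⟩
    set t := r - τ with ht
    have ht0 : 0 ≤ t := by linarith [hr.1]
    have hrt : r = τ + t := by rw [ht]; ring
    have hrt' : 2 * τ - r = τ - t := by rw [ht]; ring
    have htr : τ + t ≤ r₁ := by linarith [hr.2]
    have h1 := h.eqn r hr.2 b j₀ hz
    have h2 := HasCylLap.reflect (c := 2 * τ) (r := r)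
      (h.eqn (2 * τ - r) (by linarith [hr.1, hr.2]) b j₀ hz)
    have h3 := HasCylLap.shift (c := τ) (r := r)
      (testH_cylLap (b := b) (j₀ := j₀) (k := k) (g := g) (σ := σ) q B D a A ε hn hnk hσ
        e p he hp t)
    refine ⟨_, (h1.sub h2).sub h3, ?_⟩
    have hV0 := h.pos (τ - t) (by linarith) _ hθ
    have hW0 := h.pos r hr.2.le _ hθ
    obtain ⟨w1, w2, w3⟩ := hwb τ hτ t ht0 htr _ hθ
    have hs0 : 0 ≤ Real.sinh t := Real.sinh_nonneg_iff.2 ht0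
    obtain ⟨hτe1, hτe2⟩ := two_exp_mem (τ := τ) (by linarith [hτ.1]) (by linarith [hτ.2])
    have hop := testHop_add_source_pos (k := k) (g := g) (σ := σ) (q := q) (Cb := Cb)
      (c₂ := c₂) (Cs := Cs) (B := B) (a := a) (A := A) (ε := ε) (E := E)
      (m := 2 * Real.sinh t * Real.exp τ) (w := W (τ - t) (b j₀) ^ pp)
      (dκ := κ (τ + t) (b j₀) - κ (τ - t) (b j₀)) (t := t) (y := inner ℝ e (b j₀))
      (z := inner ℝ p (b j₀)) hk hg hg1 hσ hσ1 hq hCb hB0 ha hE hCs hgood hbad hε hεk hεq hA hA0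
      ht0 (neg_one_le_inner he hθ.1) (inner_le_one he hθ.1) hθ.2 (inner_le_one hp hθ.1)
      (Real.rpow_pos_of_pos hV0 _) w1 w2 w3
      (by have := mul_le_mul_of_nonneg_left hτe1 hs0; linarith)
      (by have := mul_le_mul_of_nonneg_left hτe2 hs0; linarith)
      (hκd τ hτ t ht0 htr _ hθ)
    rw [← hD] at hop
    have hexp : 1 ≤ Real.exp ((k - 1) * t) := Real.one_le_exp (mul_nonneg (by linarith) ht0)
    have hA4 : A / 4 ≤ A / 4 * Real.exp ((k - 1) * t) := le_mul_of_one_le_right (by linarith) hexp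
    have hH0 := hHnn t ht0 _ hθ
    have hVH := hWH τ hτ t ht0 htr _ hθ
    have hexp1 : Real.exp (-k * t) ≤ 1 := Real.exp_le_one_iff.2 (by linarith [mul_nonneg hk0.le ht0])
    have hVle : W (τ - t) (b j₀) ≤ CW := by
      have := mul_le_mul_of_nonneg_left hexp1 hCW.le
      linarith
    obtain ⟨hκ0, hκ1⟩ := hκ r hr.2.le _ hθ
    simp only [hrt'] at hneg ⊢
    rw [← hrt] at hop
    set Wr := W r (b j₀)
    set V := W (τ - t) (b j₀)
    set H := testH k g σ q B D a A ε t (inner ℝ e (b j₀)) (inner ℝ p (b j₀))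
    set Hop := testHop k g σ q B D a A ε t (inner ℝ e (b j₀)) (inner ℝ p (b j₀))
    have hmain : κ r (b j₀) * (V ^ pp - Wr ^ pp) ≤ κM * (pp * CW ^ (2 / k)) * (-(Wr - V - H)) := by
      have hf : 0 ≤ -(Wr - V - H) := by linarith
      rcases le_total V Wr with hVW | hVW
      · have := Real.rpow_le_rpow hV0.le hVW (by linarith : 0 ≤ pp)
        have : κ r (b j₀) * (V ^ pp - Wr ^ pp) ≤ 0 :=
          mul_nonpos_of_nonneg_of_nonpos hκ0 (by linarith)
        refine this.trans ?_
        positivity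
      · have e1 := rpow_sub_rpow_le hV0 hW0.le hpp1
        rw [hpp'] at e1
        have e2 : pp * V ^ (2 / k) * (V - Wr) ≤ pp * CW ^ (2 / k) * (-(Wr - V - H)) := by
          have : V - Wr ≤ -(Wr - V - H) := by linarith
          have : 0 ≤ V - Wr := by linarith
          gcongr
        have e3 : 0 ≤ pp * CW ^ (2 / k) * (-(Wr - V - H)) := by positivity
        calc κ r (b j₀) * (V ^ pp - Wr ^ pp)
            ≤ κ r (b j₀) * (pp * CW ^ (2 / k) * (-(Wr - V - H))) := by
              gcongr; exact e1.trans e2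
          _ ≤ κM * (pp * CW ^ (2 / k) * (-(Wr - V - H))) := by gcongr
          _ = _ := by ring
    have hk2 : k ^ 2 * (Wr - V - H) ≤ 0 :=
      mul_nonpos_of_nonneg_of_nonpos (by positivity) hneg.le
    have hc2 : 0 ≤ |c| * (qq * CW ^ (1 / k)) * (-(Wr - V - H)) := by
      have : 0 ≤ -(Wr - V - H) := by linarith
      positivity
    linarith
  · intro τ hτ r hr θ hθ1 hz hneg
    have hθ : θ ∈ hemisphere p := ⟨hθ1, hz.ge⟩
    set t := r - τ with ht
    have ht0 : 0 ≤ t := by linarith [hr.1]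
    have hrt' : 2 * τ - r = τ - t := by rw [ht]; ring
    have htr : τ + t ≤ r₁ := by linarith [hr.2]
    refine ⟨_, ((h.bdry r hr.2 θ hθ1 hz).fun_sub
      (h.bdry (2 * τ - r) (by linarith [hr.1, hr.2]) θ hθ1 hz)).fun_sub
      (testH_hasDerivWithinAt (k := k) (g := g) (q := q) (B := B) (D := D) (a := a) (A := A)
        (ε := ε) (t := t) hσ he hp hep hθ1 hz), ?_⟩
    have hV0 := h.pos (τ - t) (by linarith) _ hθ
    have hW0 := h.pos r hr.2.le _ hθ
    have hH0 := hHnn t ht0 _ hθ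
    have hHl := hHle t ht0 _ hθ
    have hVH := hWH τ hτ t ht0 htr _ hθ
    have hexp1 : Real.exp (-k * t) ≤ 1 := Real.exp_le_one_iff.2 (by linarith [mul_nonneg hk0.le ht0])
    have hVle : W (τ - t) θ ≤ CW := by
      have := mul_le_mul_of_nonneg_left hexp1 hCW.le
      linarith
    simp only [hrt'] at hneg ⊢
    set Wr := W r θ
    set V := W (τ - t) θ
    set H := testH k g σ q B D a A ε t (inner ℝ e θ) (inner ℝ p θ)
    have hf : 0 ≤ -(Wr - V - H) := by linarith
    have hT0 : 0 ≤ testT' k t := by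
      have := testT_nonneg (k := k) ht0
      rw [testT'_eq]; positivity
    have hS0 : 0 ≤ testS' k t := by
      have := testS_nonneg (k := k) ht0
      rw [testS'_eq]; positivity
    have hTS : 0 ≤ a * testT' k t + A * testS' k t := by positivity
    have hmain : c * Wr ^ qq - c * V ^ qq ≤ ε * (a * testT' k t + A * testS' k t) +
        |c| * (qq * CW ^ (1 / k)) * (-(Wr - V - H)) := by
      have hp1 : 0 ≤ ε * (a * testT' k t + A * testS' k t) := by positivity
      have hp2 : 0 ≤ |c| * (qq * CW ^ (1 / k)) * (-(Wr - V - H)) := by positivity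
      have hq0 : 0 ≤ qq := by linarith
      rcases le_total V Wr with hVW | hVW
      · have e0 := Real.rpow_le_rpow hV0.le hVW hq0
        rcases le_total c 0 with hc | hc
        · have := mul_le_mul_of_nonpos_left e0 hc
          linarith
        · have e1 := rpow_sub_rpow_le hW0 hV0.le hqq1
          rw [hqq'] at e1
          have e2 : Wr ^ (1 / k) ≤ CW ^ (1 / k) * Real.exp (-t) := by
            calc Wr ^ (1 / k) ≤ (CW * Real.exp (-k * t)) ^ (1 / k) := by
                  gcongr; linarith
              _ = CW ^ (1 / k) * Real.exp (-t) := by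
                  rw [Real.mul_rpow hCW.le (Real.exp_pos _).le, exp_rpow_div hk0]; simp
          have e3 : c * (Wr ^ qq - V ^ qq) ≤
              c * (qq * (CW ^ (1 / k) * Real.exp (-t)) *
                (CH * (a * testT k t + A * testS k t))) := by
            have : Wr - V ≤ CH * (a * testT k t + A * testS k t) := by linarith
            have : 0 ≤ Wr - V := by linarith
            refine mul_le_mul_of_nonneg_left (e1.trans ?_) hc
            gcongr
          have e4 : c * (qq * (CW ^ (1 / k) * Real.exp (-t)) *
                (CH * (a * testT k t + A * testS k t))) =
              (c * qq * CW ^ (1 / k) * CH) * (a * testT' k t + A * testS' k t) := by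
            rw [testT'_eq, testS'_eq]; ring
          have e5 := mul_le_mul_of_nonneg_right hcε hTS
          linarith
      · have e0 := Real.rpow_le_rpow hW0.le hVW hq0
        rcases le_total 0 c with hc | hc
        · have := mul_le_mul_of_nonneg_left e0 hc
          linarith
        · have e1 := rpow_sub_rpow_le hV0 hW0.le hqq1
          rw [hqq'] at e1
          have e2 : qq * V ^ (1 / k) * (V - Wr) ≤ qq * CW ^ (1 / k) * (-(Wr - V - H)) := by
            have : V - Wr ≤ -(Wr - V - H) := by linarith
            have : 0 ≤ V - Wr := by linarith
            gcongr
          have e3 := mul_le_mul_of_nonneg_left (e1.trans e2) (abs_nonneg c)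
          rw [abs_of_nonpos hc] at e3 hp2 ⊢
          linarith
    have hp3 : 0 ≤ κM * (pp * CW ^ (2 / k)) * (-(Wr - V - H)) := by positivity
    linarith

end IsCylSol

/-- Denominator of the standard bubble in cylindrical coordinates. -/
def bubDen (b₁ b₂ r y z : ℝ) : ℝ := Real.cosh r - b₁ * y - b₂ * z

/-- The standard bubble in cylindrical coordinates. -/
def cylBubble (k s b₁ b₂ r y z : ℝ) : ℝ := (s / 2 / bubDen b₁ b₂ r y z) ^ k

theorem bubDen_neg (b₁ b₂ r y z : ℝ) : bubDen b₁ b₂ (-r) y z = bubDen b₁ b₂ r y z := by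
  simp [bubDen]

theorem cylBubble_neg (k s b₁ b₂ r y z : ℝ) :
    cylBubble k s b₁ b₂ (-r) y z = cylBubble k s b₁ b₂ r y z := by
  simp [cylBubble, bubDen_neg]

section

variable {s b₁ b₂ y z : ℝ}

theorem abs_inner_le_of_sq (hb : b₁ ^ 2 + b₂ ^ 2 + s ^ 2 = 1) (hyz : y ^ 2 + z ^ 2 ≤ 1) :
    |b₁ * y + b₂ * z| ≤ 1 - s ^ 2 / 2 := by
  have h0 : 0 ≤ 1 - s ^ 2 / 2 := by nlinarith [sq_nonneg b₁, sq_nonneg b₂]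
  refine abs_le_of_sq_le_sq ?_ h0
  have h1 : (b₁ * y + b₂ * z) ^ 2 ≤ (b₁ ^ 2 + b₂ ^ 2) * (y ^ 2 + z ^ 2) := by
    nlinarith [sq_nonneg (b₁ * z - b₂ * y)]
  have h2 : (b₁ ^ 2 + b₂ ^ 2) * (y ^ 2 + z ^ 2) ≤ (b₁ ^ 2 + b₂ ^ 2) * 1 := by
    gcongr
  have h3 : (1 - s ^ 2 / 2) ^ 2 = 1 - s ^ 2 + (s ^ 2) ^ 2 / 4 := by ring
  nlinarith [sq_nonneg (s ^ 2)]

theorem bubDen_ge (hb : b₁ ^ 2 + b₂ ^ 2 + s ^ 2 = 1) (hyz : y ^ 2 + z ^ 2 ≤ 1) (r : ℝ) :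
    s ^ 2 / 2 * Real.cosh r ≤ bubDen b₁ b₂ r y z := by
  have h1 := (abs_le.1 (abs_inner_le_of_sq hb hyz)).2
  have h2 := Real.one_le_cosh r
  have h3 : s ^ 2 ≤ 1 := by nlinarith [sq_nonneg b₁, sq_nonneg b₂]
  unfold bubDen
  nlinarith

theorem bubDen_pos (hs : 0 < s) (hb : b₁ ^ 2 + b₂ ^ 2 + s ^ 2 = 1) (hyz : y ^ 2 + z ^ 2 ≤ 1)
    (r : ℝ) : 0 < bubDen b₁ b₂ r y z :=
  lt_of_lt_of_le (by have := Real.cosh_pos r; positivity) (bubDen_ge hb hyz r)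

theorem cylBubble_pos {k : ℝ} (hs : 0 < s) (hb : b₁ ^ 2 + b₂ ^ 2 + s ^ 2 = 1)
    (hyz : y ^ 2 + z ^ 2 ≤ 1) (r : ℝ) : 0 < cylBubble k s b₁ b₂ r y z :=
  Real.rpow_pos_of_pos (div_pos (by positivity) (bubDen_pos hs hb hyz r)) _

theorem bubDen_le (hb : b₁ ^ 2 + b₂ ^ 2 + s ^ 2 = 1) (hyz : y ^ 2 + z ^ 2 ≤ 1) (r : ℝ) :
    bubDen b₁ b₂ r y z ≤ Real.cosh r + 1 := by
  have h1 := (abs_le.1 (abs_inner_le_of_sq hb hyz)).1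
  unfold bubDen
  nlinarith [sq_nonneg s]

theorem bubDen_ge_sub (hb : b₁ ^ 2 + b₂ ^ 2 + s ^ 2 = 1) (hyz : y ^ 2 + z ^ 2 ≤ 1) (r : ℝ) :
    Real.cosh r - 1 ≤ bubDen b₁ b₂ r y z := by
  have h1 := (abs_le.1 (abs_inner_le_of_sq hb hyz)).2
  unfold bubDen
  nlinarith [sq_nonneg s]

theorem half_exp_le_exp_sub {t τ : ℝ} (hτ : τ ≤ 1 / 2) :
    Real.exp t / 2 ≤ Real.exp (t - τ) := by
  have h1 : Real.exp t * Real.exp (-τ) = Real.exp (t - τ) := by rw [← Real.exp_add]; ring_nf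
  have h2 := Real.add_one_le_exp (-τ)
  nlinarith [Real.exp_pos t]

theorem bubDen_ge_far (hb1 : 0 ≤ b₁) (hb : b₁ ^ 2 + b₂ ^ 2 + s ^ 2 = 1)
    (hb2 : |b₂| ≤ 1 / 4) (hyz : y ^ 2 + z ^ 2 ≤ 1) (hy : y ≤ 1 / 2) {t τ : ℝ} (hτ : τ ≤ 1 / 2) :
    Real.exp t / 16 ≤ bubDen b₁ b₂ (τ - t) y z := by
  have h1 : b₁ ≤ 1 := by nlinarith [sq_nonneg s, sq_nonneg b₂]
  have h2 : b₁ * y ≤ 1 / 2 := by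
    rcases le_total y 0 with h | h
    · nlinarith
    · nlinarith
  have h3 : |z| ≤ 1 := abs_le_of_sq_le_sq (by nlinarith [sq_nonneg y]) zero_le_one
  have h4 : b₂ * z ≤ 1 / 4 := by
    calc b₂ * z ≤ |b₂ * z| := le_abs_self _
      _ = |b₂| * |z| := abs_mul _ _
      _ ≤ 1 / 4 * 1 := by gcongr
      _ = 1 / 4 := by norm_num
  have h5 := Real.one_le_cosh (τ - t)
  have h6 := half_exp_le_cosh (t - τ)
  have h7 := half_exp_le_exp_sub (t := t) hτ
  rw [show t - τ = -(τ - t) by ring, Real.cosh_neg] at h6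
  rw [show t - τ = -(τ - t) by ring] at h7
  unfold bubDen
  linarith

theorem bubDen_ge_exp (hb : b₁ ^ 2 + b₂ ^ 2 + s ^ 2 = 1) (hyz : y ^ 2 + z ^ 2 ≤ 1) {t τ : ℝ}
    (hτ : τ ≤ 1 / 2) : s ^ 2 / 8 * Real.exp t ≤ bubDen b₁ b₂ (τ - t) y z := by
  refine le_trans ?_ (bubDen_ge hb hyz (τ - t))
  have h6 := half_exp_le_cosh (t - τ)
  have h7 := half_exp_le_exp_sub (t := t) hτ
  rw [show t - τ = -(τ - t) by ring, Real.cosh_neg] at h6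
  rw [show t - τ = -(τ - t) by ring] at h7
  nlinarith [sq_nonneg s]

theorem abs_sinh_le_two {x : ℝ} (hx : |x| ≤ 1 / 2) : Real.sinh x ^ 2 ≤ 4 * x ^ 2 := by
  have h1 : Real.sinh x ^ 2 = Real.cosh x ^ 2 - 1 := by
    linarith [Real.cosh_sq x]
  have h2 : Real.cosh x ≤ Real.exp (x ^ 2 / 2) := Real.cosh_le_exp_half_sq x
  have h3 : x ^ 2 ≤ 1 / 4 := by
    rw [← sq_abs]; nlinarith [abs_nonneg x]
  have h4 : Real.exp (x ^ 2) ≤ 1 + 2 * x ^ 2 := by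
    have h5 := Real.add_one_le_exp (-(x ^ 2))
    have h6 : Real.exp (x ^ 2) * Real.exp (-(x ^ 2)) = 1 := by rw [← Real.exp_add]; simp
    have h7 := Real.exp_pos (x ^ 2)
    have h8 := sq_nonneg x
    nlinarith [mul_le_mul_of_nonneg_left h5 h7.le]
  have h9 : Real.exp (x ^ 2 / 2) * Real.exp (x ^ 2 / 2) = Real.exp (x ^ 2) := by
    rw [← Real.exp_add]; ring_nf
  have h10 : Real.cosh x ^ 2 ≤ Real.exp (x ^ 2 / 2) * Real.exp (x ^ 2 / 2) := by
    rw [sq]; gcongr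
  nlinarith [sq_nonneg x]

theorem bubDen_le_near {N : ℝ} (hs : 0 < s) (hs1 : s ≤ 1) (hb1 : 0 ≤ b₁)
    (hb : b₁ ^ 2 + b₂ ^ 2 + s ^ 2 = 1)
    (hb2 : |b₂| ≤ N * s) (hyz : y ^ 2 + z ^ 2 ≤ 1) (hy : 1 / 2 ≤ y) {t τ : ℝ}
    (hτ : |τ| ≤ s / 2) (hρ : Real.cosh t - y + s ^ 2 ≤ 1) :
    bubDen b₁ b₂ (τ - t) y z ≤ (8 + 3 / 2 * N ^ 2) * (Real.cosh t - y + s ^ 2) := by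
  set ρ := Real.cosh t - y + s ^ 2 with hρd
  have hy1 : y ≤ 1 := by nlinarith [sq_nonneg z]
  have hc1 := Real.one_le_cosh t
  have hb1' : b₁ ≤ 1 := by nlinarith [sq_nonneg s, sq_nonneg b₂]
  have hb2' : b₂ ^ 2 ≤ N ^ 2 * s ^ 2 := by
    rw [← sq_abs, ← mul_pow]; gcongr
  have hN2 := sq_nonneg N
  have hs2 := sq_nonneg s
  have hc2 : Real.cosh t ≤ 2 := by linarith
  have hτ2 : τ ^ 2 ≤ s ^ 2 / 4 := by
    rw [← sq_abs]; nlinarith [abs_nonneg τ]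
  have hsσ : s ^ 2 ≤ ρ := by linarith
  have hcρ : Real.cosh t - 1 ≤ ρ := by linarith
  have hyρ : 1 - y ≤ ρ := by linarith
  have hsh := abs_sinh_le_two (x := τ) (by linarith)
  have hsh2 : Real.sinh t ^ 2 ≤ 3 * (Real.cosh t - 1) := by
    have : Real.sinh t ^ 2 = (Real.cosh t - 1) * (Real.cosh t + 1) := by
      linarith [Real.cosh_sq t]
    rw [this]; nlinarith
  have hcτ : Real.cosh τ - 1 ≤ Real.sinh τ ^ 2 / 2 := by
    have : Real.sinh τ ^ 2 = (Real.cosh τ - 1) * (Real.cosh τ + 1) := by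
      linarith [Real.cosh_sq τ]
    have := Real.one_le_cosh τ
    nlinarith
  have h1 : Real.cosh (τ - t) - Real.cosh t ≤ 3 * ρ := by
    rw [Real.cosh_sub]
    have e1 : Real.cosh t * (Real.cosh τ - 1) ≤ 2 * (s ^ 2 / 2) := by
      have := Real.one_le_cosh τ
      have : Real.cosh τ - 1 ≤ s ^ 2 / 2 := by linarith
      gcongr
    have e2 : -(Real.sinh τ * Real.sinh t) ≤ (Real.sinh τ ^ 2 + Real.sinh t ^ 2) / 2 := by
      nlinarith [sq_nonneg (Real.sinh τ + Real.sinh t)]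
    linarith
  have h2 : (1 - b₁) * y ≤ (N ^ 2 + 1) * ρ := by
    have e1 : 1 - b₁ ≤ (N ^ 2 + 1) * s ^ 2 := by nlinarith
    have e2 : (1 - b₁) * y ≤ (1 - b₁) * 1 := by gcongr
    have e3 : (N ^ 2 + 1) * s ^ 2 ≤ (N ^ 2 + 1) * ρ := by gcongr
    linarith
  have h3 : -(b₂ * z) ≤ N ^ 2 * ρ / 2 + ρ := by
    have e1 : -(b₂ * z) ≤ (b₂ ^ 2 + z ^ 2) / 2 := by nlinarith [sq_nonneg (b₂ + z)]
    have e2 : z ^ 2 / 2 ≤ 1 - y := by nlinarith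
    have e3 : N ^ 2 * s ^ 2 ≤ N ^ 2 * ρ := by gcongr
    linarith
  unfold bubDen
  linarith

end

theorem two_rpow_le {k : ℝ} (hk : 1 ≤ k) : (2:ℝ) ^ ((k + 2) / k) ≤ 8 := by
  have h : (k + 2) / k ≤ 3 := by
    rw [div_le_iff₀ (by linarith)]; linarith
  calc (2:ℝ) ^ ((k + 2) / k) ≤ 2 ^ (3:ℝ) := Real.rpow_le_rpow_of_exponent_le one_le_two h
    _ = 8 := by norm_num

theorem rpow_div_rpow {k x : ℝ} (hk : 1 ≤ k) (hx : 0 ≤ x) :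
    (x ^ k) ^ ((k + 2) / k) = x ^ (k + 2) := by
  rw [← Real.rpow_mul hx]
  congr 1
  have : k ≠ 0 := by linarith
  field_simp

theorem rpow_le_of_le_two_mul {k x V : ℝ} (hk : 1 ≤ k) (hx : 0 ≤ x) (hV : 0 ≤ V)
    (h : V ≤ 2 * x ^ k) : V ^ ((k + 2) / k) ≤ 8 * x ^ (k + 2) := by
  have hk0 : 0 < k := by linarith
  calc V ^ ((k + 2) / k) ≤ (2 * x ^ k) ^ ((k + 2) / k) := by gcongr
    _ = 2 ^ ((k + 2) / k) * x ^ (k + 2) := by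
      rw [Real.mul_rpow zero_le_two (by positivity), rpow_div_rpow hk hx]
    _ ≤ 8 * x ^ (k + 2) := by gcongr; exact two_rpow_le hk

theorem le_rpow_of_half_le {k x V : ℝ} (hk : 1 ≤ k) (hx : 0 ≤ x)
    (h : x ^ k / 2 ≤ V) : x ^ (k + 2) / 8 ≤ V ^ ((k + 2) / k) := by
  have hk0 : 0 < k := by linarith
  have h2 := two_rpow_le hk
  calc x ^ (k + 2) / 8 ≤ x ^ (k + 2) / 2 ^ ((k + 2) / k) := by gcongr
    _ = (x ^ k / 2) ^ ((k + 2) / k) := by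
      rw [Real.div_rpow (by positivity) zero_le_two, rpow_div_rpow hk hx]
    _ ≤ V ^ ((k + 2) / k) := by gcongr

theorem div_rpow_le_of_exp_le {k q₀ d t m : ℝ} (hq₀ : 0 ≤ q₀) (hm : 0 ≤ m) (hk : 0 < k)
    (h : k * Real.exp t ≤ d) :
    (q₀ / d) ^ m ≤ (q₀ / k) ^ m * Real.exp (-m * t) := by
  have h0 : 0 < k * Real.exp t := by positivity
  calc (q₀ / d) ^ m ≤ (q₀ / (k * Real.exp t)) ^ m := by
        have : 0 < d := h0.trans_le h
        gcongr
    _ = (q₀ / k * Real.exp (-t)) ^ m := by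
        congr 1; rw [Real.exp_neg]; field_simp
    _ = _ := by
        rw [Real.mul_rpow (by positivity) (Real.exp_pos _).le, ← Real.exp_mul]
        congr 2; ring

/-- Bounds for the power of a function close to the bubble. -/
theorem weight_bounds {k s b₁ b₂ y z N t τ V : ℝ} (hk : 1 ≤ k) (hs : 0 < s) (hs1 : s ≤ 1)
    (hb1 : 0 ≤ b₁) (hb : b₁ ^ 2 + b₂ ^ 2 + s ^ 2 = 1) (hb2 : |b₂| ≤ N * s) (hNs : N * s ≤ 1 / 4)
    (hyz : y ^ 2 + z ^ 2 ≤ 1) (hτ : |τ| ≤ s / 2)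
    (hV : V ≤ 2 * cylBubble k s b₁ b₂ (τ - t) y z)
    (hV' : cylBubble k s b₁ b₂ (τ - t) y z / 2 ≤ V) :
    (y ≤ 1 / 2 → V ^ ((k + 2) / k) ≤ 8 ^ (k + 3) * s ^ (k + 2) * Real.exp (-(k + 2) * t)) ∧
    V ^ ((k + 2) / k) ≤ 8 * (4 / s) ^ (k + 2) * Real.exp (-(k + 2) * t) ∧
    (1 / 2 ≤ y → Real.cosh t - y + s ^ 2 ≤ 1 →
      (1 / 8 * (1 / (2 * (8 + 3 / 2 * N ^ 2))) ^ (k + 2)) * s ^ (k + 2) *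
        (Real.cosh t - y + s ^ 2) ^ (-(k + 2)) ≤ V ^ ((k + 2) / k)) := by
  have hτ' : τ ≤ 1 / 2 := by linarith [le_abs_self τ]
  have hd := bubDen_pos hs hb hyz (τ - t)
  have hV0 : 0 ≤ V := by linarith [cylBubble_pos (k := k) hs hb hyz (τ - t)]
  have hx : 0 ≤ s / 2 / bubDen b₁ b₂ (τ - t) y z := by positivity
  have hw := rpow_le_of_le_two_mul hk hx hV0 hV
  have hw' := le_rpow_of_half_le hk hx hV'
  have hk2 : 0 ≤ k + 2 := by linarith
  refine ⟨fun hy => hw.trans ?_, hw.trans ?_, fun hy hρ => le_trans ?_ hw'⟩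
  · have h1 := bubDen_ge_far (t := t) hb1 hb (hb2.trans hNs) hyz hy hτ'
    have h2 := div_rpow_le_of_exp_le (q₀ := s / 2) (k := 1 / 16)
      (d := bubDen b₁ b₂ (τ - t) y z) (t := t) (m := k + 2)
      (by positivity) hk2 (by norm_num) (by linarith)
    have h3 : s / 2 / (1 / 16) = 8 * s := by ring
    rw [h3, Real.mul_rpow (by norm_num) hs.le] at h2
    have h4 : (8:ℝ) ^ (k + 3) = 8 * 8 ^ (k + 2) := by
      rw [show k + 3 = k + 2 + 1 by ring, Real.rpow_add_one (by norm_num)]; ring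
    rw [h4]
    linarith
  · have h1 := bubDen_ge_exp (t := t) hb hyz hτ'
    have h2 := div_rpow_le_of_exp_le (q₀ := s / 2) (m := k + 2)
      (by positivity) hk2 (by positivity) h1
    have h3 : s / 2 / (s ^ 2 / 8) = 4 / s := by field_simp; norm_num
    rw [h3] at h2
    linarith
  · have h1 := bubDen_le_near hs hs1 hb1 hb hb2 hyz hy hτ hρ
    have hρ0 : 0 < Real.cosh t - y + s ^ 2 :=
      cosh_sub_add_pos (by positivity) (by nlinarith [sq_nonneg z])
    have hC : 0 < 8 + 3 / 2 * N ^ 2 := by positivity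
    rw [Real.rpow_neg hρ0.le]
    have h2 : (s / 2 / ((8 + 3 / 2 * N ^ 2) * (Real.cosh t - y + s ^ 2))) ^ (k + 2) ≤
        (s / 2 / bubDen b₁ b₂ (τ - t) y z) ^ (k + 2) := by gcongr
    have h3 : s / 2 / ((8 + 3 / 2 * N ^ 2) * (Real.cosh t - y + s ^ 2)) =
        1 / (2 * (8 + 3 / 2 * N ^ 2)) * s * (Real.cosh t - y + s ^ 2)⁻¹ := by
      field_simp
    rw [h3, Real.mul_rpow (by positivity) (by positivity), Real.mul_rpow (by positivity) hs.le,
      Real.inv_rpow hρ0.le] at h2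
    linarith

theorem sq_inner_add_sq_inner_le {n : ℕ} {e p θ : Euc n} (he : ‖e‖ = 1) (hp : ‖p‖ = 1)
    (hep : inner ℝ e p = 0) (hθ : ‖θ‖ = 1) : inner ℝ e θ ^ 2 + inner ℝ p θ ^ 2 ≤ 1 := by
  have h := sq_nonneg ‖θ - (inner ℝ e θ • e + inner ℝ p θ • p)‖
  rw [norm_sub_sq_real, norm_add_sq_real, inner_add_right] at h
  simp only [inner_smul_left, inner_smul_right, norm_smul, he, hp, hθ, hep, Real.norm_eq_abs,
    real_inner_comm e θ, real_inner_comm p θ, conj_trivial, mul_one, mul_zero, sq_abs] at h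
  linarith

theorem exists_test_parameters {P Q X Y N : ℝ} (hP : 0 < P) (hQ : 0 < Q) (hX : 0 < X) (hY : 0 < Y) : ∃ g s : ℝ, 0 ≤ g ∧ g ≤ 1 ∧ 0 < s ∧ s < 1 ∧ N * s ≤ 1 / 4 ∧
      P * ((s ^ 2) ^ g + g) ≤ X ∧ Q * (s ^ 2 + g) ≤ Y := by
  obtain ⟨g, hg0, hg1⟩ : ∃ g : ℝ, 0 < g ∧ g < min 1 (min (X / (2 * P)) (Y / (2 * Q))) :=
    exists_between (by positivity)
  simp only [lt_min_iff] at hg1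
  obtain ⟨hg1, hg2, hg3⟩ := hg1
  rw [lt_div_iff₀ (by positivity)] at hg2 hg3
  have h1 : Tendsto (fun s : ℝ => (s ^ 2) ^ g) (𝓝[>] 0) (𝓝 0) := by
    have h2 : ContinuousAt (fun s : ℝ => (s ^ 2) ^ g) 0 := by
      have : ContinuousAt (fun s : ℝ => s ^ 2) 0 := by fun_prop
      exact this.rpow_const (Or.inr hg0.le)
    have := h2.tendsto.mono_left (nhdsWithin_le_nhds (s := Ioi 0))
    simpa [Real.zero_rpow hg0.ne'] using this
  have h2 : Tendsto (fun s : ℝ => s ^ 2) (𝓝[>] 0) (𝓝 0) := by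
    have : ContinuousAt (fun s : ℝ => s ^ 2) 0 := by fun_prop
    simpa using this.tendsto.mono_left (nhdsWithin_le_nhds (s := Ioi 0))
  have h3 : Tendsto (fun s : ℝ => N * s) (𝓝[>] 0) (𝓝 0) := by
    have : ContinuousAt (fun s : ℝ => N * s) 0 := by fun_prop
    simpa using this.tendsto.mono_left (nhdsWithin_le_nhds (s := Ioi 0))
  have e1 := h1.eventually (gt_mem_nhds (show (0:ℝ) < X / (2 * P) by positivity))
  have e2 := h2.eventually (gt_mem_nhds (show (0:ℝ) < Y / (2 * Q) by positivity))
  have e3 := h3.eventually (gt_mem_nhds (show (0:ℝ) < 1 / 4 by norm_num))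
  have e4 : ∀ᶠ s : ℝ in 𝓝[>] 0, s ∈ Ioo (0:ℝ) 1 := Ioo_mem_nhdsGT one_pos
  obtain ⟨s, hs1, hs2, hs3, hs4⟩ := (e1.and (e2.and (e3.and e4))).exists
  rw [lt_div_iff₀ (by positivity)] at hs1 hs2
  refine ⟨g, s, hg0.le, hg1.le, hs4.1, hs4.2, hs3.le, ?_, ?_⟩
  · linarith
  · linarith

section

variable {k s b₁ b₂ y z : ℝ}

theorem exists_bubble_asymptotics {ν : ℝ} (hk : 1 ≤ k) (hν : 0 < ν) : ∃ T : ℝ, 0 ≤ T ∧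
    ∀ r, T ≤ r → 1 - ν / 2 ≤ (((1 + Real.exp (-r)) ^ 2)⁻¹) ^ k ∧ 2 * Real.exp (-r) < 1 ∧
      ((1 - 2 * Real.exp (-r))⁻¹) ^ k ≤ 1 + ν / 4 := by
  have h0 : Tendsto (fun r : ℝ => Real.exp (-r)) atTop (𝓝 0) := Real.tendsto_exp_neg_atTop_nhds_zero
  have c1 : ContinuousAt (fun x : ℝ => (((1 + x) ^ 2)⁻¹) ^ k) 0 := by
    have : ContinuousAt (fun x : ℝ => ((1 + x) ^ 2)⁻¹) 0 := by
      apply ContinuousAt.inv₀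
      · fun_prop
      · norm_num
    exact this.rpow_const (Or.inr (by linarith))
  have c2 : ContinuousAt (fun x : ℝ => ((1 - 2 * x)⁻¹) ^ k) 0 := by
    have : ContinuousAt (fun x : ℝ => (1 - 2 * x)⁻¹) 0 := by
      apply ContinuousAt.inv₀
      · fun_prop
      · norm_num
    exact this.rpow_const (Or.inr (by linarith))
  have t1 := c1.tendsto.comp h0
  have t2 := c2.tendsto.comp h0
  simp only [add_zero, mul_zero, sub_zero, one_pow, inv_one, Real.one_rpow] at t1 t2
  have e1 := t1.eventually (lt_mem_nhds (show 1 - ν / 2 < 1 by linarith))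
  have e2 := t2.eventually (gt_mem_nhds (show 1 < 1 + ν / 4 by linarith))
  have e3 := h0.eventually (gt_mem_nhds (show (0:ℝ) < 1 / 2 by norm_num))
  obtain ⟨T, hT⟩ := eventually_atTop.1 (e1.and (e2.and e3))
  refine ⟨max T 0, le_max_right _ _, fun r hr => ?_⟩
  obtain ⟨h1, h2, h3⟩ := hT r ((le_max_left _ _).trans hr)
  exact ⟨h1.le, by linarith, h2.le⟩

theorem le_cylBubble (hk : 1 ≤ k) (hs : 0 < s) (hb : b₁ ^ 2 + b₂ ^ 2 + s ^ 2 = 1)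
    (hyz : y ^ 2 + z ^ 2 ≤ 1) (r : ℝ) :
    s ^ k * Real.exp (-k * r) * (((1 + Real.exp (-r)) ^ 2)⁻¹) ^ k ≤
      cylBubble k s b₁ b₂ r y z := by
  have h1 := bubDen_le hb hyz r
  have hd := bubDen_pos hs hb hyz r
  have hE := Real.exp_pos r
  have hE' := Real.exp_pos (-r)
  have hEE : Real.exp r * Real.exp (-r) = 1 := by rw [← Real.exp_add]; simp
  have h2 : s * Real.exp (-r) * ((1 + Real.exp (-r)) ^ 2)⁻¹ ≤ s / 2 / bubDen b₁ b₂ r y z := by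
    rw [← div_eq_mul_inv, div_div, div_le_div_iff₀ (by positivity) (by positivity)]
    rw [Real.cosh_eq] at h1
    have : Real.exp (-r) * (2 * bubDen b₁ b₂ r y z) ≤ (1 + Real.exp (-r)) ^ 2 := by
      nlinarith
    nlinarith
  have h3 : s ^ k * Real.exp (-k * r) * (((1 + Real.exp (-r)) ^ 2)⁻¹) ^ k =
      (s * Real.exp (-r) * ((1 + Real.exp (-r)) ^ 2)⁻¹) ^ k := by
    rw [Real.mul_rpow (by positivity) (by positivity), Real.mul_rpow hs.le hE'.le,
      ← Real.exp_mul]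
    congr 3; ring
  rw [h3]
  unfold cylBubble
  gcongr

theorem cylBubble_le (hk : 1 ≤ k) (hs : 0 < s) (hb : b₁ ^ 2 + b₂ ^ 2 + s ^ 2 = 1)
    (hyz : y ^ 2 + z ^ 2 ≤ 1) {r : ℝ} (hr : 2 * Real.exp (-r) < 1) :
    cylBubble k s b₁ b₂ r y z ≤
      s ^ k * Real.exp (-k * r) * ((1 - 2 * Real.exp (-r))⁻¹) ^ k := by
  have h1 := bubDen_ge_sub hb hyz r
  have hd := bubDen_pos hs hb hyz r
  have hE := Real.exp_pos r
  have hE' := Real.exp_pos (-r)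
  have hEE : Real.exp r * Real.exp (-r) = 1 := by rw [← Real.exp_add]; simp
  have h0 : 0 < 1 - 2 * Real.exp (-r) := by linarith
  have h2 : s / 2 / bubDen b₁ b₂ r y z ≤ s * Real.exp (-r) * (1 - 2 * Real.exp (-r))⁻¹ := by
    rw [← div_eq_mul_inv, div_div, div_le_div_iff₀ (by positivity) (by positivity)]
    rw [Real.cosh_eq] at h1
    have : 1 - 2 * Real.exp (-r) ≤ Real.exp (-r) * (2 * bubDen b₁ b₂ r y z) := by
      nlinarith
    nlinarith
  have h3 : s ^ k * Real.exp (-k * r) * ((1 - 2 * Real.exp (-r))⁻¹) ^ k =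
      (s * Real.exp (-r) * (1 - 2 * Real.exp (-r))⁻¹) ^ k := by
    rw [Real.mul_rpow (by positivity) (by positivity), Real.mul_rpow hs.le hE'.le,
      ← Real.exp_mul]
    congr 3; ring
  rw [h3]
  unfold cylBubble
  gcongr

theorem cylBubble_sub_ge (hk : 1 ≤ k) (hs : 0 < s) (hb : b₁ ^ 2 + b₂ ^ 2 + s ^ 2 = 1)
    (hyz : y ^ 2 + z ^ 2 ≤ 1) {t tL ω : ℝ} (ht : 0 ≤ t) (htL : t ≤ tL) (hω : 0 ≤ ω) :
    (s / 2) ^ k * (Real.cosh (tL + ω) + 1) ^ (-(k + 1)) * (2 * ω) * t ≤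
      cylBubble k s b₁ b₂ (t - ω) y z - cylBubble k s b₁ b₂ (t + ω) y z := by
  have h1 := bubDen_pos hs hb hyz (t - ω)
  have h2 := bubDen_pos hs hb hyz (t + ω)
  have h3 : bubDen b₁ b₂ (t + ω) y z - bubDen b₁ b₂ (t - ω) y z =
      2 * Real.sinh t * Real.sinh ω := by
    unfold bubDen; rw [Real.cosh_add, Real.cosh_sub]; ring
  have h4 : bubDen b₁ b₂ (t + ω) y z ≤ Real.cosh (tL + ω) + 1 := by
    refine (bubDen_le hb hyz _).trans ?_
    have : Real.cosh (t + ω) ≤ Real.cosh (tL + ω) := by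
      rw [Real.cosh_le_cosh, abs_of_nonneg (by linarith), abs_of_nonneg (by linarith)]
      linarith
    linarith
  set d₁ := bubDen b₁ b₂ (t - ω) y z
  set d₂ := bubDen b₁ b₂ (t + ω) y z
  have h5 : 2 * t * ω ≤ d₂ - d₁ := by
    rw [h3]
    have := Real.self_le_sinh_iff.2 ht
    have := Real.self_le_sinh_iff.2 hω
    gcongr
  have h50 : 0 ≤ d₂ - d₁ := le_trans (by positivity) h5
  have h6 : d₂ ^ (-(k + 1)) * (d₂ - d₁) ≤ d₁ ^ (-k) - d₂ ^ (-k) := by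
    have e1 : -1 ≤ (d₂ - d₁) / d₁ := by
      have : 0 ≤ (d₂ - d₁) / d₁ := by positivity
      linarith
    have e2 := one_add_mul_self_le_rpow_one_add e1 hk
    have e3 : 1 + (d₂ - d₁) / d₁ = d₂ / d₁ := by field_simp; ring
    rw [e3, Real.div_rpow h2.le h1.le] at e2
    have e4 : (d₂ - d₁) / d₂ ≤ k * ((d₂ - d₁) / d₁) := by
      have : (d₂ - d₁) / d₂ ≤ (d₂ - d₁) / d₁ := by
        gcongr; linarith
      have : 0 ≤ (d₂ - d₁) / d₁ := by positivity
      nlinarith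
    have e5 : 0 < d₂ ^ k := Real.rpow_pos_of_pos h2 k
    have e6 : 0 < d₁ ^ k := Real.rpow_pos_of_pos h1 k
    have e7 : 1 + (d₂ - d₁) / d₂ ≤ d₂ ^ k / d₁ ^ k := by linarith
    rw [show -(k + 1) = -k - 1 by ring, Real.rpow_sub_one h2.ne', Real.rpow_neg h2.le,
      Real.rpow_neg h1.le]
    have e8 : (d₂ ^ k)⁻¹ * (1 + (d₂ - d₁) / d₂) ≤ (d₂ ^ k)⁻¹ * (d₂ ^ k / d₁ ^ k) := by gcongr
    have e9 : (d₂ ^ k)⁻¹ * (d₂ ^ k / d₁ ^ k) = (d₁ ^ k)⁻¹ := by field_simp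
    have e10 : (d₂ ^ k)⁻¹ * (1 + (d₂ - d₁) / d₂) =
        (d₂ ^ k)⁻¹ + (d₂ ^ k)⁻¹ / d₂ * (d₂ - d₁) := by ring
    linarith
  have h7 : (Real.cosh (tL + ω) + 1) ^ (-(k + 1)) ≤ d₂ ^ (-(k + 1)) :=
    Real.rpow_le_rpow_of_nonpos h2 h4 (by linarith)
  have h8 : ∀ d, 0 < d → (s / 2 / d) ^ k = (s / 2) ^ k * d ^ (-k) := fun d hd => by
    rw [Real.div_rpow (by positivity) hd.le, Real.rpow_neg hd.le, div_eq_mul_inv]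
  have h9 : cylBubble k s b₁ b₂ (t - ω) y z - cylBubble k s b₁ b₂ (t + ω) y z =
      (s / 2) ^ k * (d₁ ^ (-k) - d₂ ^ (-k)) := by
    unfold cylBubble
    rw [h8 _ h1, h8 _ h2]; ring
  rw [h9]
  have h10 : (Real.cosh (tL + ω) + 1) ^ (-(k + 1)) * (2 * t * ω) ≤
      d₂ ^ (-(k + 1)) * (d₂ - d₁) := by
    have := Real.rpow_nonneg h2.le (-(k + 1))
    gcongr
  have h11 := mul_le_mul_of_nonneg_left (h10.trans h6)
    (Real.rpow_nonneg (by positivity : 0 ≤ s / 2) k)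
  calc _ = (s / 2) ^ k * ((Real.cosh (tL + ω) + 1) ^ (-(k + 1)) * (2 * t * ω)) := by ring
    _ ≤ _ := h11

end

theorem testT_le {k t : ℝ} (hk : 0 ≤ k) (ht : 0 ≤ t) : testT k t ≤ t := by
  rw [testT_eq]
  have h1 : Real.exp (-k * t) ≤ 1 := Real.exp_le_one_iff.2 (by linarith [mul_nonneg hk ht])
  have h2 := one_sub_exp_neg_nonneg ht
  have h3 := Real.add_one_le_exp (-t)
  nlinarith [Real.exp_pos (-k * t)]

theorem testS_le {k t T : ℝ} (hk : 0 ≤ k) (ht : 0 ≤ t) (htT : t ≤ T) :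
    testS k t ≤ Real.exp (k * T) * t := by
  rw [testS_eq]
  have h1 : Real.exp (k * t) ≤ Real.exp (k * T) := by gcongr
  have h2 := one_sub_exp_neg_nonneg ht
  have h3 := Real.add_one_le_exp (-t)
  gcongr
  linarith

theorem testT_le_exp {k t : ℝ} : testT k t ≤ Real.exp (-k * t) := by
  unfold testT; linarith [Real.exp_pos (-(k + 1) * t)]

theorem testS_le_exp {k t : ℝ} : testS k t ≤ Real.exp (k * t) := by
  unfold testS; linarith [Real.exp_pos ((k - 1) * t)]

theorem barrier_gap {ν : ℝ} (hν : 0 ≤ ν) :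
    (1 + ν) * (1 - 8 * ν) + 4 * ν ≤ (1 - ν) * ((1 - ν) / (1 + ν)) := by
  rw [← mul_div_assoc, le_div_iff₀ (by linarith)]
  nlinarith [sq_nonneg ν, mul_nonneg hν hν, mul_nonneg (mul_nonneg hν hν) hν]

set_option maxHeartbeats 2000000 in
/-- A solution close to a bubble on a long half-cylinder cannot coexist with a dominating
monotone coefficient. -/
theorem no_cylSol_near_bubble (k N Cg : ℝ) (hk : 1 ≤ k) (hCg : 0 ≤ Cg) :
    ∃ s ε : ℝ, 0 < s ∧ s < 1 ∧ N * s ≤ 1 / 4 ∧ 0 < ε ∧ ∀ b₁ b₂ : ℝ, 0 ≤ b₁ →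
      b₁ ^ 2 + b₂ ^ 2 + s ^ 2 = 1 → |b₂| ≤ N * s → ∃ δ L A₁ : ℝ, 0 < δ ∧ 0 < L ∧ 0 < A₁ ∧
      ∀ (n : ℕ) (p e : Euc n) (c a r₁ κ₀ κM : ℝ) (κ W : ℝ → Euc n → ℝ), 1 ≤ n → ‖p‖ = 1 →
        ‖e‖ = 1 → inner ℝ e p = 0 → (n : ℝ) = 2 * k + 2 → IsCylSol p k c r₁ κ W → L ≤ r₁ →
        0 ≤ a → a ≤ δ → c ≤ ε → 0 < κ₀ →
        (∀ r ≤ r₁, ∀ θ ∈ hemisphere p, κ₀ ≤ κ r θ ∧ κ r θ ≤ κM) →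
        (∀ τ ∈ Icc (-(1 / 2)) (1 / 2), ∀ t, 0 ≤ t → τ + t ≤ r₁ → ∀ θ ∈ hemisphere p,
          2 * Real.sinh t * Real.exp τ * (a * (inner ℝ e θ - 1 / 4) -
            Cg * Real.exp (-(2 * k) * r₁) * Real.exp ((2 * k - 1) * t))
          ≤ κ (τ + t) θ - κ (τ - t) θ) →
        (∀ r ≤ r₁, ∀ θ ∈ hemisphere p,
          A₁ * Real.exp (-(2 * k) * r₁) * Real.exp (k * r) ≤ W r θ) →
        (∀ r ≤ L, ∀ θ ∈ hemisphere p,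
          |W r θ - cylBubble k s b₁ b₂ r (inner ℝ e θ) (inner ℝ p θ)| ≤
            δ * cylBubble k s b₁ b₂ r (inner ℝ e θ) (inner ℝ p θ)) →
        (∀ r ∈ Icc (-L) L, ∀ r' ∈ Icc (-L) L, ∀ θ ∈ hemisphere p,
          |(W r θ - cylBubble k s b₁ b₂ r (inner ℝ e θ) (inner ℝ p θ)) -
            (W r' θ - cylBubble k s b₁ b₂ r' (inner ℝ e θ) (inner ℝ p θ))| ≤ δ * |r - r'|) →
        False := by
  have hk0 : 0 < k := by linarith
  set Cb : ℝ := 8 ^ (k + 3) with hCb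
  have hCb0 : 0 < Cb := by positivity
  set D : ℝ := 10 * Cb with hD
  set B : ℝ := 2 * 4 ^ (k + 1) * D with hB
  have hB0 : 0 < B := by positivity
  set c₂ : ℝ := 1 / 8 * (1 / (2 * (8 + 3 / 2 * N ^ 2))) ^ (k + 2) with hc₂
  have hc₂0 : 0 < c₂ := by positivity
  obtain ⟨g, s, hg0, hg1, hs0, hs1, hNs, hgood, hbad⟩ := exists_test_parameters (N := N)
    (P := 4 * (B * (12 * (k + 2) ^ 2))) (Q := B * (6 * (k + 2) ^ 2 * 4 ^ (k + 3)))
    (X := c₂) (Y := Cb) (by positivity) (by positivity) hc₂0 hCb0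
  set ω : ℝ := s / 2 with hω
  have hω0 : 0 < ω := by positivity
  have hω1 : ω ≤ 1 / 2 := by linarith
  set q : ℝ := s ^ (k + 2) with hq
  have hq0 : 0 < q := by positivity
  set Cs : ℝ := 8 * (4 / s) ^ (k + 2) with hCs
  have hCs0 : 0 < Cs := by positivity
  set A : ℝ := 8 * Cs * Cg + 1 with hA
  have hA0 : 0 < A := by positivity
  set ε₁ : ℝ := min 1 (min (1 / (8 * k)) (q * Cb / (2 * k + 3))) with hε₁
  have hε₁0 : 0 < ε₁ := by positivity
  have hε₁1 : ε₁ ≤ 1 := min_le_left _ _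
  have hε₁2 : 8 * k * ε₁ ≤ 1 := by
    have : ε₁ ≤ 1 / (8 * k) := (min_le_right _ _).trans (min_le_left _ _)
    rw [le_div_iff₀ (by positivity)] at this
    linarith
  have hε₁3 : ε₁ * (2 * k + 3) ≤ q * Cb := by
    have : ε₁ ≤ q * Cb / (2 * k + 3) := (min_le_right _ _).trans (min_le_right _ _)
    rwa [le_div_iff₀ (by positivity)] at this
  set CH : ℝ := q * (B * (2 / s ^ 2) ^ (k + 1)) + 2 with hCH
  have hCH0 : 0 < CH := by positivity
  set CW : ℝ := 2 * (4 / s) ^ k + CH * (1 + A * Real.exp k) with hCW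
  have hCW0 : 0 < CW := by positivity
  set ν : ℝ := (1 - Real.exp (-k * (2 * ω))) / 8 with hν
  have hνe : Real.exp (-k * (2 * ω)) = 1 - 8 * ν := by rw [hν]; ring
  have hν0 : 0 < ν := by
    have : Real.exp (-k * (2 * ω)) < 1 := by
      have : 0 < k * (2 * ω) := by positivity
      rw [← Real.exp_zero]
      exact Real.exp_lt_exp.2 (by linarith)
    rw [hν]; linarith
  have hν1 : ν ≤ 1 / 8 := by
    have := Real.exp_pos (-k * (2 * ω))
    rw [hν]; linarith
  set G : ℝ := (k + 1) / k * CW ^ (1 / k) * CH with hG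
  have hG0 : 0 < G := by positivity
  refine ⟨s, min ν (ε₁ / G), hs0, hs1, hNs, by positivity, ?_⟩
  intro b₁ b₂ hb1 hb hb2
  obtain ⟨T, hT0, hT⟩ := exists_bubble_asymptotics (k := k) hk hν0
  set tL : ℝ := T + ω with htL
  set cI : ℝ := (s / 2) ^ k * (Real.cosh (tL + ω) + 1) ^ (-(k + 1)) * (2 * ω) with hcI
  have hcI0 : 0 < cI := by
    have := Real.cosh_pos (tL + ω)
    positivity
  set U₁ : ℝ := cylBubble k s b₁ b₂ (1 - ω) 1 0 with hU₁
  set U₂ : ℝ := cylBubble k s b₁ b₂ (1 + ω) 1 0 with hU₂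
  have hyz1 : (1:ℝ) ^ 2 + 0 ^ 2 ≤ 1 := by norm_num
  have hU₂0 : 0 < U₂ := cylBubble_pos hs0 hb hyz1 _
  have hU₁₂ : U₂ < U₁ := by
    have h := cylBubble_sub_ge hk hs0 hb hyz1 (t := 1) (tL := 1) (ω := ω) zero_le_one le_rfl hω0.le
    have := Real.cosh_pos (1 + ω)
    have : 0 < (s / 2) ^ k * (Real.cosh (1 + ω) + 1) ^ (-(k + 1)) * (2 * ω) * 1 := by positivity
    linarith
  set δ : ℝ := min (1 / 2) (min (ν / 4) (min (cI / (2 * (2 + CH)))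
    (min (4 * ν * s ^ k / CH) ((U₁ - U₂) / (2 * (U₁ + U₂)))))) with hδ
  have hU0 : 0 < U₁ - U₂ := by linarith
  have hU0' : 0 < U₁ + U₂ := by linarith
  have hδ0 : 0 < δ := by positivity
  have hδ1 : δ ≤ 1 / 2 := min_le_left _ _
  have hδ2 : δ ≤ ν / 4 := (min_le_right _ _).trans (min_le_left _ _)
  have hδ3 : (2 + CH) * δ ≤ cI / 2 := by
    have : δ ≤ cI / (2 * (2 + CH)) :=
      (min_le_right _ _).trans ((min_le_right _ _).trans (min_le_left _ _))
    rw [le_div_iff₀ (by positivity)] at this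
    linarith
  have hδ4 : CH * δ ≤ 4 * ν * s ^ k := by
    have : δ ≤ 4 * ν * s ^ k / CH := (min_le_right _ _).trans ((min_le_right _ _).trans
      ((min_le_right _ _).trans (min_le_left _ _)))
    rw [le_div_iff₀ (by positivity)] at this
    linarith
  have hδ5 : 2 * (δ * (U₁ + U₂)) ≤ U₁ - U₂ := by
    have : δ ≤ (U₁ - U₂) / (2 * (U₁ + U₂)) := (min_le_right _ _).trans ((min_le_right _ _).trans
      ((min_le_right _ _).trans (min_le_right _ _)))
    rw [le_div_iff₀ (by positivity)] at this
    linarith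
  obtain ⟨L, hL1, hL2, hL3⟩ : ∃ L : ℝ, tL + ω ≤ L ∧ 2 ≤ L ∧
      CH * (A * Real.exp (-(2 * k) * L) * Real.exp (k * tL)) ≤ cI / 2 := by
    have h0 : Tendsto (fun L : ℝ => CH * (A * Real.exp (-(2 * k) * L) * Real.exp (k * tL))) atTop
        (𝓝 (CH * (A * 0 * Real.exp (k * tL)))) := by
      have : Tendsto (fun L : ℝ => Real.exp (-(2 * k) * L)) atTop (𝓝 0) :=
        Real.tendsto_exp_atBot.comp
          (tendsto_id.const_mul_atTop_of_neg (by linarith : -(2 * k) < 0))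
      exact ((this.const_mul A).mul_const _).const_mul CH
    rw [mul_zero, zero_mul, mul_zero] at h0
    obtain ⟨L, h1, h2, h3⟩ := ((h0.eventually (gt_mem_nhds (half_pos hcI0))).and
      ((eventually_ge_atTop (tL + ω)).and (eventually_ge_atTop 2))).exists
    exact ⟨L, h2, h3, h1.le⟩
  refine ⟨δ, L, max 1 (max (CW * Real.exp k) (CH * A * Real.exp k / ν)), hδ0, by linarith,
    by positivity, ?_⟩
  set A₁ : ℝ := max 1 (max (CW * Real.exp k) (CH * A * Real.exp k / ν)) with hA₁
  have hA₁1 : 1 ≤ A₁ := le_max_left _ _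
  have hA₁2 : CW * Real.exp k ≤ A₁ := (le_max_left _ _).trans (le_max_right _ _)
  have hA₁3 : CH * A * Real.exp k ≤ ν * A₁ := by
    have : CH * A * Real.exp k / ν ≤ A₁ := (le_max_right _ _).trans (le_max_right _ _)
    rw [div_le_iff₀ hν0] at this
    linarith
  intro n p e c a r₁ κ₀ κM κ W hn hp he hep hnk h hLr ha haδ hcε hκ₀ hκ hκd hlow hcl0 hcl1
  have hcν : c ≤ ν := hcε.trans (min_le_left _ _)
  set X : ℝ := Real.exp (-(2 * k) * r₁) with hX
  have hX0 : 0 < X := Real.exp_pos _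
  have hXL : X ≤ Real.exp (-(2 * k) * L) := Real.exp_le_exp.2 (by
    have := mul_le_mul_of_nonneg_left hLr hk0.le
    linarith)
  have hyz : ∀ θ ∈ hemisphere p, inner ℝ e θ ^ 2 + inner ℝ p θ ^ 2 ≤ 1 := fun θ hθ =>
    sq_inner_add_sq_inner_le he hp hep hθ.1
  have hτs : ∀ τ ∈ Icc (-ω) ω, |τ| ≤ s / 2 := fun τ hτ => abs_le.2 hτ
  have hexpk : ∀ x, x ≤ 1 → Real.exp (k * x) ≤ Real.exp k := fun x hx =>
    Real.exp_le_exp.2 (by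
      have := mul_le_mul_of_nonneg_left hx hk0.le
      linarith)
  have hWb : ∀ r ≤ L, ∀ θ ∈ hemisphere p,
      W r θ ≤ (1 + δ) * cylBubble k s b₁ b₂ r (inner ℝ e θ) (inner ℝ p θ) ∧
      (1 - δ) * cylBubble k s b₁ b₂ r (inner ℝ e θ) (inner ℝ p θ) ≤ W r θ := by
    intro r hr θ hθ
    have := abs_le.1 (hcl0 r hr θ hθ)
    constructor <;> linarith
  have hWb' : ∀ r ≤ L, ∀ θ ∈ hemisphere p,
      W r θ ≤ 2 * cylBubble k s b₁ b₂ r (inner ℝ e θ) (inner ℝ p θ) ∧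
      cylBubble k s b₁ b₂ r (inner ℝ e θ) (inner ℝ p θ) / 2 ≤ W r θ := by
    intro r hr θ hθ
    obtain ⟨h1, h2⟩ := hWb r hr θ hθ
    have h3 := cylBubble_pos (k := k) hs0 hb (hyz θ hθ) r
    have h4 := mul_le_mul_of_nonneg_right hδ1 h3.le
    constructor <;> linarith
  have hs21 : s ^ 2 ≤ 1 := pow_le_one₀ hs0.le hs1.le
  have hHle : ∀ t, 0 ≤ t → ∀ θ ∈ hemisphere p,
      testH k g (s ^ 2) q B D a (A * X) ε₁ t (inner ℝ e θ) (inner ℝ p θ)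
        ≤ CH * (a * testT k t + A * X * testS k t) := fun t ht θ hθ =>
    testH_le hk hg0 (by positivity) hs21 hq0.le (by positivity) hB0.le ha
      (by positivity) hε₁1 ht (inner_le_one he hθ.1) hθ.2 (inner_le_one hp hθ.1)
  have hHnn : ∀ t, 0 ≤ t → ∀ θ ∈ hemisphere p,
      0 ≤ testH k g (s ^ 2) q B D a (A * X) ε₁ t (inner ℝ e θ) (inner ℝ p θ) := fun t ht θ hθ =>
    testH_nonneg hk hg1 (by positivity) hs21 hq0.le (by positivity) hB ha
      (by positivity) hε₁0.le ht (neg_one_le_inner he hθ.1)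
      (inner_le_one he hθ.1) hθ.2
  have hHle' : ∀ t, 0 ≤ t → ∀ θ ∈ hemisphere p,
      testH k g (s ^ 2) q B D a (A * X) ε₁ t (inner ℝ e θ) (inner ℝ p θ)
        ≤ CH * (δ * Real.exp (-k * t) + A * X * Real.exp (k * t)) := fun t ht θ hθ => by
    refine (hHle t ht θ hθ).trans ?_
    have := testT_nonneg (k := k) ht
    have h1 := testT_le_exp (k := k) (t := t)
    have h2 := testS_le_exp (k := k) (t := t)
    gcongr
  have hconc := h.sliding hn hp he hep hnk hk (g := g) (σ := s ^ 2) (q := q) (Cb := Cb)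
    (c₂ := c₂) (Cs := Cs) (B := B) (D := D) (a := a) (A := A * X) (ε := ε₁) (E := Cg * X)
    (ω := ω) (κM := κM) (CW := CW) hg0 hg1 (by positivity) hs21 hq0 hCb0 hD hB ha
    (by positivity) hCs0.le (by linarith) (by linarith) hε₁0.le hε₁1 hε₁2 hε₁3
    (by
      have : A * X = 8 * (Cs * (Cg * X)) + X := by rw [hA]; ring
      linarith) (by positivity) hω1
    (fun r hr θ hθ => ⟨hκ₀.le.trans (hκ r hr θ hθ).1, (hκ r hr θ hθ).2⟩)
    (fun τ hτ t ht htr θ hθ => hκd τ ⟨by linarith [hτ.1], by linarith [hτ.2]⟩ t ht htr θ hθ)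
    ?_ ?_ hCW0 ?_ ?_ (by linarith) ?_
  · -- the endpoint contradiction
    have heh : e ∈ hemisphere p := ⟨he, by rw [real_inner_comm, hep]⟩
    have h1 := hconc ω ⟨by linarith, le_rfl⟩ 1 zero_le_one (by linarith) e heh
    have h2 := hHnn 1 zero_le_one e heh
    have h3 := (hWb (ω + 1) (by linarith) e heh).1
    have h4 := (hWb (ω - 1) (by linarith) e heh).2
    have e1 : inner ℝ e e = (1:ℝ) := by rw [real_inner_self_eq_norm_sq, he]; norm_num
    have e2 : inner ℝ p e = (0:ℝ) := by rw [real_inner_comm, hep]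
    rw [e1, e2] at h3 h4
    rw [show ω - 1 = -(1 - ω) by ring, cylBubble_neg, ← hU₁] at h4
    rw [show ω + 1 = 1 + ω by ring, ← hU₂] at h3
    rw [show ω - 1 = -(1 - ω) by ring, show ω + 1 = 1 + ω by ring] at h1
    linarith
  · intro τ hτ t ht htr θ hθ
    obtain ⟨h1, h2⟩ := hWb' (τ - t) (by linarith [hτ.2]) θ hθ
    exact weight_bounds hk hs0 hs1.le hb1 hb hb2 hNs (hyz θ hθ) (hτs τ hτ) h1 h2
  · intro τ hτ t ht htr θ hθ
    have h1 := (hWb' (τ - t) (by linarith [hτ.2]) θ hθ).1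
    have h2 := bubDen_ge_exp hb (hyz θ hθ) (t := t) (τ := τ) (by linarith [hτ.2])
    have h3 := div_rpow_le_of_exp_le (q₀ := s / 2) (m := k) (by positivity) hk0.le
      (by positivity) h2
    rw [show s / 2 / (s ^ 2 / 8) = 4 / s by field_simp; norm_num] at h3
    have h4 := hHle' t ht θ hθ
    have h5 : X * Real.exp (k * t) ≤ Real.exp k * Real.exp (-k * t) := by
      rw [hX, ← Real.exp_add, ← Real.exp_add]
      refine Real.exp_le_exp.2 ?_
      have : k * (2 * (t - r₁)) ≤ k * 1 := by
        gcongr; linarith [hτ.1]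
      linarith
    have h6 : CH * (δ * Real.exp (-k * t) + A * X * Real.exp (k * t)) ≤
        CH * (1 * Real.exp (-k * t) + A * (Real.exp k * Real.exp (-k * t))) := by
      rw [mul_assoc A X]
      gcongr
      linarith
    unfold cylBubble at h1
    calc _ ≤ 2 * ((4 / s) ^ k * Real.exp (-k * t)) +
          CH * (1 * Real.exp (-k * t) + A * (Real.exp k * Real.exp (-k * t))) := by linarith
      _ = CW * Real.exp (-k * t) := by rw [hCW]; ring
  · have h1 : c ≤ ε₁ / G := hcε.trans (min_le_right _ _)
    rw [le_div_iff₀ hG0] at h1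
    calc _ = c * G := by rw [hG, hCH]; ring
      _ ≤ ε₁ := h1
  · intro τ hτ θ hθ
    refine le_trans ?_ (hlow r₁ le_rfl θ hθ)
    have e1 : X * Real.exp (k * r₁) = Real.exp (-k * r₁) := by
      rw [hX, ← Real.exp_add]; ring_nf
    have e2 : Real.exp (-k * (r₁ - τ)) = Real.exp (k * τ) * Real.exp (-k * r₁) := by
      rw [← Real.exp_add]; ring_nf
    rw [mul_assoc, e1, e2, ← mul_assoc]
    have := hexpk τ (by linarith [hτ.2])
    have : CW * Real.exp (k * τ) ≤ A₁ := le_trans (by gcongr) hA₁2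
    gcongr
  · intro t ht htr θ hθ
    have hyzθ := hyz θ hθ
    rcases le_total t tL with htT | htT
    · have h1 := cylBubble_sub_ge hk hs0 hb hyzθ ht htT hω0.le
      rw [← hcI] at h1
      have h2 := hcl1 (-ω + t) ⟨by linarith, by linarith⟩ (-ω - t) ⟨by linarith, by linarith⟩ θ hθ
      rw [show -ω + t - (-ω - t) = 2 * t by ring, abs_of_nonneg (by linarith : 0 ≤ 2 * t),
        show -ω - t = -(t + ω) by ring, cylBubble_neg, show -ω + t = t - ω by ring] at h2
      have h3 := (abs_le.1 h2).1
      rw [show -ω - t = -(t + ω) by ring, show -ω + t = t - ω by ring]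
      have h4 : CH * (a * testT k t + A * X * testS k t) ≤
          CH * (δ * t + A * Real.exp (-(2 * k) * L) * (Real.exp (k * tL) * t)) := by
        have := testT_nonneg (k := k) ht
        have := testS_nonneg (k := k) ht
        have := testT_le hk0.le ht
        have := testS_le hk0.le ht htT
        gcongr
      have h5 := hHle t ht θ hθ
      have h6 : CH * (A * Real.exp (-(2 * k) * L) * Real.exp (k * tL)) * t ≤ cI / 2 * t := by
        gcongr
      have h7 : (2 + CH) * δ * t ≤ cI / 2 * t := by gcongr
      linarith
    · have hbar := h.barrier hn hp hnk hk (κ₀ := κ₀) (rL := T) (μ := s ^ k * ((1 - ν) / (1 + ν)))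
        (ν := ν) hκ₀ (fun r hr θ hθ => (hκ r hr θ hθ).1) hT0 (by linarith)
        (by
          have : 0 < 1 - ν := by linarith
          positivity)
        (by
          have e1 : s ^ k ≤ 1 := Real.rpow_le_one hs0.le hs1.le hk0.le
          have e2 : (1 - ν) / (1 + ν) ≤ 1 := by
            rw [div_le_one (by linarith)]; linarith
          have e3 : 0 ≤ (1 - ν) / (1 + ν) := div_nonneg (by linarith) (by linarith)
          exact mul_le_one₀ e1 e3 e2) hν0 hcν ?_ ?_
      · set r := -ω + t with hr
        have hrT : T ≤ r := by rw [hr]; linarith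
        have h1 := hbar r ⟨hrT, htr⟩ θ hθ
        have h2 := hlow r htr θ hθ
        obtain ⟨-, h4, h5⟩ := hT (t + ω) (by linarith)
        have h6 := cylBubble_le hk hs0 hb hyzθ h4
        have h7 := (hWb (-ω - t) (by linarith) θ hθ).1
        rw [show -ω - t = -(t + ω) by ring, cylBubble_neg] at h7
        rw [show -ω - t = -(t + ω) by ring]
        have hsk : 0 < s ^ k := Real.rpow_pos_of_pos hs0 k
        set Y := Real.exp (-k * r) with hY
        have hY0 : 0 < Y := Real.exp_pos _
        have h8 : Real.exp (-k * (t + ω)) = Y * (1 - 8 * ν) := by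
          rw [hY, ← hνe, ← Real.exp_add, hr]; ring_nf
        have h9 : Real.exp (-k * t) ≤ Y := by
          rw [hY]; refine Real.exp_le_exp.2 ?_
          have := mul_pos hk0 hω0
          rw [hr]; linarith
        have h10 : Real.exp (k * t) ≤ Real.exp k * Real.exp (k * r) := by
          rw [← Real.exp_add]
          refine Real.exp_le_exp.2 ?_
          have : k * ω ≤ k * 1 := by gcongr; linarith
          rw [hr]; linarith
        have h11 := hHle' t ht θ hθ
        have h12 : CH * (δ * Real.exp (-k * t) + A * X * Real.exp (k * t)) ≤
            4 * ν * s ^ k * Y + ν * A₁ * (X * Real.exp (k * r)) := by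
          have f1 : CH * δ * Real.exp (-k * t) ≤ 4 * ν * s ^ k * Y := by gcongr
          have f2 : CH * A * (X * Real.exp (k * t)) ≤
              CH * A * (X * (Real.exp k * Real.exp (k * r))) := by gcongr
          have f3 : CH * A * Real.exp k * (X * Real.exp (k * r)) ≤
              ν * A₁ * (X * Real.exp (k * r)) := by gcongr
          linarith
        have h18 : 0 ≤ 1 - 8 * ν := by linarith
        have h13 : W (-(t + ω)) θ ≤ (1 + ν) * (1 - 8 * ν) * (s ^ k * Y) := by
          have f1 : cylBubble k s b₁ b₂ (t + ω) (inner ℝ e θ) (inner ℝ p θ) ≤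
              s ^ k * (Y * (1 - 8 * ν)) * (1 + ν / 4) := by
            refine h6.trans ?_
            rw [h8]
            gcongr
          have f2 : (1 + δ) * cylBubble k s b₁ b₂ (t + ω) (inner ℝ e θ) (inner ℝ p θ) ≤
              (1 + ν / 4) * (s ^ k * (Y * (1 - 8 * ν)) * (1 + ν / 4)) := by
            have := (cylBubble_pos (k := k) hs0 hb hyzθ (t + ω)).le
            gcongr
          have f3 : (1 + ν / 4) * (1 + ν / 4) ≤ 1 + ν := by
            have := mul_le_mul_of_nonneg_left hν1 hν0.le
            linarith
          have f4 : (1 + ν / 4) * (1 + ν / 4) * (s ^ k * (Y * (1 - 8 * ν))) ≤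
              (1 + ν) * (s ^ k * (Y * (1 - 8 * ν))) := by gcongr
          linarith
        have h14 := barrier_gap hν0.le
        have h15 := mul_le_mul_of_nonneg_right h14 (mul_pos hsk hY0).le
        have h16 := mul_le_mul_of_nonneg_left h1 (by linarith : 0 ≤ 1 - ν)
        have h17 := mul_le_mul_of_nonneg_left h2 hν0.le
        linarith
      · intro θ' hθ'
        refine le_trans ?_ (hWb T (by linarith) θ' hθ').2
        have h1 := le_cylBubble hk hs0 hb (hyz θ' hθ') T
        have h2 := (hT T le_rfl).1
        have hsk : 0 < s ^ k := Real.rpow_pos_of_pos hs0 k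
        have hE := Real.exp_pos (-k * T)
        have h3 : s ^ k * Real.exp (-k * T) * (1 - ν / 2) ≤
            cylBubble k s b₁ b₂ T (inner ℝ e θ') (inner ℝ p θ') := le_trans (by gcongr) h1
        have h4 : (1 - ν / 2) * (s ^ k * Real.exp (-k * T) * (1 - ν / 2)) ≤
            (1 - δ) * cylBubble k s b₁ b₂ T (inner ℝ e θ') (inner ℝ p θ') := by
          have : 0 ≤ 1 - ν / 2 := by linarith
          gcongr
          · linarith
          · linarith
        have h5 : 1 - ν ≤ (1 - ν / 2) * (1 - ν / 2) := by linarith [mul_pos hν0 hν0]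
        have h6 := mul_le_mul_of_nonneg_right h5 (mul_pos hsk hE).le
        have h7 : s ^ k * ((1 - ν) / (1 + ν)) * (1 + ν) * Real.exp (-k * T) =
            (1 - ν) * (s ^ k * Real.exp (-k * T)) := by field_simp
        rw [h7]
        linarith
      · intro θ' hθ'
        refine le_trans ?_ (hlow r₁ le_rfl θ' hθ')
        have e1 : X * Real.exp (k * r₁) = Real.exp (-k * r₁) := by
          rw [hX, ← Real.exp_add]; ring_nf
        rw [mul_assoc A₁, e1]
        have h7 : s ^ k * ((1 - ν) / (1 + ν)) * (1 + ν) = (1 - ν) * s ^ k := by field_simp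
        have e2 : s ^ k ≤ 1 := Real.rpow_le_one hs0.le hs1.le hk0.le
        have : s ^ k * ((1 - ν) / (1 + ν)) * (1 + ν) ≤ A₁ := by
          rw [h7]
          exact (mul_le_one₀ (by linarith) (Real.rpow_nonneg hs0.le k) e2).trans hA₁1
        gcongr

theorem HasSecondDerivAt.comp_curve {u : Euc n → ℝ} {q q' : ℝ → Euc n} {q'' : Euc n} {x : ℝ}
    (hu : ContDiffAt ℝ 2 u (q x)) (h1 : ∀ t, HasDerivAt q (q' t) t) (h2 : HasDerivAt q' q'' x) :
    (∀ᶠ t in 𝓝 x, HasDerivAt (fun t => u (q t)) (fderiv ℝ u (q t) (q' t)) t) ∧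
      HasDerivAt (fun t => fderiv ℝ u (q t) (q' t))
        (fderiv ℝ (fderiv ℝ u) (q x) (q' x) (q' x) + fderiv ℝ u (q x) q'') x := by
  constructor
  · have h : ∀ᶠ y in 𝓝 (q x), ContDiffAt ℝ 2 u y := hu.eventually (by simp)
    filter_upwards [(h1 x).continuousAt.eventually h] with t ht
    exact (ht.differentiableAt (by norm_num)).hasFDerivAt.comp_hasDerivAt t (h1 t)
  · have h : DifferentiableAt ℝ (fderiv ℝ u) (q x) :=
      (hu.fderiv_right (m := 1) (by norm_num)).differentiableAt (by norm_num)
    have h3 : HasDerivAt (fun t => fderiv ℝ u (q t)) (fderiv ℝ (fderiv ℝ u) (q x) (q' x)) x :=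
      h.hasFDerivAt.comp_hasDerivAt x (h1 x)
    exact h3.clm_apply h2

theorem HasSecondDerivAt.exp_mul {f f' : ℝ → ℝ} {d x : ℝ} (C k : ℝ)
    (h1 : ∀ᶠ t in 𝓝 x, HasDerivAt f (f' t) t) (h2 : HasDerivAt f' d x) :
    HasSecondDerivAt (fun t => C * Real.exp (k * t) * f t)
      (C * Real.exp (k * x) * (k ^ 2 * f x + 2 * k * f' x + d)) x := by
  have hE : ∀ t, HasDerivAt (fun t => C * Real.exp (k * t)) (C * Real.exp (k * t) * k) t := by
    intro t
    have := (((hasDerivAt_id t).const_mul k).exp).const_mul C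
    simpa [mul_assoc] using this
  refine ⟨fun t => C * Real.exp (k * t) * k * f t + C * Real.exp (k * t) * f' t, ?_, ?_⟩
  · filter_upwards [h1] with t ht using (hE t).mul ht
  · have h3 := (((hE x).mul_const k).mul h1.self_of_nhds).add ((hE x).mul h2)
    refine h3.congr_deriv ?_
    ring

theorem sum_iteratedFDeriv_orthonormalBasis (u : Euc n → ℝ) (y : Euc n)
    (b : OrthonormalBasis (Fin n) ℝ (Euc n)) :
    ∑ i, fderiv ℝ (fderiv ℝ u) y (b i) (b i) =
      ∑ i, iteratedFDeriv ℝ 2 u y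
        ![EuclideanSpace.single i (1 : ℝ), EuclideanSpace.single i (1 : ℝ)] := by
  have h1 := congrFun (InnerProductSpace.laplacian_eq_iteratedFDeriv_orthonormalBasis u b) y
  have h2 := congrFun (InnerProductSpace.laplacian_eq_iteratedFDeriv_orthonormalBasis u
    (EuclideanSpace.basisFun (Fin n) ℝ)) y
  rw [h1] at h2
  simpa [iteratedFDeriv_two_apply] using h2

/-- Polar decomposition of the Laplacian in logarithmic coordinates. -/
theorem hasCylLap_of_contDiffAt {u : Euc n → ℝ} {x₀ : Euc n} {k μ r : ℝ} (hμ : 0 < μ)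
    (hnk : (n : ℝ) = 2 * k + 2) (b : OrthonormalBasis (Fin n) ℝ (Euc n)) (j₀ : Fin n)
    (hu : ContDiffAt ℝ 2 u (x₀ + (μ * Real.exp r) • b j₀)) :
    HasCylLap b j₀ (fun r θ => (μ * Real.exp r) ^ k * u (x₀ + (μ * Real.exp r) • θ)) r
      ((μ * Real.exp r) ^ k * (k ^ 2 * u (x₀ + (μ * Real.exp r) • b j₀) + (μ * Real.exp r) ^ 2 *
        ∑ i, fderiv ℝ (fderiv ℝ u) (x₀ + (μ * Real.exp r) • b j₀) (b i) (b i))) := by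
  set y := x₀ + (μ * Real.exp r) • b j₀ with hy
  set ρ := μ * Real.exp r with hρ
  set D := fderiv ℝ u y (b j₀) with hD
  set H := fun i => fderiv ℝ (fderiv ℝ u) y (b i) (b i) with hH
  have hpow : ∀ t, (μ * Real.exp t) ^ k = μ ^ k * Real.exp (k * t) := fun t => by
    rw [Real.mul_rpow hμ.le (Real.exp_pos t).le, ← Real.exp_mul, mul_comm t k]
  refine ⟨μ ^ k * Real.exp (k * r) * (k ^ 2 * u y + 2 * k * (ρ * D) + (ρ ^ 2 * H j₀ + ρ * D)),
    fun j => ρ ^ k * (ρ ^ 2 * H j - ρ * D), ?_, ?_, ?_⟩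
  · have hE : ∀ t, HasDerivAt (fun t => x₀ + (μ * Real.exp t) • b j₀)
        ((μ * Real.exp t) • b j₀) t := fun t =>
      (((Real.hasDerivAt_exp t).const_mul μ).smul_const (b j₀)).const_add x₀
    have hE' : HasDerivAt (fun t => (μ * Real.exp t) • b j₀) ((μ * Real.exp r) • b j₀) r :=
      ((Real.hasDerivAt_exp r).const_mul μ).smul_const (b j₀)
    obtain ⟨h1, h2⟩ := HasSecondDerivAt.comp_curve hu hE hE'
    have h3 := HasSecondDerivAt.exp_mul (μ ^ k) k h1 h2
    have e : (fun t => (μ * Real.exp t) ^ k * u (x₀ + (μ * Real.exp t) • b j₀)) =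
        fun t => μ ^ k * Real.exp (k * t) * u (x₀ + (μ * Real.exp t) • b j₀) := by
      funext t; rw [hpow]
    rw [e]
    convert h3 using 1
    simp only [← hρ, ← hy, map_smul, smul_eq_mul, ← hD, hH, FunLike.coe_smul, Pi.smul_apply]
    ring
  · intro j hj
    have hc : ∀ t, HasDerivAt (fun φ => x₀ + ρ • (Real.cos φ • b j₀ + Real.sin φ • b j))
        (ρ • (-Real.sin t • b j₀ + Real.cos t • b j)) t := fun t =>
      ((((Real.hasDerivAt_cos t).smul_const (b j₀)).add
        ((Real.hasDerivAt_sin t).smul_const (b j))).const_smul ρ).const_add x₀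
    have hc' : HasDerivAt (fun φ => ρ • (-Real.sin φ • b j₀ + Real.cos φ • b j))
        (ρ • (-Real.cos 0 • b j₀ + -Real.sin 0 • b j)) 0 :=
      ((((Real.hasDerivAt_sin 0).neg).smul_const (b j₀)).add
        ((Real.hasDerivAt_cos 0).smul_const (b j))).const_smul ρ
    have hu' : ContDiffAt ℝ 2 u (x₀ + ρ • (Real.cos 0 • b j₀ + Real.sin 0 • b j)) := by
      simpa using hu
    obtain ⟨h1, h2⟩ := HasSecondDerivAt.comp_curve hu' hc hc'
    have h3 : HasSecondDerivAt (fun φ => u (x₀ + ρ • (Real.cos φ • b j₀ + Real.sin φ • b j)))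
      _ 0 := ⟨_, h1, h2⟩
    convert h3.const_mul (ρ ^ k) using 1
    simp only [Real.cos_zero, Real.sin_zero, one_smul, zero_smul, add_zero, neg_zero, zero_add,
      neg_smul, ← hy, map_smul, smul_eq_mul, hH, FunLike.coe_smul, Pi.smul_apply, map_neg, smul_neg,
      ← hD]
    ring
  · rw [← hpow, ← hρ, ← Finset.mul_sum, Finset.sum_sub_distrib, ← Finset.mul_sum, Finset.sum_const,
      Finset.card_erase_of_mem (Finset.mem_univ _), Finset.card_univ, Fintype.card_fin,
      ← Finset.add_sum_erase Finset.univ H (Finset.mem_univ j₀), nsmul_eq_mul,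
      Nat.cast_sub (Nat.succ_le_of_lt (Fin.pos j₀)), hnk]
    push_cast
    ring

/-- The inner unit normal of the upper half-space. -/
def normalVec (n : ℕ) (h0 : 0 < n) : Euc n := EuclideanSpace.single (lastIdx n h0) (1 : ℝ)

theorem norm_normalVec (h0 : 0 < n) : ‖normalVec n h0‖ = 1 := by simp [normalVec]

theorem inner_normalVec (h0 : 0 < n) (x : Euc n) :
    inner ℝ (normalVec n h0) x = x (lastIdx n h0) := by
  simp [normalVec, EuclideanSpace.inner_single_left]

theorem normalVec_last (h0 : 0 < n) : normalVec n h0 (lastIdx n h0) = 1 := by simp [normalVec]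

theorem continuous_last (h0 : 0 < n) : Continuous fun x : Euc n => x (lastIdx n h0) := by
  fun_prop

theorem isOpen_halfBall (h0 : 0 < n) (r : ℝ) : IsOpen (halfBall n h0 r) :=
  isOpen_ball.inter (isOpen_lt continuous_const (continuous_last h0))

theorem convex_halfBall (h0 : 0 < n) (r : ℝ) : Convex ℝ (halfBall n h0 r) := by
  refine (convex_ball _ _).inter ?_
  intro x hx y hy a b ha hb hab
  simp only [upperHalf, mem_ofPred_eq, PiLp.add_apply, PiLp.smul_apply, smul_eq_mul] at *
  rcases ha.eq_or_lt with rfl | ha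
  · have : b = 1 := by linarith
    subst this; linarith
  · have := mul_pos ha hx
    have := mul_nonneg hb hy.le
    linarith

theorem mem_closure_halfBall (h0 : 0 < n) {r : ℝ} {y : Euc n} (h1 : ‖y‖ < r)
    (h2 : 0 ≤ y (lastIdx n h0)) : y ∈ closure (halfBall n h0 r) := by
  have hc : Continuous fun t : ℝ => y + t • normalVec n h0 := by fun_prop
  have h3 : Tendsto (fun t : ℝ => y + t • normalVec n h0) (𝓝[>] 0) (𝓝 y) := by
    have := (hc.tendsto 0).mono_left (nhdsWithin_le_nhds (s := Ioi 0))
    simpa using this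
  refine mem_closure_of_tendsto h3 ?_
  have h4 : ∀ᶠ t in 𝓝[>] (0:ℝ), y + t • normalVec n h0 ∈ ball (0 : Euc n) r :=
    h3.eventually (isOpen_ball.mem_nhds (by simpa using h1))
  filter_upwards [h4, self_mem_nhdsWithin] with t ht ht0
  refine ⟨ht, ?_⟩
  simp only [upperHalf, mem_ofPred_eq, PiLp.add_apply, PiLp.smul_apply, smul_eq_mul, normalVec_last]
  have : 0 < t := ht0
  linarith

theorem closure_halfBall_subset (h0 : 0 < n) (r : ℝ) {y : Euc n}
    (hy : y ∈ closure (halfBall n h0 r)) : ‖y‖ ≤ r ∧ 0 ≤ y (lastIdx n h0) := by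
  have hc : IsClosed {y : Euc n | ‖y‖ ≤ r ∧ 0 ≤ y (lastIdx n h0)} :=
    (isClosed_le continuous_norm continuous_const).inter
      (isClosed_le continuous_const (continuous_last h0))
  refine closure_minimal ?_ hc hy
  rintro z ⟨h1, h2⟩
  exact ⟨by simpa using (mem_ball_zero_iff.1 h1).le, le_of_lt h2⟩

theorem uniqueDiffOn_halfBall (h0 : 0 < n) {r : ℝ} (hr : 0 < r) :
    UniqueDiffOn ℝ (closure (halfBall n h0 r)) := by
  refine uniqueDiffOn_convex (convex_halfBall h0 r).closure ?_
  refine ⟨(r / 2) • normalVec n h0, interior_mono subset_closure ?_⟩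
  rw [(isOpen_halfBall h0 r).interior_eq]
  refine ⟨?_, ?_⟩
  · rw [mem_ball_zero_iff, norm_smul, norm_normalVec, Real.norm_of_nonneg (by positivity)]
    linarith
  · simp only [upperHalf, mem_ofPred_eq, PiLp.smul_apply, smul_eq_mul, normalVec_last]
    linarith

theorem isCompact_closure_halfBall (h0 : 0 < n) (r : ℝ) :
    IsCompact (closure (halfBall n h0 r)) :=
  (isCompact_closedBall (0 : Euc n) r).of_isClosed_subset isClosed_closure fun y hy => by
    simpa using (closure_halfBall_subset h0 r hy).1

theorem polar_mem (h0 : 0 < n) {x₀ θ : Euc n} {ρ r : ℝ} (hx : x₀ (lastIdx n h0) = 0)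
    (hρ : 0 ≤ ρ) (hr : ‖x₀‖ + ρ < r) (hθ : θ ∈ hemisphere (normalVec n h0)) :
    x₀ + ρ • θ ∈ closure (halfBall n h0 r) := by
  have h2 := hθ.2
  rw [inner_normalVec] at h2
  refine mem_closure_halfBall h0 ?_ ?_
  · refine (norm_add_le _ _).trans_lt ?_
    rw [norm_smul, hθ.1, Real.norm_of_nonneg hρ]; linarith
  · simp only [PiLp.add_apply, PiLp.smul_apply, smul_eq_mul, hx]
    have := mul_nonneg hρ h2
    linarith

/-- A solution of the boundary Yamabe system in logarithmic polar coordinates. -/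
theorem IsYamabeSol.isCylSol {h0 : 0 < n} {K u : Euc n → ℝ} {c : ℝ}
    (h : IsYamabeSol n h0 K (fun _ => c) u) {x₀ : Euc n} {k μ r₁ : ℝ} (hk : 0 < k)
    (hnk : (n : ℝ) = 2 * k + 2) (hμ : 0 < μ) (hx : x₀ (lastIdx n h0) = 0)
    (hr : ‖x₀‖ + μ * Real.exp r₁ < 1) :
    IsCylSol (normalVec n h0) k c r₁ (fun r θ => K (x₀ + (μ * Real.exp r) • θ))
      (fun r θ => (μ * Real.exp r) ^ k * u (x₀ + (μ * Real.exp r) • θ)) := by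
  obtain ⟨hu, hpos, hpde, hbd⟩ := h
  have hρ : ∀ r, 0 < μ * Real.exp r := fun r => mul_pos hμ (Real.exp_pos r)
  have hle : ∀ r ≤ r₁, ‖x₀‖ + μ * Real.exp r < 1 := fun r hr1 => by
    have : μ * Real.exp r ≤ μ * Real.exp r₁ := by gcongr
    linarith
  have hmem : ∀ r ≤ r₁, ∀ θ ∈ hemisphere (normalVec n h0),
      x₀ + (μ * Real.exp r) • θ ∈ closure (halfBall n h0 1) := fun r hr1 θ hθ =>
    polar_mem h0 hx (hρ r).le (hle r hr1) hθ
  have e1 : ((n : ℝ) + 2) / ((n : ℝ) - 2) = (k + 2) / k := by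
    rw [hnk, show 2 * k + 2 + 2 = 2 * (k + 2) by ring, show 2 * k + 2 - 2 = 2 * k by ring,
      mul_div_mul_left _ _ two_ne_zero]
  have e2 : (n : ℝ) / ((n : ℝ) - 2) = (k + 1) / k := by
    rw [hnk, show 2 * k + 2 = 2 * (k + 1) by ring, show 2 * (k + 1) - 2 = 2 * k by ring,
      mul_div_mul_left _ _ two_ne_zero]
  refine ⟨?_, ?_, ?_, ?_⟩
  · refine ContinuousOn.mul (Continuous.continuousOn ?_) ?_
    · refine Continuous.rpow_const (by fun_prop) fun x => Or.inr hk.le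
    · refine hu.continuousOn.comp (Continuous.continuousOn (by fun_prop)) ?_
      rintro ⟨r, θ⟩ ⟨h1, h2⟩
      exact hmem r h1 θ h2
  · intro r hr1 θ hθ
    exact mul_pos (Real.rpow_pos_of_pos (hρ r) k) (hpos _ (hmem r hr1 θ hθ))
  · intro r hr1 b j₀ hb
    have hbn : ‖b j₀‖ = 1 := b.norm_eq_one j₀
    have hin : x₀ + (μ * Real.exp r) • b j₀ ∈ halfBall n h0 1 := by
      rw [inner_normalVec] at hb
      refine ⟨?_, ?_⟩
      · rw [mem_ball_zero_iff]
        refine (norm_add_le _ _).trans_lt ?_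
        rw [norm_smul, hbn, Real.norm_of_nonneg (hρ r).le, mul_one]
        exact hle r hr1.le
      · simp only [upperHalf, mem_ofPred_eq, PiLp.add_apply, PiLp.smul_apply, smul_eq_mul, hx]
        have := mul_pos (hρ r) hb
        linarith
    set y := x₀ + (μ * Real.exp r) • b j₀ with hy
    have hyS := subset_closure hin
    have hnhds : closure (halfBall n h0 1) ∈ 𝓝 y :=
      mem_of_superset ((isOpen_halfBall h0 1).mem_nhds hin) subset_closure
    have huy : ContDiffAt ℝ 2 u y := (hu y hyS).contDiffAt hnhds
    have h1 := hasCylLap_of_contDiffAt (k := k) hμ hnk b j₀ huy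
    have h2 := hpde y hin
    have h3 : lapWithin n (closure (halfBall n h0 1)) u y =
        ∑ i, fderiv ℝ (fderiv ℝ u) y (b i) (b i) := by
      rw [sum_iteratedFDeriv_orthonormalBasis, lapWithin]
      refine Finset.sum_congr rfl fun i _ => ?_
      rw [iteratedFDerivWithin_eq_iteratedFDeriv (uniqueDiffOn_halfBall h0 one_pos) huy hyS]
    rw [h3, e1] at h2
    convert h1 using 1
    rw [← hy, Real.mul_rpow (Real.rpow_nonneg (hρ r).le k) (hpos y hyS).le,
      ← Real.rpow_mul (hρ r).le, show k * ((k + 2) / k) = k + 2 by field_simp,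
      Real.rpow_add (hρ r), Real.rpow_two]
    have h4 : ∑ i, fderiv ℝ (fderiv ℝ u) y (b i) (b i) = -(K y * u y ^ ((k + 2) / k)) := by
      linarith
    rw [h4]; ring
  · intro r hr1 θ hθ hpθ
    have hθm : θ ∈ hemisphere (normalVec n h0) := ⟨hθ, hpθ.ge⟩
    set y := x₀ + (μ * Real.exp r) • θ with hy
    have hyS := hmem r hr1.le θ hθm
    have hyb : y ∈ flatBdry n h0 1 := by
      rw [inner_normalVec] at hpθ
      refine ⟨?_, ?_⟩
      · rw [mem_ball_zero_iff]
        refine (norm_add_le _ _).trans_lt ?_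
        rw [norm_smul, hθ, Real.norm_of_nonneg (hρ r).le, mul_one]
        exact hle r hr1.le
      · simp [hy, hx, hpθ]
    have h2 := hbd y hyb
    set q : ℝ → Euc n := fun φ => x₀ + (μ * Real.exp r) •
        (Real.cos φ • θ + Real.sin φ • normalVec n h0) with hq
    have hc : HasDerivAt q
        ((μ * Real.exp r) • (-Real.sin 0 • θ + Real.cos 0 • normalVec n h0)) 0 :=
      ((((Real.hasDerivAt_cos 0).smul_const θ).add
        ((Real.hasDerivAt_sin 0).smul_const (normalVec n h0))).const_smul
          (μ * Real.exp r)).const_add x₀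
    have hq0 : q 0 = y := by simp [hq, hy]
    have hfd : HasFDerivWithinAt u (fderivWithin ℝ u (closure (halfBall n h0 1)) y)
        (closure (halfBall n h0 1)) (q 0) := by
      rw [hq0]
      exact ((hu y hyS).differentiableWithinAt (by norm_num)).hasFDerivWithinAt
    have hmaps : MapsTo q (Icc 0 Real.pi) (closure (halfBall n h0 1)) := by
      intro φ hφ
      refine hmem r hr1.le _ ⟨norm_rotation hθ (norm_normalVec h0) hpθ φ, ?_⟩
      rw [inner_rotation (norm_normalVec h0) hpθ]
      exact Real.sin_nonneg_of_mem_Icc hφ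
    have h3 : HasDerivWithinAt (fun φ => u (q φ)) _ (Icc 0 Real.pi) 0 :=
      hfd.comp_hasDerivWithinAt (0:ℝ) hc.hasDerivWithinAt hmaps
    have h3' : HasDerivWithinAt (fun φ => u (q φ)) _ (Ici 0) 0 :=
      h3.mono_of_mem_nhdsWithin (Icc_mem_nhdsGE Real.pi_pos)
    have h4 := h3'.const_mul ((μ * Real.exp r) ^ k)
    refine h4.congr_deriv ?_
    simp only [Real.cos_zero, Real.sin_zero, one_smul, zero_smul, neg_zero, zero_add, map_smul,
      smul_eq_mul]
    have h5 : fderivWithin ℝ u (closure (halfBall n h0 1)) y (normalVec n h0) =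
        c * u y ^ ((k + 1) / k) := by rw [← e2]; exact h2
    rw [h5, Real.mul_rpow (Real.rpow_nonneg (hρ r).le k) (hpos y hyS).le,
      ← Real.rpow_mul (hρ r).le, show k * ((k + 1) / k) = k + 1 by field_simp,
      Real.rpow_add (hρ r), Real.rpow_one]
    ring

theorem le_of_sublinear_bound {P g c : ℝ} {m : ℕ} (hm : 1 ≤ m) (hP : 0 ≤ P)
    (hc : 0 ≤ c) (h : P ≤ g + c * P ^ (((m : ℝ) - 1) / m)) :
    c * P ^ (((m : ℝ) - 1) / m) ≤ g / 4 + 2 * (8 * c) ^ m := by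
  obtain ⟨j, rfl⟩ : ∃ j, m = j + 1 := ⟨m - 1, by omega⟩
  have hm0 : ((j + 1 : ℕ) : ℝ) ≠ 0 := by positivity
  obtain ⟨X, hX, rfl⟩ : ∃ X : ℝ, 0 ≤ X ∧ P = X ^ (j + 1) :=
    ⟨P ^ (1 / ((j + 1 : ℕ) : ℝ)), by positivity, by
      rw [← Real.rpow_natCast, ← Real.rpow_mul hP, one_div_mul_cancel hm0, Real.rpow_one]⟩
  have e : (X ^ (j + 1)) ^ ((((j + 1 : ℕ) : ℝ) - 1) / ((j + 1 : ℕ) : ℝ)) = X ^ j := by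
    rw [← Real.rpow_natCast, ← Real.rpow_mul hX, mul_div_cancel₀ _ hm0, ← Real.rpow_natCast]
    push_cast; ring_nf
  rw [e] at h ⊢
  have key : ∀ q : ℝ, 0 < q → q ≤ 1 → c * X ^ j ≤ q * X ^ (j + 1) + c * (c / q) ^ j := by
    intro q hq _
    rcases le_total c (q * X) with h1 | h1
    · have h2 : c * X ^ j ≤ q * X * X ^ j := by gcongr
      have h3 : 0 ≤ c * (c / q) ^ j := by positivity
      rw [pow_succ]; linarith
    · have h2 : X ≤ c / q := by rw [le_div_iff₀ hq]; linarith
      have h3 : c * X ^ j ≤ c * (c / q) ^ j := by gcongr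
      have h4 : 0 ≤ q * X ^ (j + 1) := by positivity
      linarith
  have h1 := key (1 / 8) (by norm_num) (by norm_num)
  have h2 := key (1 / 2) (by norm_num) (by norm_num)
  rw [show c / (1 / 8) = 8 * c by ring] at h1
  rw [show c / (1 / 2) = 2 * c by ring] at h2
  have h3 : c * (2 * c) ^ j ≤ c * (8 * c) ^ j := by gcongr; norm_num
  have h4 : 8 * (c * (8 * c) ^ j) = (8 * c) ^ (j + 1) := by rw [pow_succ]; ring
  have h5 : 0 ≤ c * (8 * c) ^ j := by positivity
  linarith

/-- A differential inequality for the gradient controls its oscillation. -/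
theorem norm_sub_le_of_norm_fderiv_le {F : Type*} [NormedAddCommGroup F] [NormedSpace ℝ F]
    {G : Euc n → F} {G' : Euc n → Euc n →L[ℝ] F} {S : Set (Euc n)} (hS : Convex ℝ S) {m : ℕ}
    (hm : 1 ≤ m) {C₀ : ℝ} (hC₀ : 0 ≤ C₀) (hG : ∀ y ∈ S, HasFDerivWithinAt G (G' y) S y)
    (hG' : ∀ y ∈ S, ‖G' y‖ ≤ C₀ * ‖G y‖ ^ (((m : ℝ) - 1) / m)) {y z : Euc n} (hy : y ∈ S)
    (hz : z ∈ S) : ‖G z - G y‖ ≤ ‖G y‖ / 4 + 2 * (8 * C₀) ^ m * ‖z - y‖ ^ m := by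
  have hβ : 0 ≤ ((m : ℝ) - 1) / m := by
    have : (1:ℝ) ≤ m := by exact_mod_cast hm
    exact div_nonneg (by linarith) (by linarith)
  have hseg : segment ℝ y z ⊆ S := hS.segment_subset hy hz
  have hcomp : IsCompact (segment ℝ y z) := by
    rw [segment_eq_image]
    exact isCompact_Icc.image (by fun_prop)
  have hcont : ContinuousOn (fun w => ‖G w‖) (segment ℝ y z) := fun w hw =>
    ((hG w (hseg hw)).mono hseg).continuousWithinAt.norm
  obtain ⟨w₀, hw₀, hmax⟩ := hcomp.exists_isMaxOn ⟨y, left_mem_segment ℝ y z⟩ hcont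
  have hbd : ∀ w ∈ segment ℝ y z, ‖G' w‖ ≤ C₀ * ‖G w₀‖ ^ (((m : ℝ) - 1) / m) := fun w hw =>
    (hG' w (hseg hw)).trans (by
      have : ‖G w‖ ≤ ‖G w₀‖ := hmax hw
      gcongr)
  have hmv : ∀ w ∈ segment ℝ y z,
      ‖G w - G y‖ ≤ C₀ * ‖z - y‖ * ‖G w₀‖ ^ (((m : ℝ) - 1) / m) := fun w hw => by
    have h1 := (convex_segment y z).norm_image_sub_le_of_norm_hasFDerivWithin_le
      (fun w hw => (hG w (hseg hw)).mono hseg) hbd (left_mem_segment ℝ y z) hw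
    have h2 : ‖w - y‖ ≤ ‖z - y‖ := by
      rw [segment_eq_image'] at hw
      obtain ⟨t, ht, rfl⟩ := hw
      rw [add_sub_cancel_left, norm_smul, Real.norm_of_nonneg ht.1]
      exact mul_le_of_le_one_left (norm_nonneg _) ht.2
    calc _ ≤ C₀ * ‖G w₀‖ ^ (((m : ℝ) - 1) / m) * ‖w - y‖ := h1
      _ ≤ C₀ * ‖G w₀‖ ^ (((m : ℝ) - 1) / m) * ‖z - y‖ := by gcongr
      _ = _ := by ring
  have h1 : ‖G w₀‖ ≤ ‖G y‖ + C₀ * ‖z - y‖ * ‖G w₀‖ ^ (((m : ℝ) - 1) / m) := by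
    have h2 := hmv w₀ hw₀
    have h3 := norm_sub_norm_le (G w₀) (G y)
    linarith
  have h2 := le_of_sublinear_bound hm (norm_nonneg _) (by positivity) h1
  calc _ ≤ _ := hmv z (right_mem_segment ℝ y z)
    _ ≤ _ := h2
    _ = _ := by rw [show 8 * (C₀ * ‖z - y‖) = (8 * C₀) * ‖z - y‖ by ring, mul_pow]; ring

theorem CondK1.norm_fderivWithin_sub_le (hn : 4 ≤ n) {h0 : 0 < n} {C₀ : ℝ} (hC₀ : 0 ≤ C₀)
    {K : Euc n → ℝ} (hK : CondK1 n h0 C₀ K) {y z : Euc n} (hy : y ∈ closure (halfBall n h0 1))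
    (hz : z ∈ closure (halfBall n h0 1)) :
    ‖fderivWithin ℝ K (closure (halfBall n h0 1)) z
        - fderivWithin ℝ K (closure (halfBall n h0 1)) y‖ ≤
      ‖fderivWithin ℝ K (closure (halfBall n h0 1)) y‖ / 4
        + 2 * (8 * C₀) ^ (n - 3) * ‖z - y‖ ^ (n - 3) := by
  set S := closure (halfBall n h0 1) with hS
  have hu : UniqueDiffOn ℝ S := uniqueDiffOn_halfBall h0 one_pos
  have hK2 : ContDiffOn ℝ 2 K S := hK.1.of_le (by exact_mod_cast (by omega : 2 ≤ n - 2))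
  have hG : ContDiffOn ℝ 1 (fderivWithin ℝ K S) S := hK2.fderivWithin hu (by norm_num)
  have hm : ((n - 3 : ℕ) : ℝ) = (n : ℝ) - 3 := by
    rw [Nat.cast_sub (by omega)]; norm_num
  refine norm_sub_le_of_norm_fderiv_le (G' := fun y => fderivWithin ℝ (fderivWithin ℝ K S) S y)
    (convex_halfBall h0 1).closure (by omega) hC₀
    (fun w hw => ((hG.differentiableOn (by norm_num)) w hw).hasFDerivWithinAt) ?_ hy hz
  intro w hw
  have h1 := hK.2 w hw 2 (by norm_num) (by omega)
  rw [← hS, norm_iteratedFDerivWithin_one _ (hu w hw), ← norm_iteratedFDerivWithin_fderivWithin hu hw,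
    norm_iteratedFDerivWithin_one _ (hu w hw)] at h1
  rw [hm]
  convert h1 using 3
  push_cast; ring

theorem CondK3.fderivWithin_normalVec {h0 : 0 < n} {K : Euc n → ℝ} (hK : CondK3 n h0 K)
    {y : Euc n} (hy1 : ‖y‖ < 1) (hy2 : y (lastIdx n h0) = 0)
    (hd : DifferentiableWithinAt ℝ K (closure (halfBall n h0 1)) y) :
    fderivWithin ℝ K (closure (halfBall n h0 1)) y (normalVec n h0) = 0 := by
  set S := closure (halfBall n h0 1) with hS
  set q : ℝ → Euc n := fun t => y + t • normalVec n h0 with hq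
  have hy : y ∈ S := mem_closure_halfBall h0 hy1 hy2.ge
  have hq' : HasDerivAt q (normalVec n h0) 0 := by
    have := ((hasDerivAt_id (0:ℝ)).smul_const (normalVec n h0)).const_add y
    rw [one_smul] at this
    exact this
  have hq0 : q 0 = y := by simp [hq]
  have hmaps : MapsTo q (Icc 0 (1 - ‖y‖) ∩ Iio (1 - ‖y‖)) S := by
    intro t ht
    refine mem_closure_halfBall h0 ?_ ?_
    · refine (norm_add_le _ _).trans_lt ?_
      rw [norm_smul, norm_normalVec, Real.norm_of_nonneg ht.1.1]
      have : t < 1 - ‖y‖ := ht.2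
      linarith
    · simp only [hq, PiLp.add_apply, PiLp.smul_apply, smul_eq_mul, hy2, normalVec_last]
      have := ht.1.1
      linarith
  have hfd : HasFDerivWithinAt K (fderivWithin ℝ K S y) S (q 0) := by
    rw [hq0]; exact hd.hasFDerivWithinAt
  have h1 : HasDerivWithinAt (fun t => K (q t)) (fderivWithin ℝ K S y (normalVec n h0))
      (Icc 0 (1 - ‖y‖) ∩ Iio (1 - ‖y‖)) 0 :=
    hfd.comp_hasDerivWithinAt (0:ℝ) hq'.hasDerivWithinAt hmaps
  have h2 : HasDerivWithinAt (fun t => K (q t)) 0 (Icc 0 (1 - ‖y‖) ∩ Iio (1 - ‖y‖)) 0 := by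
    refine (hasDerivWithinAt_const (0:ℝ) _ (K y)).congr (fun t ht => ?_) (by rw [hq0])
    refine hK _ (hmaps ht) _ hy fun i hi => ?_
    simp [hq, normalVec, hi]
  have hmem : Icc 0 (1 - ‖y‖) ∩ Iio (1 - ‖y‖) ∈ 𝓝[≥] (0:ℝ) := by
    refine inter_mem (Icc_mem_nhdsGE (by linarith)) (mem_nhdsWithin_of_mem_nhds ?_)
    exact Iio_mem_nhds (by linarith)
  have h3 : HasDerivWithinAt (fun t => K (q t)) (fderivWithin ℝ K S y (normalVec n h0))
      (Ici 0) 0 := h1.mono_of_mem_nhdsWithin hmem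
  have h4 : HasDerivWithinAt (fun t => K (q t)) 0 (Ici 0) 0 := h2.mono_of_mem_nhdsWithin hmem
  exact (uniqueDiffWithinAt_Ici (0:ℝ)).eq_deriv _ h3 h4

/-- The unit tangential direction of the gradient. -/
theorem exists_gradient_direction (hn : 2 ≤ n) (h0 : 0 < n) {G : Euc n →L[ℝ] ℝ}
    (hG : G (normalVec n h0) = 0) :
    ∃ e : Euc n, ‖e‖ = 1 ∧ inner ℝ e (normalVec n h0) = 0 ∧ ∀ θ, G θ = ‖G‖ * inner ℝ e θ := by
  by_cases h : G = 0
  · refine ⟨EuclideanSpace.single ⟨0, h0⟩ 1, by simp, ?_, by simp [h]⟩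
    rw [real_inner_comm, inner_normalVec]
    have : lastIdx n h0 ≠ ⟨0, h0⟩ := by
      simp only [lastIdx, ne_eq, Fin.mk.injEq]; omega
    simp [this]
  · have hn0 : ‖G‖ ≠ 0 := norm_ne_zero_iff.2 h
    have key : ∀ θ, inner ℝ (‖G‖⁻¹ • (InnerProductSpace.toDual ℝ (Euc n)).symm G) θ =
        ‖G‖⁻¹ * G θ := fun θ => by
      rw [real_inner_smul_left, InnerProductSpace.toDual_symm_apply]
    refine ⟨‖G‖⁻¹ • (InnerProductSpace.toDual ℝ (Euc n)).symm G, ?_, ?_, fun θ => ?_⟩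
    · rw [norm_smul, norm_inv, norm_norm, LinearIsometryEquiv.norm_map, inv_mul_cancel₀ hn0]
    · rw [key, hG, mul_zero]
    · rw [key]; field_simp

/-- Growth of `K` along the rays of a polar coordinate system whose centre is displaced from `y`
against the direction of the gradient at `y`. -/
theorem CondK1.polar_growth (hn : 4 ≤ n) {h0 : 0 < n} {C₀ : ℝ} (hC₀ : 0 ≤ C₀)
    {K : Euc n → ℝ} (hK : CondK1 n h0 C₀ K) {y e : Euc n} {k μ d r₁ g : ℝ}
    (hnk : (n : ℝ) = 2 * k + 2) (hy : y ∈ closure (halfBall n h0 1)) (he : ‖e‖ = 1)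
    (hg : ‖fderivWithin ℝ K (closure (halfBall n h0 1)) y‖ = g)
    (hGe : ∀ θ, fderivWithin ℝ K (closure (halfBall n h0 1)) y θ = g * inner ℝ e θ)
    (hμ : 0 < μ) (hd : 0 ≤ d) (hdμ : d ≤ μ) (hlast : (y - d • e) (lastIdx n h0) = 0)
    (hr : ‖y - d • e‖ + μ * Real.exp r₁ < 1) {τ t : ℝ}
    (hτ : τ ∈ Icc (-(1 / 2) : ℝ) (1 / 2)) (ht : 0 ≤ t) (hτt : τ + t ≤ r₁) {θ : Euc n}
    (hθ : θ ∈ hemisphere (normalVec n h0)) :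
    2 * Real.sinh t * Real.exp τ * (μ * g * (inner ℝ e θ - 1 / 4) -
        2 * (8 * C₀) ^ (n - 3) * 3 ^ (n - 3) * Real.exp (-(2 * k) * r₁)
          * Real.exp ((2 * k - 1) * t)) ≤
      K (y - d • e + (μ * Real.exp (τ + t)) • θ) - K (y - d • e + (μ * Real.exp (τ - t)) • θ) := by
  set S := closure (halfBall n h0 1) with hS
  set X := y - d • e with hX
  obtain ⟨m, rfl⟩ : ∃ m, n = m + 3 := ⟨n - 3, by omega⟩
  have hm : 2 * k = (m : ℝ) + 1 := by push_cast at hnk; linarith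
  simp only [Nat.add_sub_cancel]
  have hμr : μ * Real.exp r₁ ≤ 1 := by have := norm_nonneg X; linarith
  have hmem : ∀ r ≤ r₁, X + (μ * Real.exp r) • θ ∈ S := fun r hr' =>
    polar_mem h0 hlast (by positivity) (lt_of_le_of_lt (by gcongr) hr) hθ
  have h1 := hmem (τ + t) hτt
  have h2 := hmem (τ - t) (by linarith)
  have hseg : segment ℝ (X + (μ * Real.exp (τ - t)) • θ) (X + (μ * Real.exp (τ + t)) • θ) ⊆ S :=
    (convex_halfBall h0 1).closure.segment_subset h2 h1
  have hdiff : DifferentiableOn ℝ K S := hK.1.differentiableOn (by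
    exact_mod_cast (by omega : m + 3 - 2 ≠ 0))
  have hexp : Real.exp τ ≤ 2 := by
    have h3 : Real.exp τ ≤ Real.exp (1 / 2) := Real.exp_le_exp.2 hτ.2
    have h4 : Real.exp (1 / 2) ^ 2 = Real.exp 1 := by rw [← Real.exp_nat_mul]; norm_num
    have h5 := Real.exp_one_lt_d9
    nlinarith [Real.exp_pos (1 / 2 : ℝ)]
  have hexpt : 1 ≤ Real.exp t := Real.one_le_exp ht
  have hdist : ∀ r ≤ τ + t, ‖X + (μ * Real.exp r) • θ - y‖ ≤ 3 * μ * Real.exp t := fun r hr' => by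
    have e1 : X + (μ * Real.exp r) • θ - y = (μ * Real.exp r) • θ - d • e := by rw [hX]; abel
    have e2 : ‖(μ * Real.exp r) • θ‖ = μ * Real.exp r := by
      rw [norm_smul, hθ.1, mul_one, Real.norm_of_nonneg (by positivity)]
    have e3 : ‖d • e‖ = d := by rw [norm_smul, he, mul_one, Real.norm_of_nonneg hd]
    have e4 : Real.exp r ≤ 2 * Real.exp t := by
      refine (Real.exp_le_exp.2 hr').trans ?_
      rw [Real.exp_add]
      gcongr
    rw [e1]
    refine (norm_sub_le _ _).trans ?_
    rw [e2, e3]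
    calc μ * Real.exp r + d ≤ μ * (2 * Real.exp t) + μ * Real.exp t := by
          refine add_le_add (by gcongr) (hdμ.trans ?_)
          exact le_mul_of_one_le_right hμ.le hexpt
      _ = _ := by ring
  have hbd : ∀ w ∈ segment ℝ (X + (μ * Real.exp (τ - t)) • θ) (X + (μ * Real.exp (τ + t)) • θ),
      ‖fderivWithin ℝ K S w - fderivWithin ℝ K S y‖ ≤
        g / 4 + 2 * (8 * C₀) ^ m * (3 * μ * Real.exp t) ^ m := fun w hw => by
    have h3 := hK.norm_fderivWithin_sub_le hn hC₀ hy (hseg hw)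
    rw [← hS, hg] at h3
    refine h3.trans ?_
    have h4 : ‖w - y‖ ≤ 3 * μ * Real.exp t := by
      have hc : Convex ℝ (closedBall y (3 * μ * Real.exp t)) := convex_closedBall _ _
      have := hc.segment_subset (x := X + (μ * Real.exp (τ - t)) • θ)
        (y := X + (μ * Real.exp (τ + t)) • θ)
        (mem_closedBall_iff_norm.2 (hdist _ (by linarith)))
        (mem_closedBall_iff_norm.2 (hdist _ le_rfl)) hw
      exact mem_closedBall_iff_norm.1 this
    simp only [Nat.add_sub_cancel]
    gcongr
  have hmv := (convex_segment (𝕜 := ℝ) (X + (μ * Real.exp (τ - t)) • θ)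
      (X + (μ * Real.exp (τ + t)) • θ)).norm_image_sub_le_of_norm_hasFDerivWithin_le'
    (f := K) (f' := fun w => fderivWithin ℝ K S w)
    (fun w hw => (hdiff w (hseg hw)).hasFDerivWithinAt.mono hseg) hbd
    (left_mem_segment ℝ _ _) (right_mem_segment ℝ _ _)
  set ℓ := 2 * Real.sinh t * Real.exp τ * μ with hℓ
  have hsinh : 0 ≤ Real.sinh t := Real.sinh_nonneg_iff.2 ht
  have hℓ0 : 0 ≤ ℓ := by positivity
  have hZ : X + (μ * Real.exp (τ + t)) • θ - (X + (μ * Real.exp (τ - t)) • θ) = ℓ • θ := by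
    rw [add_sub_add_left_eq_sub, ← sub_smul]
    congr 1
    rw [hℓ, Real.sinh_eq, Real.exp_add, sub_eq_add_neg τ t, Real.exp_add]
    ring
  rw [hZ, norm_smul, hθ.1, mul_one, Real.norm_of_nonneg hℓ0, map_smul, hGe, smul_eq_mul,
    Real.norm_eq_abs] at hmv
  have h3 := (abs_le.1 hmv).1
  have hpow : μ ^ (m + 1) ≤ Real.exp (-(2 * k) * r₁) := by
    have h4 : μ ≤ Real.exp (-r₁) := by
      rw [Real.exp_neg, ← one_div, le_div_iff₀ (Real.exp_pos _)]; exact hμr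
    calc μ ^ (m + 1) ≤ Real.exp (-r₁) ^ (m + 1) := by gcongr
      _ = _ := by rw [← Real.exp_nat_mul, hm]; push_cast; ring_nf
  have hexpm : Real.exp t ^ m = Real.exp ((2 * k - 1) * t) := by
    rw [← Real.exp_nat_mul, hm]; ring_nf
  have h5 : 2 * Real.sinh t * Real.exp τ * (2 * (8 * C₀) ^ m * 3 ^ m * μ ^ (m + 1)
      * Real.exp ((2 * k - 1) * t)) ≤ 2 * Real.sinh t * Real.exp τ * (2 * (8 * C₀) ^ m * 3 ^ m *
      Real.exp (-(2 * k) * r₁) * Real.exp ((2 * k - 1) * t)) := by gcongr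
  have h6 : (g / 4 + 2 * (8 * C₀) ^ m * (3 * μ * Real.exp t) ^ m) * ℓ =
      2 * Real.sinh t * Real.exp τ * (μ * g / 4) + 2 * Real.sinh t * Real.exp τ *
      (2 * (8 * C₀) ^ m * 3 ^ m * μ ^ (m + 1) * Real.exp ((2 * k - 1) * t)) := by
    rw [hℓ, mul_pow, mul_pow, hexpm, pow_succ]; ring
  rw [h6] at h3
  have h7 : ℓ * (g * inner ℝ e θ) =
      2 * Real.sinh t * Real.exp τ * (μ * g * inner ℝ e θ) := by rw [hℓ]; ring
  rw [h7] at h3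
  linear_combination h3 + h5

/-- The standard bubble in logarithmic polar coordinates around a displaced centre. -/
theorem rpow_mul_bubble_polar {γ l R t₀ k : ℝ} (hγ : 0 < γ) (hl : 0 < l)
    (hR : R ^ 2 + t₀ ^ 2 + γ ^ 2 = l ^ 2) {e p θ : Euc n} (he : ‖e‖ = 1) (hp : ‖p‖ = 1)
    (hep : inner ℝ e p = 0) (hθ : ‖θ‖ = 1) (r : ℝ) :
    (l * Real.exp r) ^ k *
      (γ / (γ ^ 2 + ‖(-R) • e + (l * Real.exp r) • θ - t₀ • p‖ ^ 2)) ^ k =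
      cylBubble k (γ / l) (R / l) (t₀ / l) r (inner ℝ e θ) (inner ℝ p θ) := by
  have hden : γ ^ 2 + ‖(-R) • e + (l * Real.exp r) • θ - t₀ • p‖ ^ 2 =
      2 * l ^ 2 * Real.exp r * bubDen (R / l) (t₀ / l) r (inner ℝ e θ) (inner ℝ p θ) := by
    have h1 : ‖(-R) • e + (l * Real.exp r) • θ - t₀ • p‖ ^ 2 =
        R ^ 2 + l ^ 2 * Real.exp r ^ 2 + t₀ ^ 2 - 2 * R * l * Real.exp r * inner ℝ e θ
          - 2 * t₀ * l * Real.exp r * inner ℝ p θ := by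
      rw [norm_sub_sq_real, norm_add_sq_real, inner_add_left]
      simp only [norm_smul, real_inner_smul_left, real_inner_smul_right, hep, he, hp, hθ,
        Real.norm_eq_abs, mul_one, sq_abs]
      rw [real_inner_comm p θ]
      ring
    have h2 : Real.exp r * Real.cosh r = (Real.exp r ^ 2 + 1) / 2 := by
      rw [Real.cosh_eq, Real.exp_neg]
      field_simp
    rw [h1, bubDen]
    have h3 : 2 * l ^ 2 * Real.exp r *
        (Real.cosh r - R / l * inner ℝ e θ - t₀ / l * inner ℝ p θ) =
        2 * l ^ 2 * (Real.exp r * Real.cosh r) - 2 * R * l * Real.exp r * inner ℝ e θ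
          - 2 * t₀ * l * Real.exp r * inner ℝ p θ := by
      field_simp
    rw [h3, h2]
    linear_combination hR
  rw [cylBubble, ← Real.mul_rpow (by positivity) (by positivity), hden]
  congr 1
  have := Real.exp_pos r
  rcases eq_or_ne (bubDen (R / l) (t₀ / l) r (inner ℝ e θ) (inner ℝ p θ)) 0 with h0 | h0
  · simp [h0]
  · field_simp

theorem abs_exp_sub_exp_le {a L r r' : ℝ} (ha : 0 ≤ a) (hr : r ≤ L) (hr' : r' ≤ L) :
    |Real.exp (a * r) - Real.exp (a * r')| ≤ a * Real.exp (a * L) * |r - r'| := by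
  have hd : ∀ x ∈ Iic L, HasDerivWithinAt (fun x => Real.exp (a * x))
      (Real.exp (a * x) * (a * 1)) (Iic L) x := fun x _ =>
    (((hasDerivAt_id x).const_mul a).exp).hasDerivWithinAt
  have := (convex_Iic L).norm_image_sub_le_of_norm_hasDerivWithin_le
    (C := a * Real.exp (a * L)) hd (fun x hx => by
      rw [mul_one, Real.norm_of_nonneg (by positivity), mul_comm]
      gcongr
      exact hx) hr' hr
  simpa [Real.norm_eq_abs] using this

/-- Lipschitz bound in the logarithmic radial variable. -/
theorem abs_polar_sub_le {f : Euc n → ℝ} {S : Set (Euc n)} {η l k L : ℝ} (hη : 0 ≤ η)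
    (hl : 0 < l) (hk : 0 ≤ k) (hf : ∀ y ∈ S, |f y| ≤ η)
    (hf' : ∀ y ∈ S, ∀ y' ∈ S, |f y - f y'| ≤ η * ‖y - y'‖) {z θ : Euc n} (hθ : ‖θ‖ = 1)
    (hS : ∀ r ≤ L, z + (l * Real.exp r) • θ ∈ S) {r r' : ℝ} (hr : r ≤ L) (hr' : r' ≤ L) :
    |(l * Real.exp r) ^ k * f (z + (l * Real.exp r) • θ)
        - (l * Real.exp r') ^ k * f (z + (l * Real.exp r') • θ)| ≤
      η * (l ^ k * Real.exp (k * L) * (l * Real.exp L + k)) * |r - r'| := by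
  have hpow : ∀ q : ℝ, (l * Real.exp q) ^ k = l ^ k * Real.exp (k * q) := fun q => by
    rw [Real.mul_rpow hl.le (Real.exp_pos _).le, ← Real.exp_mul, mul_comm q k]
  have h1 := hf' _ (hS r hr) _ (hS r' hr')
  have h2 := hf _ (hS r' hr')
  rw [add_sub_add_left_eq_sub, ← sub_smul, norm_smul, hθ, mul_one, ← mul_sub, norm_mul,
    Real.norm_of_nonneg hl.le, Real.norm_eq_abs] at h1
  have h3 := abs_exp_sub_exp_le zero_le_one hr hr'
  simp only [one_mul] at h3
  have h4 := abs_exp_sub_exp_le hk hr hr'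
  set A := f (z + (l * Real.exp r) • θ)
  set B := f (z + (l * Real.exp r') • θ)
  have e : (l * Real.exp r) ^ k * A - (l * Real.exp r') ^ k * B =
      l ^ k * (Real.exp (k * r) * (A - B) + (Real.exp (k * r) - Real.exp (k * r')) * B) := by
    rw [hpow, hpow]; ring
  have hlk : 0 < l ^ k := Real.rpow_pos_of_pos hl k
  rw [e, abs_mul, abs_of_pos hlk]
  have h5 : |Real.exp (k * r) * (A - B) + (Real.exp (k * r) - Real.exp (k * r')) * B| ≤
      Real.exp (k * L) * (η * (l * (Real.exp L * |r - r'|))) +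
        k * Real.exp (k * L) * |r - r'| * η := by
    refine (abs_add_le _ _).trans ?_
    rw [abs_mul, abs_mul, abs_of_pos (Real.exp_pos _)]
    have h6 : |A - B| ≤ η * (l * (Real.exp L * |r - r'|)) := h1.trans (by gcongr)
    have h7 : Real.exp (k * r) ≤ Real.exp (k * L) := by gcongr
    exact add_le_add (mul_le_mul h7 h6 (abs_nonneg _) (by positivity))
      (mul_le_mul h4 h2 (abs_nonneg _) (by positivity))
  calc _ ≤ l ^ k * (Real.exp (k * L) * (η * (l * (Real.exp L * |r - r'|))) +
        k * Real.exp (k * L) * |r - r'| * η) := by gcongr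
    _ = _ := by ring

theorem TendstoC2LocOn.eventually_close {v : ℕ → Euc n → ℝ} {U : Euc n → ℝ} {D : Set (Euc n)}
    (h : TendstoC2LocOn n v U D) (hD : IsClosed D) (hDc : Convex ℝ D) (hU : Differentiable ℝ U)
    (hUpos : ∀ y, 0 < U y) {B η : ℝ} (hη : 0 < η)
    (hv : ∀ᶠ i in atTop, ∀ y ∈ closedBall 0 B ∩ D, DifferentiableWithinAt ℝ (v i) D y) :
    ∀ᶠ i in atTop, ∀ y ∈ closedBall 0 B ∩ D, |v i y - U y| ≤ η * U y ∧ |v i y - U y| ≤ η ∧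
      ∀ y' ∈ closedBall 0 B ∩ D, |(v i y - U y) - (v i y' - U y')| ≤ η * ‖y - y'‖ := by
  have hS : IsCompact (closedBall 0 B ∩ D) := (isCompact_closedBall 0 B).inter_right hD
  have hSc : Convex ℝ (closedBall 0 B ∩ D) := (convex_closedBall 0 B).inter hDc
  obtain ⟨h1, h2, -⟩ := h _ hS inter_subset_right
  obtain ⟨m, hm, hmU⟩ : ∃ m : ℝ, 0 < m ∧ ∀ y ∈ closedBall 0 B ∩ D, m ≤ U y := by
    rcases (closedBall 0 B ∩ D).eq_empty_or_nonempty with he | hne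
    · exact ⟨1, one_pos, by simp [he]⟩
    · obtain ⟨y, -, hy⟩ := hS.exists_isMinOn hne hU.continuous.continuousOn
      exact ⟨U y, hUpos y, fun z hz => hy hz⟩
  have h1' := (Metric.tendstoUniformlyOn_iff.1 h1) (min η (η * m)) (by positivity)
  have h2' := (Metric.tendstoUniformlyOn_iff.1 h2) η hη
  filter_upwards [h1', h2', hv] with i h3 h4 h5 y hy
  have h6 := h3 y hy
  rw [dist_comm, Real.dist_eq] at h6
  refine ⟨h6.le.trans ((min_le_right _ _).trans ?_), h6.le.trans (min_le_left _ _), ?_⟩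
  · have := hmU y hy
    gcongr
  intro y' hy'
  have hder : ∀ w ∈ closedBall 0 B ∩ D, HasFDerivWithinAt (fun w => v i w - U w)
      (fderivWithin ℝ (v i) D w - fderivWithin ℝ U D w) (closedBall 0 B ∩ D) w := fun w hw =>
    ((h5 w hw).hasFDerivWithinAt.sub
      (hU w).differentiableWithinAt.hasFDerivWithinAt).mono inter_subset_right
  have := hSc.norm_image_sub_le_of_norm_hasFDerivWithin_le hder (C := η) (fun w hw => by
    have h7 := h4 w hw
    rw [dist_comm, dist_eq_norm] at h7
    exact h7.le) hy' hy
  simpa [Real.norm_eq_abs] using this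

theorem nonneg_last_of_mem_closure (h0 : 0 < n) {z : Euc n} (hz : z ∈ closure (upperHalf n h0)) :
    0 ≤ z (lastIdx n h0) :=
  closure_minimal (t := {w : Euc n | 0 ≤ w (lastIdx n h0)})
    (fun w (hw : 0 < w (lastIdx n h0)) => hw.le)
    (isClosed_le continuous_const (continuous_last h0)) hz

theorem differentiableWithinAt_rescaling {h0 : 0 < n} {u : Euc n → ℝ} {x' y : Euc n} {M q : ℝ}
    (hu : DifferentiableOn ℝ u (closure (halfBall n h0 1))) (hq : 0 ≤ q)
    (hx : x' (lastIdx n h0) = 0) (hy : y ∈ closure (upperHalf n h0))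
    (hy1 : ‖x'‖ + q * ‖y‖ < 1) :
    DifferentiableWithinAt ℝ (fun y => u (x' + q • y) / M) (closure (upperHalf n h0)) y := by
  have hnorm : ∀ z : Euc n, ‖x' + q • z‖ ≤ ‖x'‖ + q * ‖z‖ := fun z =>
    (norm_add_le _ _).trans (by rw [norm_smul, Real.norm_of_nonneg hq])
  have hmem : ∀ z ∈ closure (upperHalf n h0) ∩ {z | ‖x'‖ + q * ‖z‖ < 1},
      x' + q • z ∈ closure (halfBall n h0 1) := fun z hz =>
    mem_closure_halfBall h0 ((hnorm z).trans_lt hz.2) (by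
      have := nonneg_last_of_mem_closure h0 hz.1
      simp only [PiLp.add_apply, PiLp.smul_apply, smul_eq_mul, hx]
      positivity)
  have hopen : IsOpen {z : Euc n | ‖x'‖ + q * ‖z‖ < 1} :=
    isOpen_lt (by fun_prop) continuous_const
  have h1 : DifferentiableWithinAt ℝ (fun y => u (x' + q • y))
      (closure (upperHalf n h0) ∩ {z | ‖x'‖ + q * ‖z‖ < 1}) y :=
    (hu _ (hmem y ⟨hy, hy1⟩)).comp y
      ((differentiableAt_id.const_smul q).const_add x').differentiableWithinAt hmem
  have h2 : DifferentiableWithinAt ℝ (fun y => u (x' + q • y)) (closure (upperHalf n h0)) y :=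
    h1.mono_of_mem_nhdsWithin (inter_mem_nhdsWithin _ (hopen.mem_nhds hy1))
  simp only [div_eq_mul_inv]
  exact h2.mul_const M⁻¹

theorem mem_closure_upperHalf (h0 : 0 < n) {y : Euc n} (hy : 0 ≤ y (lastIdx n h0)) :
    y ∈ closure (upperHalf n h0) :=
  closure_mono inter_subset_right
    (mem_closure_halfBall h0 (lt_add_one ‖y‖) hy : y ∈ closure (halfBall n h0 (‖y‖ + 1)))

theorem convex_upperHalf (h0 : 0 < n) : Convex ℝ (upperHalf n h0) := by
  intro x hx y hy a b ha hb hab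
  have hx' : 0 < x (lastIdx n h0) := hx
  have hy' : 0 < y (lastIdx n h0) := hy
  change 0 < (a • x + b • y) (lastIdx n h0)
  simp only [PiLp.add_apply, PiLp.smul_apply, smul_eq_mul]
  rcases ha.eq_or_lt with rfl | ha'
  · have : b = 1 := by linarith
    simp [this, hy']
  · positivity

/-- No blow-up sequence of boundary Yamabe solutions with a nondegenerate bubble profile and small
boundary coefficient exists. -/
theorem exists_no_blowup (hn : 4 ≤ n) (h0 : 0 < n) {C₀ Λ N : ℝ} (hC₀ : 0 ≤ C₀) (hΛ : 0 < Λ)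
    (hN : 1 ≤ N) :
    ∃ ε : ℝ, 0 < ε ∧ ∀ (K : ℕ → Euc n → ℝ) (c : ℕ → ℝ) (c₀ : ℝ) (u : ℕ → Euc n → ℝ)
      (x' : ℕ → Euc n) (Γ : ℕ → ℝ) (γ t₀ k : ℝ), (n : ℝ) = 2 * k + 2 →
      (∀ i, CondK1 n h0 C₀ (K i)) → (∀ i, CondK2 n h0 Λ (K i)) → (∀ i, CondK3 n h0 (K i)) →
      Tendsto c atTop (𝓝 c₀) → c₀ < ε → (∀ i, IsYamabeSol n h0 (K i) (fun _ => c i) (u i)) →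
      (∀ i, x' i (lastIdx n h0) = 0) → (∀ i, ‖x' i‖ < 1 / 2) → (∀ i, 0 < Γ i) →
      Tendsto Γ atTop atTop →
      (∀ i : ℕ, ∀ z ∈ closure (halfBall n h0 (2 / 3)), (i : ℝ) ≤ Γ i ^ k * u i z) →
      0 < γ → |t₀| ≤ N * γ →
      TendstoC2LocOn n (fun i y => u i (x' i + (Γ i)⁻¹ • y) / Γ i ^ k)
        (fun y => (γ / (γ ^ 2 + ‖y - t₀ • normalVec n h0‖ ^ 2)) ^ k)
        (closure (upperHalf n h0)) → False := by
  have hn' : (4:ℝ) ≤ n := by exact_mod_cast hn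
  obtain ⟨s, ε, hs, hs1, hNs, hε, core⟩ := no_cylSol_near_bubble (((n:ℝ) - 2) / 2) N
    (2 * (8 * C₀) ^ (n - 3) * 3 ^ (n - 3)) (by linarith) (by positivity)
  refine ⟨ε, hε, fun K c c₀ u x' Γ γ t₀ k hnk hK1 hK2 hK3 hc hc₀ hu hx'l hx'n hΓ hΓt hlow hγ ht₀
    hconv => ?_⟩
  obtain rfl : ((n:ℝ) - 2) / 2 = k := by linarith
  set k := ((n:ℝ) - 2) / 2 with hk
  have hk1 : 1 ≤ k := by linarith
  have hk0 : 0 < k := by linarith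
  set p := normalVec n h0 with hp
  set l := γ / s with hl
  have hl0 : 0 < l := by positivity
  have hls : l * s = γ := div_mul_cancel₀ _ hs.ne'
  have hRnn : 0 ≤ l ^ 2 - t₀ ^ 2 - γ ^ 2 := by
    have h1 : t₀ ^ 2 ≤ (N * γ) ^ 2 := by rw [← sq_abs]; gcongr
    have h2 : N * γ ≤ l / 4 := by
      rw [← hls]
      calc N * (l * s) = l * (N * s) := by ring
        _ ≤ l * (1 / 4) := by gcongr
        _ = _ := by ring
    have h3 : (N * γ) ^ 2 ≤ (l / 4) ^ 2 := by gcongr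
    have h4 : γ ≤ N * γ := le_mul_of_one_le_left hγ.le hN
    have h5 : γ ^ 2 ≤ (l / 4) ^ 2 := by have := h4.trans h2; gcongr
    have h6 : 0 ≤ l ^ 2 := sq_nonneg l
    rw [div_pow] at h3 h5
    linarith
  set R := √(l ^ 2 - t₀ ^ 2 - γ ^ 2) with hRdef
  have hR0 : 0 ≤ R := Real.sqrt_nonneg _
  have hRsq : R ^ 2 + t₀ ^ 2 + γ ^ 2 = l ^ 2 := by
    rw [hRdef, Real.sq_sqrt hRnn]; ring
  have hRl : R ≤ l := by
    refine abs_le_of_sq_le_sq' ?_ hl0.le |>.2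
    have := sq_nonneg t₀; have := sq_nonneg γ; linarith
  have hγl : γ / l = s := by rw [← hls]; field_simp
  obtain ⟨δ, L, A₁, hδ, hL, hA₁, core⟩ := core (R / l) (t₀ / l) (by positivity)
    (by rw [← hγl]; field_simp; exact hRsq) (by
      rw [abs_div, abs_of_pos hl0, div_le_iff₀ hl0]
      calc |t₀| ≤ N * γ := ht₀
        _ = N * s * l := by rw [← hls]; ring)
  set Cst := l ^ k * Real.exp (k * L) * (l * Real.exp L + k) with hCst
  have hCst0 : 0 < Cst := by positivity
  set η := min δ (δ / Cst) with hη
  have hη0 : 0 < η := by positivity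
  set B := R + l * Real.exp L with hB
  have hB0 : 0 ≤ B := by positivity
  have hden : ∀ y : Euc n, 0 < γ ^ 2 + ‖y - t₀ • p‖ ^ 2 := fun y => by positivity
  have hclose := hconv.eventually_close (B := B) (η := η) isClosed_closure
    (convex_upperHalf h0).closure
    (by
      intro y
      refine DifferentiableAt.rpow_const ?_ (Or.inl (div_pos hγ (hden y)).ne')
      have h1 : DifferentiableAt ℝ (fun y : Euc n => γ ^ 2 + ‖y - t₀ • p‖ ^ 2) y :=
        ((differentiableAt_id.sub_const _).norm_sq ℝ).const_add _
      simp only [div_eq_mul_inv]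
      exact (h1.fun_inv (hden y).ne').const_mul γ)
    (fun y => Real.rpow_pos_of_pos (div_pos hγ (hden y)) _) hη0
    (by
      filter_upwards [hΓt.eventually_gt_atTop (2 * B)] with i hi y hy
      refine differentiableWithinAt_rescaling ((hu i).1.differentiableOn (by norm_num))
        (inv_nonneg.2 (hΓ i).le) (hx'l i) hy.2 ?_
      have h1 : ‖y‖ ≤ B := by simpa using hy.1
      have h2 : (Γ i)⁻¹ * ‖y‖ ≤ 1 / 2 := by
        rw [inv_mul_le_iff₀ (hΓ i)]; linarith
      have := hx'n i
      linarith)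
  obtain ⟨i, hclose, hci, hΓ1, hΓ2, hΓ3, hi⟩ := (hclose.and <| (hc.eventually_le_const hc₀).and <|
    (hΓt.eventually_ge_atTop (l * Λ / δ)).and <|
    (hΓt.eventually_ge_atTop (Real.exp L * (12 * l))).and <|
    (hΓt.eventually_gt_atTop (12 * R)).and <|
    tendsto_natCast_atTop_atTop.eventually_ge_atTop (A₁ * 12 ^ (2 * k) * l ^ k)).exists
  have hΓi := hΓ i
  set S := closure (halfBall n h0 1) with hS
  set r₁ := Real.log (Γ i / (12 * l)) with hr₁
  have hexpr₁ : Real.exp r₁ = Γ i / (12 * l) := Real.exp_log (by positivity)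
  have hLr₁ : L ≤ r₁ := by
    rw [hr₁, Real.le_log_iff_exp_le (by positivity), le_div_iff₀ (by positivity)]
    exact hΓ2
  set μ := l / Γ i with hμ
  have hμ0 : 0 < μ := by positivity
  have hμr₁ : μ * Real.exp r₁ = 1 / 12 := by rw [hμ, hexpr₁]; field_simp
  have hx'S : x' i ∈ S := mem_closure_halfBall h0 (by linarith [hx'n i]) (hx'l i).ge
  have hdiff : DifferentiableOn ℝ (K i) S := (hK1 i).1.differentiableOn (by
    exact_mod_cast (by omega : n - 2 ≠ 0))
  have hu1 : UniqueDiffOn ℝ S := uniqueDiffOn_halfBall h0 one_pos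
  obtain ⟨e, he, hep, hGe⟩ := exists_gradient_direction (by omega) h0
    ((hK3 i).fderivWithin_normalVec (by linarith [hx'n i]) (hx'l i) (hdiff _ hx'S))
  rw [← hS] at hGe
  have hgΛ : ‖fderivWithin ℝ (K i) S (x' i)‖ ≤ Λ := by
    rw [← norm_iteratedFDerivWithin_one _ (hu1 _ hx'S)]
    exact (hK2 i _ hx'S).2 1 le_rfl (by omega)
  have hel : e (lastIdx n h0) = 0 := by
    rw [← inner_normalVec h0, real_inner_comm]; exact hep
  set d := R / Γ i with hd
  have hd0 : 0 ≤ d := by positivity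
  have hdμ : d ≤ μ := by rw [hd, hμ]; gcongr
  have hd12 : d < 1 / 12 := by rw [hd, div_lt_iff₀ hΓi]; linarith
  have hXl : (x' i - d • e) (lastIdx n h0) = 0 := by
    simp [hx'l i, hel]
  have hXn : ‖x' i - d • e‖ + μ * Real.exp r₁ < 2 / 3 := by
    have h1 := norm_sub_le (x' i) (d • e)
    rw [norm_smul, he, mul_one, Real.norm_of_nonneg hd0] at h1
    have := hx'n i
    linarith
  obtain ⟨κM, hκM⟩ := (isCompact_closure_halfBall h0 1).bddAbove_image hdiff.continuousOn
  have hmem1 : ∀ r ≤ r₁, ∀ θ ∈ hemisphere p, x' i - d • e + (μ * Real.exp r) • θ ∈ S :=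
    fun r hr θ hθ => polar_mem h0 hXl (by positivity)
      (lt_of_le_of_lt (by gcongr : _ ≤ ‖x' i - d • e‖ + μ * Real.exp r₁) (by linarith)) hθ
  have hmem2 : ∀ r ≤ r₁, ∀ θ ∈ hemisphere p,
      x' i - d • e + (μ * Real.exp r) • θ ∈ closure (halfBall n h0 (2 / 3)) :=
    fun r hr θ hθ => polar_mem h0 hXl (by positivity)
      (lt_of_le_of_lt (by gcongr : _ ≤ ‖x' i - d • e‖ + μ * Real.exp r₁) hXn) hθ
  set v := fun y => u i (x' i + (Γ i)⁻¹ • y) / Γ i ^ k with hv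
  set U := fun y : Euc n => (γ / (γ ^ 2 + ‖y - t₀ • p‖ ^ 2)) ^ k with hU
  have hWv : ∀ r θ, (μ * Real.exp r) ^ k * u i (x' i - d • e + (μ * Real.exp r) • θ) =
      (l * Real.exp r) ^ k * v ((-R) • e + (l * Real.exp r) • θ) := fun r θ => by
    have e1 : x' i - d • e + (μ * Real.exp r) • θ =
        x' i + (Γ i)⁻¹ • ((-R) • e + (l * Real.exp r) • θ) := by
      rw [smul_add, smul_smul, smul_smul, hd, hμ]
      have h1 : (Γ i)⁻¹ * -R = -(R / Γ i) := by ring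
      have h2 : (Γ i)⁻¹ * (l * Real.exp r) = l / Γ i * Real.exp r := by ring
      rw [h1, h2, neg_smul]; abel
    have e2 : (μ * Real.exp r) ^ k = (l * Real.exp r) ^ k / Γ i ^ k := by
      rw [← Real.div_rpow (by positivity) hΓi.le, hμ]; congr 1; ring
    rw [e1, e2, hv]; ring
  have hWU : ∀ r, ∀ θ ∈ hemisphere p, cylBubble k s (R / l) (t₀ / l) r (inner ℝ e θ) (inner ℝ p θ) =
      (l * Real.exp r) ^ k * U ((-R) • e + (l * Real.exp r) • θ) := fun r θ hθ => by
    rw [hU, rpow_mul_bubble_polar hγ hl0 hRsq he (norm_normalVec h0) hep hθ.1, hγl]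
  have hmemB : ∀ θ ∈ hemisphere p, ∀ r ≤ L,
      (-R) • e + (l * Real.exp r) • θ ∈ closedBall 0 B ∩ closure (upperHalf n h0) := by
    intro θ hθ r hr
    refine ⟨mem_closedBall_zero_iff.2 ?_, mem_closure_upperHalf h0 ?_⟩
    · refine (norm_add_le _ _).trans ?_
      rw [norm_smul, norm_smul, he, hθ.1, mul_one, mul_one, norm_neg, Real.norm_of_nonneg hR0,
        Real.norm_of_nonneg (by positivity), hB]
      gcongr
    · have h1 : 0 ≤ θ (lastIdx n h0) := by rw [← inner_normalVec h0]; exact hθ.2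
      simp only [PiLp.add_apply, PiLp.smul_apply, smul_eq_mul, hel, mul_zero, zero_add]
      positivity
  refine core n p e (c i) (μ * ‖fderivWithin ℝ (K i) S (x' i)‖) r₁ (1 / Λ) κM _ _ (by omega)
    (norm_normalVec h0) he hep hnk ((hu i).isCylSol hk0 hnk hμ0 hXl (by linarith)) hLr₁
    (by positivity) ?_ hci (by positivity) ?_ ?_ ?_ ?_ ?_
  · rw [div_le_iff₀ hδ] at hΓ1
    calc μ * ‖fderivWithin ℝ (K i) S (x' i)‖ ≤ μ * Λ := by gcongr
      _ ≤ δ := by rw [hμ, div_mul_eq_mul_div, div_le_iff₀ hΓi]; linarith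
  · exact fun r hr θ hθ => ⟨(hK2 i _ (hmem1 r hr θ hθ)).1,
      hκM (mem_image_of_mem _ (hmem1 r hr θ hθ))⟩
  · exact fun τ hτ t ht hτt θ hθ => (hK1 i).polar_growth hn hC₀ hnk hx'S he rfl hGe hμ0 hd0 hdμ hXl
      (by linarith) hτ ht hτt hθ
  · intro r hr θ hθ
    have h1 := hlow i _ (hmem2 r hr θ hθ)
    set z := u i (x' i - d • e + (μ * Real.exp r) • θ)
    have hΓk : 0 < Γ i ^ k := Real.rpow_pos_of_pos hΓi k
    have h2 : Real.exp (-(2 * k) * r₁) = 12 ^ (2 * k) * l ^ k * l ^ k / (Γ i ^ k * Γ i ^ k) := by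
      have h3 : Real.exp (-(2 * k) * r₁) = ((12 * l) / Γ i) ^ (2 * k) := by
        rw [show -(2 * k) * r₁ = -r₁ * (2 * k) by ring, Real.exp_mul, Real.exp_neg, hexpr₁,
          inv_div]
      rw [h3, Real.div_rpow (by positivity) hΓi.le, Real.mul_rpow (by norm_num) hl0.le, two_mul,
        Real.rpow_add hl0, Real.rpow_add hΓi]
      ring
    have h4 : (μ * Real.exp r) ^ k = l ^ k / Γ i ^ k * Real.exp (k * r) := by
      rw [Real.mul_rpow hμ0.le (Real.exp_pos r).le, ← Real.exp_mul, mul_comm r k, hμ,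
        Real.div_rpow hl0.le hΓi.le]
    have h5 : (A₁ * 12 ^ (2 * k) * l ^ k) / Γ i ^ k ≤ z := by
      rw [div_le_iff₀ hΓk]; linarith
    simp only [h2, h4]
    calc _ = l ^ k / Γ i ^ k * Real.exp (k * r) * ((A₁ * 12 ^ (2 * k) * l ^ k) / Γ i ^ k) := by
          field_simp
      _ ≤ _ := by gcongr
  · intro r hr θ hθ
    have h1 := (hclose _ (hmemB θ hθ r hr)).1
    simp only [hWv, hWU r θ hθ]
    have h2 : 0 ≤ (l * Real.exp r) ^ k := by positivity
    rw [← mul_sub, abs_mul, abs_of_nonneg h2]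
    have h3 : 0 ≤ U ((-R) • e + (l * Real.exp r) • θ) :=
      (Real.rpow_pos_of_pos (div_pos hγ (hden _)) _).le
    calc _ ≤ (l * Real.exp r) ^ k * (η * U ((-R) • e + (l * Real.exp r) • θ)) := by
          gcongr
      _ ≤ (l * Real.exp r) ^ k * (δ * U ((-R) • e + (l * Real.exp r) • θ)) := by
          gcongr; exact min_le_left _ _
      _ = _ := by ring
  · intro r hr r' hr' θ hθ
    simp only [hWv, hWU _ θ hθ]
    rw [← mul_sub, ← mul_sub]
    refine (abs_polar_sub_le (f := fun y => v y - U y) hη0.le hl0 hk0.le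
      (fun y hy => (hclose y hy).2.1) (fun y hy => (hclose y hy).2.2) hθ.1 (hmemB θ hθ)
      hr.2 hr'.2).trans ?_
    gcongr
    calc η * Cst ≤ δ / Cst * Cst := by gcongr; exact min_le_right _ _
      _ = δ := div_mul_cancel₀ _ hCst0.ne'

end

/-- in the blow-up framework with bounded `T_i`, the gradient of `K_i`
at the projected blow-up points vanishes at the rate `Γ_i^{3-n}`. -/
theorem gradK_vanishes_fast_Ti_bounded (n : ℕ) (hn : 4 ≤ n) (h0 : 0 < n)
    (C₀ Λ : ℝ) (hC₀ : 0 < C₀) (hΛ : 0 < Λ) :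
    ∃ ε : ℝ, 0 < ε ∧
      ∀ (K : ℕ → Euc n → ℝ) (c : ℕ → ℝ) (c₀ : ℝ) (u : ℕ → Euc n → ℝ)
        (x x' : ℕ → Euc n) (σ : ℕ → ℝ) (M Γ : ℕ → ℝ) (Tbar γ t₀ : ℝ)
        (v : ℕ → Euc n → ℝ) (U : Euc n → ℝ),
        (∀ i, CondK1 n h0 C₀ (K i)) →
        (∀ i, CondK2 n h0 Λ (K i)) →
        (∀ i, CondK3 n h0 (K i)) →
        Filter.Tendsto (fun i => K i (x i)) Filter.atTop (nhds ((n : ℝ) * ((n : ℝ) - 2))) →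
        Filter.Tendsto c Filter.atTop (nhds c₀) →
        c₀ < ε →
        (∀ i, IsYamabeSol n h0 (K i) (fun _ => c i) (u i)) →
        (∀ i, x i ∈ closure (upperHalf n h0) ∩ Metric.ball (0 : Euc n) (1/2)) →
        (∀ i, M i = u i (x i)) →
        (∀ i, Γ i = M i ^ ((2 : ℝ) / ((n : ℝ) - 2))) →
        (∀ i, sSup (u i '' closure (halfBall n h0 (1/3))) ≤ M i) →
        Filter.Tendsto σ Filter.atTop (nhds 0) →
        (∀ i, ∀ z ∈ Metric.ball (x i) (σ i) ∩ upperHalf n h0, u i z ≤ M i) →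
        Filter.Tendsto (fun i => Γ i * σ i) Filter.atTop Filter.atTop →
        (∀ i : ℕ, (i : ℝ) < M i * sInf (u i '' closure (halfBall n h0 (2/3)))) →
        (0 ≤ Tbar) →
        Filter.Tendsto (fun i => x i (lastIdx n h0) * Γ i) Filter.atTop (nhds Tbar) →
        (∀ i, x' i = x i - x i (lastIdx n h0) • EuclideanSpace.single (lastIdx n h0) (1 : ℝ)) →
        (γ = if c₀ ≤ 0 then (1 + c₀ ^ 2 / ((n : ℝ) - 2) ^ 2)⁻¹ else 1) →
        (t₀ = γ * c₀ / ((n : ℝ) - 2)) →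
        (∀ y : Euc n, U y =
          (γ / (γ ^ 2 + ‖y - t₀ • EuclideanSpace.single (lastIdx n h0) (1 : ℝ)‖ ^ 2))
            ^ (((n : ℝ) - 2) / 2)) →
        (∀ i y, v i y = u i (x' i + (Γ i)⁻¹ • y) / M i) →
        TendstoC2LocOn n v U (closure (upperHalf n h0)) →
        ∃ C : ℝ, 0 < C ∧
          ∀ i, ‖iteratedFDerivWithin ℝ 1 (K i) (closure (halfBall n h0 1)) (x' i)‖
              * Γ i ^ ((n : ℝ) - 3) ≤ C := by
  have hn' : (4:ℝ) ≤ n := by exact_mod_cast hn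
  obtain ⟨ε₁, hε₁, hno₁⟩ := exists_no_blowup hn h0 hC₀.le hΛ (le_refl (1:ℝ))
  refine ⟨min ε₁ 1, by positivity, ?_⟩
  intro K c c₀ u x x' σ M Γ Tbar γ t₀ v U hK1 hK2 hK3 _ hc hc₀ hu hx hM hΓ _ _ _ _ hlow _ _ hx'
    hγ ht₀ hU hv hconv
  exfalso
  set k : ℝ := ((n:ℝ) - 2) / 2 with hk
  have hk0 : 0 < k := by linarith
  have hxl : ∀ i, 0 ≤ x i (lastIdx n h0) := fun i => nonneg_last_of_mem_closure h0 (hx i).1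
  have hxn : ∀ i, ‖x i‖ < 1 / 2 := fun i => mem_ball_zero_iff.1 (hx i).2
  have hM0 : ∀ i, 0 < M i := fun i => by
    rw [hM]
    exact (hu i).2.1 _ (mem_closure_halfBall h0 (by linarith [hxn i]) (hxl i))
  have hΓ0 : ∀ i, 0 < Γ i := fun i => by rw [hΓ]; exact Real.rpow_pos_of_pos (hM0 i) _
  have hΓk : ∀ i, Γ i ^ k = M i := fun i => by
    rw [hΓ, ← Real.rpow_mul (hM0 i).le, hk, div_mul_div_cancel₀' (by norm_num),
      div_self (by linarith), Real.rpow_one]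
  have hlow' : ∀ i : ℕ, ∀ z ∈ closure (halfBall n h0 (2 / 3)), (i : ℝ) < M i * u i z := by
    intro i z hz
    have hsub : closure (halfBall n h0 (2 / 3)) ⊆ closure (halfBall n h0 1) :=
      closure_mono (inter_subset_inter_left _ (ball_subset_ball (by norm_num)))
    refine (hlow i).trans_le (mul_le_mul_of_nonneg_left (csInf_le ⟨0, ?_⟩ ⟨z, hz, rfl⟩) (hM0 i).le)
    rintro _ ⟨w, hw, rfl⟩
    exact ((hu i).2.1 w (hsub hw)).le
  have hMt : Tendsto M atTop atTop := by
    refine tendsto_atTop.2 fun b => ?_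
    filter_upwards [tendsto_natCast_atTop_atTop.eventually_ge_atTop (|b| ^ 2)] with i hi
    have h1 := hlow' i (x i) (mem_closure_halfBall h0 (by linarith [hxn i]) (hxl i))
    rw [← hM, ← sq] at h1
    exact (le_abs_self b).trans (abs_le_of_sq_le_sq' (hi.trans h1.le) (hM0 i).le).2
  have hΓt : Tendsto Γ atTop atTop := by
    rw [funext hΓ]
    exact (tendsto_rpow_atTop (div_pos two_pos (by linarith))).comp hMt
  have hx'l : ∀ i, x' i (lastIdx n h0) = 0 := fun i => by simp [hx']
  have hx'n : ∀ i, ‖x' i‖ < 1 / 2 := fun i => by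
    refine lt_of_le_of_lt ?_ (hxn i)
    have h1 : inner ℝ (x' i) (x i (lastIdx n h0) • normalVec n h0) = 0 := by
      rw [real_inner_smul_right, real_inner_comm, inner_normalVec, hx'l, mul_zero]
    have h2 : x i = x' i + x i (lastIdx n h0) • normalVec n h0 := by
      rw [hx', normalVec, sub_add_cancel]
    have h3 := norm_add_sq_eq_norm_sq_add_norm_sq_of_inner_eq_zero _ _ h1
    rw [← h2] at h3
    exact abs_le_of_sq_le_sq' (by nlinarith [mul_self_nonneg ‖x i (lastIdx n h0) • normalVec n h0‖])
      (norm_nonneg _) |>.2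
  have hv' : v = fun i y => u i (x' i + (Γ i)⁻¹ • y) / Γ i ^ k := by
    funext i y
    rw [hv, hΓk]
  have hU' : U = fun y => (γ / (γ ^ 2 + ‖y - t₀ • normalVec n h0‖ ^ 2)) ^ k := funext hU
  rw [hv', hU'] at hconv
  have hlow'' : ∀ i : ℕ, ∀ z ∈ closure (halfBall n h0 (2 / 3)), (i : ℝ) ≤ Γ i ^ k * u i z :=
    fun i z hz => by rw [hΓk]; exact (hlow' i z hz).le
  have hnk : (n : ℝ) = 2 * k + 2 := by rw [hk]; ring
  rcases le_or_gt c₀ 0 with h | h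
  · rw [if_pos h] at hγ
    have hγ0 : 0 < γ := by rw [hγ]; positivity
    obtain ⟨ε₂, hε₂, hno₂⟩ := exists_no_blowup hn h0 hC₀.le hΛ
      (le_add_of_nonneg_right (by positivity) : (1:ℝ) ≤ 1 + |c₀ / ((n : ℝ) - 2)|)
    refine hno₂ K c c₀ u x' Γ γ t₀ k hnk hK1 hK2 hK3 hc (h.trans_lt hε₂) hu hx'l hx'n hΓ0 hΓt
      hlow'' hγ0 ?_ hconv
    rw [ht₀, mul_div_assoc, abs_mul, abs_of_pos hγ0, mul_comm]
    gcongr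
    linarith
  · rw [if_neg (not_le.2 h)] at hγ
    subst hγ
    refine hno₁ K c c₀ u x' Γ 1 t₀ k hnk hK1 hK2 hK3 hc (hc₀.trans_le (min_le_left _ _)) hu hx'l
      hx'n hΓ0 hΓt hlow'' one_pos ?_ hconv
    have h1 : c₀ < 1 := hc₀.trans_le (min_le_right _ _)
    rw [ht₀, one_mul, abs_of_nonneg (div_nonneg h.le (by linarith)), one_mul,
      div_le_one (by linarith)]
    linarith
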